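/- arXiv:2003.10705 — 2 statements merged into one kernel-verified Lean document; each statement's English description precedes it below -/
import Mathlib

section
/- If n ≥ 1, d₁, d₂ ∈ {0,…,9} with d₁ ≠ d₂ and d₁ > 0, and ℓ₁, ℓ₂ ≥ 1 satisfy P_n = (1/9)(d₁·10^{ℓ₁+ℓ₂} − (d₁ − d₂)·10^{ℓ₂} − d₂), then ℓ₁ ≤ 53. -/
/-- The Padovan sequence: `P 0 = 0`, `P 1 = 1`, `P 2 = 1`, `P (n+3) = P (n+1) + P n`. -/
def padovan : ℕ → ℕ
  | 0 => 0
  | 1 => 1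
  | 2 => 1
  | n + 3 => padovan (n + 1) + padovan n

/-! ### Part 1: the case `d₂ ≠ 0`, by a congruence sieve -/

/-- Test for one triple of parameters. -/
def sieveOne (P d e a : ℕ) : Bool :=
  !(Nat.beq ((9 * P + P % 10 + d * 10 ^ e) % 4000) ((P % 10 * 10 ^ e) % 4000)) ||
  Nat.beq d (P % 10) ||
  !(Nat.beq ((9 * P + P % 10 + d * 10 ^ e) % 4444000)
      ((P % 10 * 10 ^ e + d * 10 ^ (8 + (e + a) % 4)) % 4444000))

/-- Tests for all `a < k`. -/
def sieveA (P d e : ℕ) : ℕ → Bool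
  | 0 => true
  | k + 1 => sieveOne P d e k && sieveA P d e k

/-- Tests for all exponents below `k`. -/
def sieveE (P d : ℕ) : ℕ → Bool
  | 0 => true
  | k + 1 => (!(Nat.beq ((9 * P + P % 10 + d * 10 ^ (k + 1)) % 4000)
      ((P % 10 * 10 ^ (k + 1)) % 4000)) || sieveA P d (k + 1) 4) && sieveE P d k

/-- Tests for all digits `1..k`. -/
def sieveD (P K : ℕ) : ℕ → Bool
  | 0 => true
  | k + 1 => sieveE P (k + 1) K && sieveD P K k

/-- All tests for one residue. -/
def sieveN (P : ℕ) : Bool :=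
  Nat.beq (P % 10) 0 ||
    (sieveD P 1 9 && (!(Nat.beq ((9 * P + P % 10) % 100) 0) || sieveD P 8 9))

/-- Tests everything along one period. -/
def sieveWalk : ℕ → ℕ → ℕ → ℕ → Bool
  | 0, a, b, c => Nat.beq a 0 && Nat.beq b 1 && Nat.beq c 1
  | k + 1, a, b, c =>
    sieveN a &&
      match (a + b) % 4444000 with
      | 0 => sieveWalk k b c 0
      | s + 1 => sieveWalk k b c (s + 1)

/-- One segment of the period, from the state `a, b, c` to the state `x, y, z`. -/
def sieveTo (x y z : ℕ) : ℕ → ℕ → ℕ → ℕ → Bool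
  | 0, a, b, c => Nat.beq a x && Nat.beq b y && Nat.beq c z
  | k + 1, a, b, c =>
    sieveN a &&
      match (a + b) % 4444000 with
      | 0 => sieveTo x y z k b c 0
      | s + 1 => sieveTo x y z k b c (s + 1)

theorem sieveTo_step (x y z k a b c : ℕ) (h : sieveTo x y z (k + 1) a b c = true) :
    sieveN a = true ∧
      sieveTo x y z k b c ((a + b) % 4444000) = true := by
  rw [sieveTo, Bool.and_eq_true] at h
  refine ⟨h.1, ?_⟩
  have h2 := h.2
  split at h2
  · rename_i heq; rw [heq]; exact h2
  · rename_i heq; rw [heq]; exact h2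

theorem sieveTo_append (x y z m : ℕ) (hm : sieveWalk m x y z = true) :
    ∀ k a b c, sieveTo x y z k a b c = true → sieveWalk (m + k) a b c = true := by
  intro k
  induction k with
  | zero =>
    intro a b c h
    simp only [sieveTo, Bool.and_eq_true] at h
    obtain ⟨⟨e1, e2⟩, e3⟩ := h
    rw [Nat.eq_of_beq_eq_true e1, Nat.eq_of_beq_eq_true e2, Nat.eq_of_beq_eq_true e3]
    exact hm
  | succ k ih =>
    intro a b c h
    obtain ⟨h1, h2⟩ := sieveTo_step x y z k a b c h
    have h3 := ih _ _ _ h2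
    rw [← Nat.add_assoc, sieveWalk, h1, Bool.true_and]
    split
    · rename_i heq; rw [heq] at h3; exact h3
    · rename_i heq; rw [heq] at h3; exact h3

theorem sieve_segment_0 : sieveTo 209272 3358857 2483793 700 0 1 1 = true := by
  decide +kernel

theorem sieve_segment_1 : sieveTo 2254320 3427537 4327649 700 209272 3358857 2483793 = true := by
  decide +kernel

theorem sieve_segment_2 : sieveTo 757096 3470361 1465713 700 2254320 3427537 4327649 = true := by
  decide +kernel

theorem sieve_segment_3 : sieveTo 2769824 2333505 3425921 700 757096 3470361 1465713 = true := by
  decide +kernel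

theorem sieve_segment_4 : sieveTo 2946776 42825 1582065 700 2769824 2333505 3425921 = true := by
  decide +kernel

theorem sieve_segment_5 : sieveTo 2222000 2222001 1 700 2946776 42825 1582065 = true := by
  decide +kernel

theorem sieve_segment_6 : sieveTo 2431272 1136857 2483793 700 2222000 2222001 1 = true := by
  decide +kernel

theorem sieve_segment_7 : sieveTo 32320 1205537 4327649 700 2431272 1136857 2483793 = true := by
  decide +kernel

theorem sieve_segment_8 : sieveTo 2979096 1248361 1465713 700 32320 1205537 4327649 = true := by
  decide +kernel

theorem sieve_segment_9 : sieveTo 547824 111505 3425921 700 2979096 1248361 1465713 = true := by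
  decide +kernel

theorem sieve_segment_10 : sieveTo 724776 2264825 1582065 700 547824 111505 3425921 = true := by
  decide +kernel

theorem sieve_segment_11 : sieveTo 0 1 1 700 724776 2264825 1582065 = true := by
  decide +kernel

theorem sieveWalk_ok : sieveWalk 8400 0 1 1 = true := by
  have h0 : sieveWalk 0 0 1 1 = true := by decide
  have h1 := sieveTo_append _ _ _ 0 h0 700 _ _ _ sieve_segment_11
  have h2 := sieveTo_append _ _ _ 700 h1 700 _ _ _ sieve_segment_10
  have h3 := sieveTo_append _ _ _ 1400 h2 700 _ _ _ sieve_segment_9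
  have h4 := sieveTo_append _ _ _ 2100 h3 700 _ _ _ sieve_segment_8
  have h5 := sieveTo_append _ _ _ 2800 h4 700 _ _ _ sieve_segment_7
  have h6 := sieveTo_append _ _ _ 3500 h5 700 _ _ _ sieve_segment_6
  have h7 := sieveTo_append _ _ _ 4200 h6 700 _ _ _ sieve_segment_5
  have h8 := sieveTo_append _ _ _ 4900 h7 700 _ _ _ sieve_segment_4
  have h9 := sieveTo_append _ _ _ 5600 h8 700 _ _ _ sieve_segment_3
  have h10 := sieveTo_append _ _ _ 6300 h9 700 _ _ _ sieve_segment_2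
  have h11 := sieveTo_append _ _ _ 7000 h10 700 _ _ _ sieve_segment_1
  have h12 := sieveTo_append _ _ _ 7700 h11 700 _ _ _ sieve_segment_0
  exact h12

theorem sieveWalk_step (k a b c : ℕ) (h : sieveWalk (k + 1) a b c = true) :
    sieveN a = true ∧
      sieveWalk k b c ((a + b) % 4444000) = true := by
  rw [sieveWalk, Bool.and_eq_true] at h
  refine ⟨h.1, ?_⟩
  have h2 := h.2
  split at h2
  · rename_i heq; rw [heq]; exact h2
  · rename_i heq; rw [heq]; exact h2

theorem padovan_rec (n : ℕ) : padovan (n + 3) = padovan (n + 1) + padovan n := rfl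

theorem sieveWalk_all (k : ℕ) : ∀ j : ℕ,
    sieveWalk k (padovan j % 4444000) (padovan (j + 1) % 4444000)
      (padovan (j + 2) % 4444000) = true →
    (∀ i < k, sieveN (padovan (j + i) % 4444000) = true) ∧
    padovan (j + k) % 4444000 = 0 ∧ padovan (j + k + 1) % 4444000 = 1 ∧
    padovan (j + k + 2) % 4444000 = 1 := by
  induction k with
  | zero =>
    intro j h
    rw [sieveWalk] at h
    simp only [Bool.and_eq_true] at h
    exact ⟨fun i hi => absurd hi (by omega), Nat.eq_of_beq_eq_true h.1.1,
      Nat.eq_of_beq_eq_true h.1.2, Nat.eq_of_beq_eq_true h.2⟩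
  | succ k ih =>
    intro j h
    obtain ⟨h1, h2⟩ := sieveWalk_step _ _ _ _ h
    have e : (padovan j % 4444000 + padovan (j + 1) % 4444000) % 4444000
        = padovan (j + 1 + 2) % 4444000 := by
      rw [show j + 1 + 2 = j + 3 from rfl, padovan_rec, ← Nat.add_mod, Nat.add_comm]
    rw [e] at h2
    obtain ⟨h3, h4, h5, h6⟩ := ih (j + 1) h2
    have ej : j + (k + 1) = j + 1 + k := by omega
    refine ⟨?_, by rw [ej]; exact h4, by rw [ej]; exact h5, by rw [ej]; exact h6⟩
    intro i hi
    rcases i with _ | i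
    · exact h1
    · rw [show j + (i + 1) = j + 1 + i by omega]
      exact h3 i (by omega)

theorem sieve_all_zero (k : ℕ) (h : sieveWalk k 0 1 1 = true) :
    (∀ i < k, sieveN (padovan i % 4444000) = true) ∧
    padovan k % 4444000 = 0 ∧ padovan (k + 1) % 4444000 = 1 ∧
    padovan (k + 2) % 4444000 = 1 := by
  have := sieveWalk_all k 0 h
  simpa only [Nat.zero_add] using this

theorem padovan_period_gen (T m : ℕ) (hm : 1 < m) (h0 : padovan T % m = 0)
    (h1 : padovan (T + 1) % m = 1) (h2 : padovan (T + 2) % m = 1) (n : ℕ) :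
    padovan (n + T) % m = padovan n % m := by
  have key : ∀ n, padovan (n + T) % m = padovan n % m ∧
      padovan (n + 1 + T) % m = padovan (n + 1) % m ∧
      padovan (n + 2 + T) % m = padovan (n + 2) % m := by
    intro n
    induction n with
    | zero =>
      refine ⟨?_, ?_, ?_⟩
      · rw [Nat.zero_add, h0]; simp [padovan]
      · rw [Nat.zero_add, Nat.add_comm 1 T, h1]; simp [padovan, Nat.mod_eq_of_lt hm]
      · rw [Nat.zero_add, Nat.add_comm 2 T, h2]; simp [padovan, Nat.mod_eq_of_lt hm]
    | succ n ih =>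
      obtain ⟨i0, i1, i2⟩ := ih
      refine ⟨i1, i2, ?_⟩
      have e1 : padovan (n + 1 + 2 + T) = padovan (n + 1 + T) + padovan (n + T) := by
        rw [show n + 1 + 2 + T = n + T + 3 by omega, padovan_rec,
          show n + T + 1 = n + 1 + T by omega]
      have e2 : padovan (n + 1 + 2) = padovan (n + 1) + padovan n := padovan_rec n
      rw [e1, e2, Nat.add_mod, i0, i1, ← Nat.add_mod]
  exact (key n).1

theorem padovan_mod_period_gen (T m : ℕ) (hm : 1 < m) (h0 : padovan T % m = 0)
    (h1 : padovan (T + 1) % m = 1) (h2 : padovan (T + 2) % m = 1) (n : ℕ) :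
    padovan n % m = padovan (n % T) % m := by
  have h : ∀ k r : ℕ, padovan (r + T * k) % m = padovan r % m := by
    intro k
    induction k with
    | zero => intro r; rfl
    | succ k ih =>
      intro r
      rw [show r + T * (k + 1) = (r + T * k) + T by ring, padovan_period_gen T m hm h0 h1 h2, ih]
  conv_lhs => rw [← Nat.mod_add_div n T]
  exact h _ _

theorem sieve_gen (k : ℕ) (hk : 0 < k) (h : sieveWalk k 0 1 1 = true) (n : ℕ) :
    sieveN (padovan n % 4444000) = true := by
  obtain ⟨h1, h2, h3, h4⟩ := sieve_all_zero k h
  rw [padovan_mod_period_gen k 4444000 (by norm_num) h2 h3 h4 n]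
  exact h1 _ (Nat.mod_lt _ hk)

theorem sieveD_spec (P E K : ℕ) (h : sieveD P E K = true) :
    ∀ d, 1 ≤ d → d ≤ K → sieveE P d E = true := by
  induction K with
  | zero => intro d h1 h2; omega
  | succ k ih =>
    rw [sieveD, Bool.and_eq_true] at h
    intro d h1 h2
    rcases Nat.lt_or_ge d (k + 1) with h3 | h3
    · exact ih h.2 d h1 (by omega)
    · obtain rfl : d = k + 1 := by omega
      exact h.1

theorem sieveE_spec (P d K : ℕ) (h : sieveE P d K = true) :
    ∀ e, 1 ≤ e → e ≤ K → (!(Nat.beq ((9 * P + P % 10 + d * 10 ^ e) % 4000)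
      ((P % 10 * 10 ^ e) % 4000)) || sieveA P d e 4) = true := by
  induction K with
  | zero => intro e h1 h2; omega
  | succ k ih =>
    rw [sieveE, Bool.and_eq_true] at h
    intro e h1 h2
    rcases Nat.lt_or_ge e (k + 1) with h3 | h3
    · exact ih h.2 e h1 (by omega)
    · obtain rfl : e = k + 1 := by omega
      exact h.1

theorem sieveA_spec (P d e K : ℕ) (h : sieveA P d e K = true) :
    ∀ a, a < K → sieveOne P d e a = true := by
  induction K with
  | zero => intro a h2; omega
  | succ k ih =>
    rw [sieveA, Bool.and_eq_true] at h
    intro a h2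
    rcases Nat.lt_or_ge a k with h3 | h3
    · exact ih h.2 a (by omega)
    · obtain rfl : a = k := by omega
      exact h.1

/-- Powers of ten are periodic modulo `4444000`. -/
theorem ten_pow_mod (k j : ℕ) (hk : 5 ≤ k) : 10 ^ (k + 4 * j) % 4444000 = 10 ^ k % 4444000 := by
  induction j with
  | zero => rfl
  | succ j ih =>
    rw [← ih]
    obtain ⟨i, hi⟩ : ∃ i, k + 4 * j = i + 5 := ⟨k + 4 * j - 5, by omega⟩
    rw [show k + 4 * (j + 1) = (i + 5) + 4 by omega, hi]
    have e : (10:ℕ) ^ (i + 5 + 4) = 10 ^ (i + 5) + 4444000 * (10 ^ i * 225) := by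
      rw [pow_add, pow_add]; ring
    rw [e, Nat.add_mul_mod_self_left]

theorem case_d2_pos (n d₁ d₂ ℓ₁ ℓ₂ : ℕ)
    (hd₁ : d₁ ≤ 9) (hd₂ : d₂ ≤ 9) (hne : d₁ ≠ d₂) (hd₁pos : 0 < d₁)
    (hℓ₁ : 54 ≤ ℓ₁) (hℓ₂ : 1 ≤ ℓ₂)
    (heq : 9 * padovan n + d₂ + d₁ * 10 ^ ℓ₂ = d₂ * 10 ^ ℓ₂ + d₁ * 10 ^ (ℓ₁ + ℓ₂))
    (h0 : d₂ ≠ 0) : False := by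
  -- reduce the exponents
  obtain ⟨e, he1, he8, hemod, he4⟩ : ∃ e, 1 ≤ e ∧ e ≤ 8 ∧
      10 ^ ℓ₂ % 4444000 = 10 ^ e % 4444000 ∧ ℓ₂ % 4 = e % 4 := by
    rcases Nat.lt_or_ge ℓ₂ 9 with h | h
    · exact ⟨ℓ₂, hℓ₂, by omega, rfl, rfl⟩
    · refine ⟨5 + (ℓ₂ - 5) % 4, by omega, by omega, ?_, by omega⟩
      have := ten_pow_mod (5 + (ℓ₂ - 5) % 4) ((ℓ₂ - 5) / 4) (by omega)
      rw [← this]; congr 2; omega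
  have hbig : 10 ^ (ℓ₁ + ℓ₂) % 4444000 = 10 ^ (8 + (e + ℓ₁ % 4) % 4) % 4444000 := by
    have := ten_pow_mod (8 + (e + ℓ₁ % 4) % 4) ((ℓ₁ + ℓ₂ - 8) / 4) (by omega)
    rw [← this]; congr 2; omega
  set P := padovan n % 4444000 with hP
  have hd : P % 10 = d₂ := by
    have h10 : ∀ k, 1 ≤ k → 10 ^ k % 10 = 0 := by
      intro k hk
      obtain ⟨j, rfl⟩ : ∃ j, k = j + 1 := ⟨k - 1, by omega⟩
      rw [pow_succ]; omega
    have a1 := h10 ℓ₂ hℓ₂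
    have a2 := h10 (ℓ₁ + ℓ₂) (by omega)
    have b1 : (d₁ * 10 ^ ℓ₂) % 10 = 0 := by rw [Nat.mul_mod, a1]; simp
    have b2 : (d₂ * 10 ^ ℓ₂) % 10 = 0 := by rw [Nat.mul_mod, a1]; simp
    have b3 : (d₁ * 10 ^ (ℓ₁ + ℓ₂)) % 10 = 0 := by rw [Nat.mul_mod, a2]; simp
    omega
  have hmod : (9 * P + P % 10 + d₁ * 10 ^ e) % 4444000 =
      (P % 10 * 10 ^ e + d₁ * 10 ^ (8 + (e + ℓ₁ % 4) % 4)) % 4444000 := by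
    have c1 : (9 * P + P % 10 + d₁ * 10 ^ e) ≡ 9 * padovan n + d₂ + d₁ * 10 ^ ℓ₂ [MOD 4444000] := by
      rw [hd]
      refine Nat.ModEq.add (Nat.ModEq.add (Nat.ModEq.mul_left _ ?_) rfl)
        (Nat.ModEq.mul_left _ hemod.symm)
      exact Nat.mod_modEq _ _
    have c2 : (P % 10 * 10 ^ e + d₁ * 10 ^ (8 + (e + ℓ₁ % 4) % 4)) ≡
        d₂ * 10 ^ ℓ₂ + d₁ * 10 ^ (ℓ₁ + ℓ₂) [MOD 4444000] := by
      rw [hd]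
      exact Nat.ModEq.add (Nat.ModEq.mul_left _ hemod.symm) (Nat.ModEq.mul_left _ hbig.symm)
    exact c1.trans ((congrArg (· % 4444000) heq).trans c2.symm)
  have hmod4 : (9 * P + P % 10 + d₁ * 10 ^ e) % 4000 = (P % 10 * 10 ^ e) % 4000 := by
    have h1 : (9 * P + P % 10 + d₁ * 10 ^ e) % 4000 =
      (P % 10 * 10 ^ e + d₁ * 10 ^ (8 + (e + ℓ₁ % 4) % 4)) % 4000 := by
      have := Nat.ModEq.of_dvd (show 4000 ∣ 4444000 by norm_num) hmod
      exact this
    rw [h1]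
    have : d₁ * 10 ^ (8 + (e + ℓ₁ % 4) % 4) = 4000 * (d₁ * 25000 * 10 ^ ((e + ℓ₁ % 4) % 4)) := by
      rw [pow_add]; ring
    rw [this, Nat.add_mul_mod_self_left]
  have hs := sieve_gen 8400 (by norm_num) sieveWalk_ok n
  have fin : ∀ E, e ≤ E → sieveD P E 9 = true → False := by
    intro E hE hs
    have h1 := sieveE_spec P d₁ E (sieveD_spec P E 9 hs d₁ hd₁pos hd₁) e he1 hE
    rw [hmod4] at h1
    simp only [Nat.beq_refl, Bool.not_true, Bool.false_or] at h1
    have h2 := sieveA_spec P d₁ e 4 h1 (ℓ₁ % 4) (Nat.mod_lt _ (by norm_num))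
    rw [sieveOne, hmod4, hmod] at h2
    simp only [Nat.beq_refl, Bool.not_true, Bool.false_or, Bool.or_false] at h2
    have := Nat.eq_of_beq_eq_true h2
    omega
  rw [← hP, sieveN, Bool.or_eq_true, Bool.and_eq_true, Bool.or_eq_true] at hs
  rcases hs with hs | ⟨hs, hs'⟩
  · have := Nat.eq_of_beq_eq_true hs
    omega
  · rcases Nat.lt_or_ge e 2 with h2 | h2
    · exact fin 1 (by omega) hs
    · rcases hs' with hs' | hs'
      · have h100 : (9 * P + P % 10) % 100 = 0 := by
          obtain ⟨j, rfl⟩ : ∃ j, e = j + 2 := ⟨e - 2, by omega⟩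
          have e1 : d₁ * 10 ^ (j + 2) = 100 * (d₁ * 10 ^ j) := by rw [pow_add]; ring
          have e2 : P % 10 * 10 ^ (j + 2) = 100 * (P % 10 * 10 ^ j) := by rw [pow_add]; ring
          rw [e1, e2] at hmod4
          omega
        rw [h100] at hs'
        simp at hs'
      · exact fin 8 he8 hs'

/-! ### Part 2: 2-adic bound for `ℓ₂` in the case `d₂ = 0` -/

/-- The Padovan sequence shifted by 16. -/
def padS : ℕ → ℤ
  | 0 => 0
  | 1 => -3
  | 2 => 4
  | n + 3 => padS (n + 1) + padS n

theorem padS_rec (n : ℕ) : padS (n + 3) = padS (n + 1) + padS n := rfl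

theorem padS_eq (n : ℕ) : padS (n + 16) = padovan n := by
  have key : ∀ n, padS (n + 16) = padovan n ∧ padS (n + 1 + 16) = padovan (n + 1) ∧
      padS (n + 2 + 16) = padovan (n + 2) := by
    intro n
    induction n with
    | zero => decide
    | succ n ih =>
      obtain ⟨i0, i1, i2⟩ := ih
      refine ⟨i1, i2, ?_⟩
      rw [show n + 1 + 2 + 16 = n + 16 + 3 by omega, padS_rec, show n + 1 + 2 = n + 3 by omega,
        padovan_rec, i0, show n + 16 + 1 = n + 1 + 16 by omega, i1]
      push_cast; ring
  exact (key n).1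

theorem padS_base (m : ℕ) : padS (m + 28) = 465 * padS m + 816 * padS (m + 1) + 616 * padS (m + 2) := by
  simp only [padS_rec]
  ring

theorem padS_shift (k : ℕ) : ∃ a b c : ℤ, ∀ m, padS (m + 28 * 2 ^ k) =
    padS m + 8 * 2 ^ k * ((58 + 4 * a) * padS m + (102 + 4 * b) * padS (m + 1)
      + (77 + 4 * c) * padS (m + 2)) := by
  induction k with
  | zero =>
    refine ⟨0, 0, 0, fun m => ?_⟩
    rw [pow_zero, Nat.mul_one, padS_base]
    ring
  | succ k ih =>
    obtain ⟨a, b, c, h⟩ := ih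
    refine ⟨a + 2 ^ k * ((58 + 4 * a) ^ 2 + 2 * (102 + 4 * b) * (77 + 4 * c)),
      b + 2 ^ k * (2 * (58 + 4 * a) * (102 + 4 * b) + 2 * (102 + 4 * b) * (77 + 4 * c)
        + (77 + 4 * c) ^ 2),
      c + 2 ^ k * ((102 + 4 * b) ^ 2 + 2 * (58 + 4 * a) * (77 + 4 * c) + (77 + 4 * c) ^ 2),
      fun m => ?_⟩
    have h0 := h (m + 28 * 2 ^ k)
    have h1 := h m
    have h2 := h (m + 1)
    have h3 := h (m + 2)
    rw [show m + 1 + 28 * 2 ^ k = m + 28 * 2 ^ k + 1 by omega] at h2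
    rw [show m + 2 + 28 * 2 ^ k = m + 28 * 2 ^ k + 2 by omega] at h3
    have r1 : padS (m + 1 + 2) = padS (m + 1) + padS m := padS_rec m
    have r3 : padS (m + 2 + 2) = padS (m + 2) + padS (m + 1) := padS_rec (m + 1)
    rw [show m + 28 * 2 ^ (k + 1) = m + 28 * 2 ^ k + 28 * 2 ^ k by ring, h0, h1, h2, h3, r1, r3,
      show m + 1 + 1 = m + 2 by omega]
    ring

theorem padS_shift_mul (k u m : ℕ) : ∃ w : ℤ, padS (m + 28 * 2 ^ k * u) =
    padS m + 8 * 2 ^ k * (u * (58 * padS m + 102 * padS (m + 1) + 77 * padS (m + 2)) + 4 * w) := by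
  obtain ⟨a, b, c, h⟩ := padS_shift k
  have aux : ∀ u : ℕ, ∀ m : ℕ, ∃ v : ℤ, padS (m + 28 * 2 ^ k * u) = padS m + 4 * v := by
    intro u
    induction u with
    | zero => intro m; exact ⟨0, by simp⟩
    | succ u ih =>
      intro m
      obtain ⟨v, hv⟩ := ih m
      refine ⟨v + 2 * 2 ^ k * ((58 + 4 * a) * padS (m + 28 * 2 ^ k * u)
        + (102 + 4 * b) * padS (m + 28 * 2 ^ k * u + 1)
        + (77 + 4 * c) * padS (m + 28 * 2 ^ k * u + 2)), ?_⟩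
      rw [show m + 28 * 2 ^ k * (u + 1) = m + 28 * 2 ^ k * u + 28 * 2 ^ k by ring, h]
      linear_combination hv
  induction u with
  | zero => exact ⟨0, by simp⟩
  | succ u ih =>
    obtain ⟨w, hw⟩ := ih
    obtain ⟨v0, hv0⟩ := aux u m
    obtain ⟨v1, hv1⟩ := aux u (m + 1)
    obtain ⟨v2, hv2⟩ := aux u (m + 2)
    rw [show m + 1 + 28 * 2 ^ k * u = m + 28 * 2 ^ k * u + 1 by omega] at hv1
    rw [show m + 2 + 28 * 2 ^ k * u = m + 28 * 2 ^ k * u + 2 by omega] at hv2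
    refine ⟨w + (58 + 4 * a) * v0 + (102 + 4 * b) * v1 + (77 + 4 * c) * v2
      + a * padS m + b * padS (m + 1) + c * padS (m + 2), ?_⟩
    rw [show m + 28 * 2 ^ k * (u + 1) = m + 28 * 2 ^ k * u + 28 * 2 ^ k by ring, h, hv1, hv2]
    rw [show (58 + 4 * a) * padS (m + 28 * 2 ^ k * u) = (58 + 4 * a) * (padS m + 4 * v0) by rw [hv0],
      hw]
    push_cast
    ring

theorem padS_zero_base (m : ℕ) (h : (16 : ℤ) ∣ padS m) :
    ∃ z ∈ [0, 9, 13, 14, 16], ∃ u, m = z + 28 * u ∨ m + 28 * u = z := by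
  have hper : ∀ u r : ℕ, padS (r + 56 * u) % 16 = padS r % 16 := by
    intro u r
    obtain ⟨w, hw⟩ := padS_shift_mul 1 u r
    rw [show r + 56 * u = r + 28 * 2 ^ 1 * u by ring, hw]
    omega
  have h56 := hper (m / 56) (m % 56)
  rw [Nat.mod_add_div] at h56
  have hz : padS (m % 56) % 16 = 0 := by omega
  have hall : ∀ r < 56, padS r % 16 = 0 → r ∈ [0, 9, 13, 14, 16, 28, 42] := by decide
  have hm := hall _ (Nat.mod_lt m (by norm_num)) hz
  simp only [List.mem_cons, List.not_mem_nil, or_false] at hm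
  rcases hm with h | h | h | h | h | h | h
  · exact ⟨0, by simp, 2 * (m / 56), by omega⟩
  · exact ⟨9, by simp, 2 * (m / 56), by omega⟩
  · exact ⟨13, by simp, 2 * (m / 56), by omega⟩
  · exact ⟨14, by simp, 2 * (m / 56), by omega⟩
  · exact ⟨16, by simp, 2 * (m / 56), by omega⟩
  · exact ⟨0, by simp, 2 * (m / 56) + 1, by omega⟩
  · exact ⟨14, by simp, 2 * (m / 56) + 1, by omega⟩

theorem padS_zero (k m : ℕ) (hm : 17 ≤ m) (h : (16 : ℤ) * 2 ^ k ∣ padS m) :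
    ∃ z ∈ [0, 9, 13, 14, 16], ∃ u, m = z + 28 * 2 ^ k * u := by
  induction k with
  | zero =>
    obtain ⟨z, hz, u, hu⟩ := padS_zero_base m (by simpa using h)
    refine ⟨z, hz, u, ?_⟩
    simp only [List.mem_cons, List.not_mem_nil, or_false] at hz
    omega
  | succ k ih =>
    obtain ⟨z, hz, u, hu⟩ := ih (Dvd.dvd.trans ⟨2, by ring⟩ h)
    refine ⟨z, hz, u / 2, ?_⟩
    obtain ⟨w, hw⟩ := padS_shift_mul k u z
    rw [← hu] at hw
    obtain ⟨v, hv⟩ := h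
    have h2 : (2:ℤ) ^ k ≠ 0 := by positivity
    have hz0 : padS z = 0 := by
      simp only [List.mem_cons, List.not_mem_nil, or_false] at hz
      rcases hz with rfl | rfl | rfl | rfl | rfl <;> rfl
    rw [hv, hz0] at hw
    have h4 : 4 * v = u * (58 * 0 + 102 * padS (z + 1) + 77 * padS (z + 2)) + 4 * w := by
      have : (8 * 2 ^ k) * (4 * v) = (8 * 2 ^ k) * (u * (58 * 0 + 102 * padS (z + 1) + 77 * padS (z + 2)) + 4 * w) := by
        rw [← zero_add ((8 * 2 ^ k) * (u * (58 * 0 + 102 * padS (z + 1) + 77 * padS (z + 2)) + 4 * w)), ← hw]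
        ring
      exact mul_left_cancel₀ (by positivity) this
    have hue : u % 2 = 0 := by
      simp only [List.mem_cons, List.not_mem_nil, or_false] at hz
      rcases hz with rfl | rfl | rfl | rfl | rfl
      · rw [show padS (0 + 1) = -3 by decide, show padS (0 + 2) = 4 by decide] at h4; omega
      · rw [show padS (9 + 1) = 1 by decide, show padS (9 + 2) = -1 by decide] at h4; omega
      · rw [show padS (13 + 1) = 0 by decide, show padS (13 + 2) = 1 by decide] at h4; omega
      · rw [show padS (14 + 1) = 1 by decide, show padS (14 + 2) = 0 by decide] at h4; omega
      · rw [show padS (16 + 1) = 1 by decide, show padS (16 + 2) = 1 by decide] at h4; omega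
    obtain ⟨v, rfl⟩ : ∃ v, u = 2 * v := ⟨u / 2, by omega⟩
    rw [hu, Nat.mul_div_cancel_left _ (by norm_num : 0 < 2)]
    ring

/-- If `2 ^ ℓ` divides `P n` with `n ≥ 1` then `7 * 2 ^ ℓ ≤ 4 * (n + 16)`, for `ℓ ≥ 4`. -/
theorem two_pow_dvd_padovan (n ℓ : ℕ) (hn : 1 ≤ n) (hℓ : 4 ≤ ℓ) (h : 2 ^ ℓ ∣ padovan n) :
    7 * 2 ^ ℓ ≤ 4 * (n + 16) := by
  obtain ⟨k, rfl⟩ : ∃ k, ℓ = k + 4 := ⟨ℓ - 4, by omega⟩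
  have h' : (16 : ℤ) * 2 ^ k ∣ padS (n + 16) := by
    rw [padS_eq]
    have := Int.natCast_dvd_natCast.mpr h
    rw [pow_add] at this
    push_cast at this
    rw [mul_comm]
    exact_mod_cast this
  obtain ⟨z, hz, u, hu⟩ := padS_zero k (n + 16) (by omega) h'
  simp only [List.mem_cons, List.not_mem_nil, or_false] at hz
  have hu1 : 1 ≤ u := by
    rcases Nat.eq_zero_or_pos u with h0 | h0
    · subst h0; omega
    · exact h0
  have : 28 * 2 ^ k * 1 ≤ 28 * 2 ^ k * u := Nat.mul_le_mul_left _ hu1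
  rw [pow_add]
  omega

/-! ### Part 3: the roots of `X ^ 3 - X - 1`, asymptotics and the norm inequality -/

theorem exists_alpha : ∃ α : ℝ, α ^ 3 = α + 1 ∧ 1.3247 < α ∧ α < 1.3248 := by
  have hc : ContinuousOn (fun x : ℝ => x ^ 3 - x - 1) (Set.Icc 1.3247 1.3248) := by fun_prop
  have := intermediate_value_Ioo (by norm_num : (1.3247 : ℝ) ≤ 1.3248) hc
  have h0 : (0 : ℝ) ∈ Set.Ioo ((fun x : ℝ => x ^ 3 - x - 1) 1.3247)
      ((fun x : ℝ => x ^ 3 - x - 1) 1.3248) := by constructor <;> norm_num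
  obtain ⟨x, hx, hx0⟩ := this h0
  exact ⟨x, by simp only at hx0; linarith, hx.1, hx.2⟩

theorem exists_beta (α : ℝ) (hα : α ^ 3 = α + 1) (h1 : 1.3247 < α) (h2 : α < 1.3248) :
    ∃ y : ℝ, y ^ 2 = (α ^ 2 - 1) - α ^ 2 / 4 ∧
      (⟨-α / 2, y⟩ : ℂ) ^ 3 = (⟨-α / 2, y⟩ : ℂ) + 1 ∧
      ‖(⟨-α / 2, y⟩ : ℂ)‖ ^ 2 = α ^ 2 - 1 := by
  have hpos : 0 ≤ (α ^ 2 - 1) - α ^ 2 / 4 := by nlinarith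
  refine ⟨√((α ^ 2 - 1) - α ^ 2 / 4), Real.sq_sqrt hpos, ?_, ?_⟩
  · have hs := Real.sq_sqrt hpos
    generalize √((α ^ 2 - 1) - α ^ 2 / 4) = y at hs
    apply Complex.ext
    · simp only [pow_succ, pow_zero, one_mul, Complex.mul_re, Complex.mul_im, Complex.add_re,
        Complex.one_re]
      linear_combination hα + (3 * α / 2) * hs
    · simp only [pow_succ, pow_zero, one_mul, Complex.mul_re, Complex.mul_im, Complex.add_im,
        Complex.one_im]
      linear_combination - y * hs
  · have hs := Real.sq_sqrt hpos
    generalize √((α ^ 2 - 1) - α ^ 2 / 4) = y at hs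
    rw [← Complex.normSq_eq_norm_sq, Complex.normSq_mk]
    linear_combination hs

/-- The norm form of `ℤ[α]`. -/
def nform (u v w : ℤ) : ℤ :=
  u ^ 3 + v ^ 3 + w ^ 3 + 2 * u ^ 2 * w + u * w ^ 2 - u * v ^ 2 - v * w ^ 2 - 3 * u * v * w

theorem nform_even (u v w : ℤ) (h : nform u v w % 2 = 0) : u % 2 = 0 ∧ v % 2 = 0 ∧ w % 2 = 0 := by
  have e : nform u v w % 2 = nform (u % 2) (v % 2) (w % 2) % 2 := by
    have hu : u ≡ u % 2 [ZMOD 2] := (Int.mod_modEq u 2).symm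
    have hv : v ≡ v % 2 [ZMOD 2] := (Int.mod_modEq v 2).symm
    have hw : w ≡ w % 2 [ZMOD 2] := (Int.mod_modEq w 2).symm
    have : nform u v w ≡ nform (u % 2) (v % 2) (w % 2) [ZMOD 2] := by
      unfold nform
      gcongr
    exact this
  rw [h] at e
  rcases Int.emod_two_eq_zero_or_one u with a | a <;>
  rcases Int.emod_two_eq_zero_or_one v with b | b <;>
  rcases Int.emod_two_eq_zero_or_one w with c | c <;>
  rw [a, b, c] at e <;> first | exact ⟨a, b, c⟩ | (exfalso; revert e; decide)

theorem nform_ne_zero (k : ℕ) : ∀ u v w : ℤ, u.natAbs + v.natAbs + w.natAbs ≤ k →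
    nform u v w = 0 → u = 0 ∧ v = 0 ∧ w = 0 := by
  induction k using Nat.strong_induction_on with
  | _ k ih =>
    intro u v w hk h
    obtain ⟨a, b, c⟩ := nform_even u v w (by rw [h]; rfl)
    obtain ⟨u', rfl⟩ : ∃ t, u = 2 * t := ⟨u / 2, by omega⟩
    obtain ⟨v', rfl⟩ : ∃ t, v = 2 * t := ⟨v / 2, by omega⟩
    obtain ⟨w', rfl⟩ : ∃ t, w = 2 * t := ⟨w / 2, by omega⟩
    have h' : nform u' v' w' = 0 := by
      have : nform (2 * u') (2 * v') (2 * w') = 8 * nform u' v' w' := by unfold nform; ring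
      omega
    by_cases h0 : u'.natAbs + v'.natAbs + w'.natAbs = 0
    · omega
    · have := ih (u'.natAbs + v'.natAbs + w'.natAbs) (by omega) u' v' w' le_rfl h'
      omega

open Polynomial in
theorem norm_form (α : ℝ) (hα : α ^ 3 = α + 1) (y : ℝ) (hy : y ^ 2 = (α ^ 2 - 1) - α ^ 2 / 4)
    (hβ : (⟨-α / 2, y⟩ : ℂ) ^ 3 = (⟨-α / 2, y⟩ : ℂ) + 1) (f : ℤ[X]) :
    ∃ N : ℤ, aeval α f * ‖aeval (⟨-α / 2, y⟩ : ℂ) f‖ ^ 2 = N ∧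
      (N = 0 → aeval α f = 0 ∧ aeval (⟨-α / 2, y⟩ : ℂ) f = 0) := by
  set β : ℂ := ⟨-α / 2, y⟩ with hβdef
  set m : ℤ[X] := X ^ 3 - X - 1 with hm
  have hmm : m.Monic := by rw [hm]; monicity!
  have hdeg : m.natDegree = 3 := by rw [hm]; compute_degree!
  set r := f %ₘ m with hr
  have hfr : f = r + m * (f /ₘ m) := (modByMonic_add_div f m).symm
  have hrdeg : r.natDegree < 3 := by
    rw [← hdeg]; exact natDegree_modByMonic_lt f hmm (by intro h; rw [h] at hdeg; simp at hdeg)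
  have hmα : aeval α m = 0 := by simp [hm, hα]
  have hmβ : aeval β m = 0 := by simp [hm, hβ]
  have hr3 : r = C (r.coeff 0) + C (r.coeff 1) * X + C (r.coeff 2) * X ^ 2 := by
    conv_lhs => rw [r.as_sum_range' 3 hrdeg]
    simp [Finset.sum_range_succ, ← C_mul_X_pow_eq_monomial]
  obtain ⟨u, v, w, hruvw⟩ : ∃ u v w : ℤ, r = C u + C v * X + C w * X ^ 2 := ⟨_, _, _, hr3⟩
  have e1 : aeval α f = u + v * α + w * α ^ 2 := by
    rw [hfr, map_add, map_mul, hmα, zero_mul, add_zero, hruvw]; simp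
  have e2 : aeval β f = u + v * β + w * β ^ 2 := by
    rw [hfr, map_add, map_mul, hmβ, zero_mul, add_zero, hruvw]; simp
  have e3 : ‖aeval β f‖ ^ 2 = u ^ 2 - u * v * α + u * w * (2 - α ^ 2) + v ^ 2 * (α ^ 2 - 1) - v * w
      + w ^ 2 * (α ^ 2 - 1) ^ 2 := by
    rw [e2, ← Complex.normSq_eq_norm_sq, Complex.normSq_apply, hβdef]
    simp only [pow_two, Complex.add_re, Complex.add_im, Complex.mul_re, Complex.mul_im,
      Complex.intCast_re, Complex.intCast_im]
    have hy4 : y ^ 4 = ((α ^ 2 - 1) - α ^ 2 / 4) ^ 2 := by rw [← hy]; ring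
    linear_combination (v ^ 2 - 2 * u * w - α * v * w + α ^ 2 / 2 * w ^ 2 : ℝ) * hy
      + (w : ℝ) ^ 2 * hy4 - (v * w : ℝ) * hα
  have e4 : aeval α f * ‖aeval β f‖ ^ 2 = nform u v w := by
    rw [e3, e1]; unfold nform; push_cast
    have h4 : α ^ 4 = α ^ 2 + α := by linear_combination α * hα
    have h5 : α ^ 5 = α ^ 2 + α + 1 := by linear_combination α * h4 + hα
    have h6 : α ^ 6 = α ^ 2 + 2 * α + 1 := by linear_combination α * h5 + hα
    ring_nf
    rw [h6, h5, h4, hα]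
    ring
  refine ⟨nform u v w, e4, fun h0 => ?_⟩
  obtain ⟨rfl, rfl, rfl⟩ := nform_ne_zero _ u v w le_rfl h0
  rw [e1, e2]; simp

open Polynomial in
theorem norm_ineq (α : ℝ) (hα : α ^ 3 = α + 1) (y : ℝ) (hy : y ^ 2 = (α ^ 2 - 1) - α ^ 2 / 4)
    (hβ : (⟨-α / 2, y⟩ : ℂ) ^ 3 = (⟨-α / 2, y⟩ : ℂ) + 1) (f : ℤ[X]) (hf : aeval α f ≠ 0) :
    1 ≤ |aeval α f| * ‖aeval (⟨-α / 2, y⟩ : ℂ) f‖ ^ 2 := by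
  obtain ⟨N, h1, h2⟩ := norm_form α hα y hy hβ f
  have hne : N ≠ 0 := fun h => hf (h2 h).1
  have : (1 : ℝ) ≤ |(N : ℝ)| := by
    rw [← Int.cast_abs]; exact_mod_cast Int.one_le_abs hne
  rw [← h1, abs_mul, abs_of_nonneg (sq_nonneg ‖aeval (⟨-α / 2, y⟩ : ℂ) f‖)] at this
  exact this

open Polynomial in
theorem alpha_pow_ne (α : ℝ) (hα : α ^ 3 = α + 1) (h1 : 1.3247 < α) (h2 : α < 1.3248)
    (a b : ℕ) (hb : 0 < b) : α ^ a ≠ 10 ^ b := by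
  intro h
  obtain ⟨y, hy, hβ, hn⟩ := exists_beta α hα h1 h2
  obtain ⟨N, e1, e2⟩ := norm_form α hα y hy hβ (X ^ a - C (10 ^ b))
  have h0 : aeval α (X ^ a - C (10 ^ b) : ℤ[X]) = 0 := by
    rw [map_sub, map_pow, aeval_X, aeval_C, h]; simp
  rw [h0, zero_mul] at e1
  have := (e2 (by exact_mod_cast e1.symm)).2
  generalize (⟨-α / 2, y⟩ : ℂ) = β at this hn
  have h3 : β ^ a = 10 ^ b := by
    rw [map_sub, map_pow, aeval_X, aeval_C, sub_eq_zero] at this; simpa using this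
  have h4 : ‖β‖ ^ a = 10 ^ b := by rw [← norm_pow, h3]; simp
  have h5 : ‖β‖ ≤ 1 := by
    have : ‖β‖ ^ 2 ≤ 1 := by rw [hn]; nlinarith
    nlinarith [norm_nonneg β]
  have h6 := pow_le_one₀ (n := a) (norm_nonneg β) h5
  rw [h4] at h6
  have : (1:ℝ) < 10 ^ b := one_lt_pow₀ (by norm_num) (by omega)
  linarith

theorem padovan_asymp (α : ℝ) (hα : α ^ 3 = α + 1) (h1 : 1.3247 < α) (h2 : α < 1.3248) (n : ℕ) :
    |(padovan n : ℝ) - α ^ (n + 3) / (3 * α ^ 2 - 1)| ≤ 1 := by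
  have hD : 0 < 3 * α ^ 2 - 1 := by nlinarith
  have hDinv : 3 * α ^ 2 - 1 ≠ 0 := hD.ne'
  have hr : ∀ n, α ^ (n + 3 + 3) / (3 * α ^ 2 - 1)
      = α ^ (n + 1 + 3) / (3 * α ^ 2 - 1) + α ^ (n + 3) / (3 * α ^ 2 - 1) := by
    intro n
    rw [← add_div]; congr 1
    linear_combination α ^ (n + 3) * hα
  set e : ℕ → ℝ := fun n => (padovan n : ℝ) - α ^ (n + 3) / (3 * α ^ 2 - 1) with he
  have hrec : ∀ n, e (n + 2) = - α * e (n + 1) - (α ^ 2 - 1) * e n := by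
    intro n
    induction n with
    | zero =>
      simp only [he, padovan]
      field_simp
      have h4 : α ^ 4 = α ^ 2 + α := by linear_combination α * hα
      have h5 : α ^ 5 = α ^ 2 + α + 1 := by linear_combination α * h4 + hα
      push_cast
      linear_combination 4 * hα - 3 * h5
    | succ n ih =>
      have a1 : e (n + 1 + 2) = e (n + 1) + e n := by
        simp only [he]
        rw [show n + 1 + 2 = n + 3 from rfl, hr n, padovan_rec]; push_cast; ring
      rw [a1, show n + 1 + 1 = n + 2 from rfl, ih]
      linear_combination (- e n) * hα
  set E : ℕ → ℝ := fun n => e (n + 1) ^ 2 + α * e (n + 1) * e n + (α ^ 2 - 1) * e n ^ 2 with hE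
  have hErec : ∀ n, E (n + 1) = (α ^ 2 - 1) * E n := by
    intro n
    simp only [hE]
    rw [show n + 1 + 1 = n + 2 from rfl, hrec n]; ring
  have hE0 : E 0 ≤ 0.2 := by
    obtain ⟨t, ht⟩ : ∃ t, t = α ^ 3 / (3 * α ^ 2 - 1) := ⟨_, rfl⟩
    have ht1 : 0.544 ≤ t := by rw [ht, le_div_iff₀ hD, hα]; nlinarith
    have ht2 : t ≤ 0.546 := by rw [ht, div_le_iff₀ hD, hα]; nlinarith
    have e0 : e 0 = - t := by simp only [he, padovan, ht]; push_cast; ring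
    have e1 : e 1 = 1 - α * t := by simp only [he, padovan, ht]; push_cast; ring
    simp only [hE]
    rw [e0, show 0 + 1 = 1 from rfl, e1]
    have a1 : 0.72 ≤ α * t := by nlinarith
    have a2 : α * t ≤ 0.7234 := by nlinarith
    have b1 : (1 - α * t) ^ 2 ≤ 0.0784 := by nlinarith
    have b2 : 0.19 ≤ (α * t) * (1 - α * t) := by nlinarith
    have b3 : (α ^ 2 - 1) * t ^ 2 ≤ 0.23 := by
      have : α ^ 2 - 1 ≤ 0.7552 := by nlinarith
      have : t ^ 2 ≤ 0.299 := by nlinarith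
      nlinarith [sq_nonneg t]
    nlinarith
  have hEn : ∀ n, E n ≤ 0.2 := by
    intro n
    induction n with
    | zero => exact hE0
    | succ n ih => 
      rw [hErec]
      have : α ^ 2 - 1 ≤ 1 := by nlinarith
      have : 0 ≤ α ^ 2 - 1 := by nlinarith
      nlinarith
  have hfin : e n ^ 2 ≤ 1 := by
    have := hEn n
    simp only [hE] at this
    nlinarith [sq_nonneg (e (n + 1) + α / 2 * e n), sq_nonneg (e n)]
  exact abs_le_one_iff_mul_self_le_one.mpr (by nlinarith)

/-! ### Part 4: the zero estimate (a generalized Wronskian) -/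

section ZeroEstimate

open Polynomial

theorem coeff_prod_top {ι : Type*} (s : Finset ι) (f : ι → ℝ[X]) (e : ι → ℕ)
    (h : ∀ i ∈ s, (f i).natDegree ≤ e i) :
    (∏ i ∈ s, f i).natDegree ≤ ∑ i ∈ s, e i ∧
    (∏ i ∈ s, f i).coeff (∑ i ∈ s, e i) = ∏ i ∈ s, (f i).coeff (e i) := by
  classical
  induction s using Finset.induction_on with
  | empty => simp
  | insert a s ha ih =>
    obtain ⟨h1, h2⟩ := ih (fun i hi => h i (Finset.mem_insert_of_mem hi))
    have h3 := h a (Finset.mem_insert_self _ _)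
    rw [Finset.prod_insert ha, Finset.sum_insert ha, Finset.prod_insert ha]
    refine ⟨natDegree_mul_le.trans (add_le_add h3 h1), ?_⟩
    rw [coeff_mul_add_eq_of_natDegree_le h3 h1, h2]

/-- `(X d/dX + q j)^k` applied to the `j`-th column polynomial. -/
noncomputable def zH (g : ℕ → ℕ → ℝ) (D0 q k j : ℕ) : ℝ[X] :=
  ∑ i ∈ Finset.range D0, C (g i j * ((i + q * j : ℕ) : ℝ) ^ k) * X ^ i

theorem zH_coeff (g : ℕ → ℕ → ℝ) (D0 q k j i : ℕ) (hi : i < D0) :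
    (zH g D0 q k j).coeff i = g i j * ((i + q * j : ℕ) : ℝ) ^ k := by
  unfold zH
  rw [finsetSum_coeff, Finset.sum_eq_single i]
  · rw [coeff_C_mul_X_pow]; simp
  · intro b _ hb; rw [coeff_C_mul_X_pow, if_neg (Ne.symm hb)]
  · intro h; exact absurd (Finset.mem_range.mpr hi) h

theorem zH_natDegree (g : ℕ → ℕ → ℝ) (D0 q k j e : ℕ) (he : ∀ i < D0, e < i → g i j = 0) :
    (zH g D0 q k j).natDegree ≤ e := by
  unfold zH
  apply natDegree_sum_le_of_forall_le
  intro i hi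
  by_cases h : e < i
  · rw [he i (Finset.mem_range.mp hi) h]; simp
  · exact (natDegree_C_mul_X_pow_le _ _).trans (by omega)

theorem zero_estimate (D0 D1 q S T : ℕ) (g : ℕ → ℕ → ℝ)
    (hg : ∃ i < D0, ∃ j < D1, g i j ≠ 0) (hq : D0 ≤ q) (ξ ω : ℝ) (hξ : 0 < ξ) (hξ1 : ξ ≠ 1)
    (hω : 0 < ω) (hDT : D1 ≤ T)
    (hV : ∀ s, 1 ≤ s → s ≤ S → ∀ τ < T, ∑ j ∈ Finset.range D1, ∑ i ∈ Finset.range D0,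
      g i j * ((i + q * j).choose τ : ℝ) * ξ ^ (s * i) * ω ^ (s * j) = 0) :
    S * (T - D1) < D0 * D1 := by
  classical
  set J : Finset ℕ := (Finset.range D1).filter (fun j => ∃ i < D0, g i j ≠ 0) with hJ
  set h := J.card with hh
  have hJD : h ≤ D1 := by
    rw [hh]; exact (Finset.card_filter_le _ _).trans (by simp)
  have hpos : 0 < h := by
    obtain ⟨i, hi, j, hj, hij⟩ := hg
    exact Finset.card_pos.mpr ⟨j, Finset.mem_filter.mpr ⟨Finset.mem_range.mpr hj, i, hi, hij⟩⟩
  have hD0 : 0 < D0 := by obtain ⟨i, hi, -⟩ := hg; omega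
  set φ : Fin h → ℕ := fun l => J.orderEmbOfFin rfl l with hφ
  have φinj : Function.Injective φ := (J.orderEmbOfFin rfl).injective
  have φmem : ∀ l, φ l ∈ J := fun l => Finset.orderEmbOfFin_mem J rfl l
  have φimg : Finset.univ.image φ = J := by
    apply Finset.eq_of_subset_of_card_le
    · intro x hx
      obtain ⟨l, -, rfl⟩ := Finset.mem_image.mp hx
      exact φmem l
    · rw [Finset.card_image_of_injective _ φinj]; simp [hh]
  -- the top index in each column
  have htop : ∀ l : Fin h, ∃ e < D0, g e (φ l) ≠ 0 ∧ ∀ i < D0, e < i → g i (φ l) = 0 := by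
    intro l
    obtain ⟨i, hi, hij⟩ := (Finset.mem_filter.mp (φmem l)).2
    set A := (Finset.range D0).filter (fun i => g i (φ l) ≠ 0) with hA
    have hne : A.Nonempty := ⟨i, Finset.mem_filter.mpr ⟨Finset.mem_range.mpr hi, hij⟩⟩
    have hm := Finset.mem_filter.mp (A.max'_mem hne)
    refine ⟨A.max' hne, Finset.mem_range.mp hm.1, hm.2, ?_⟩
    intro k hk hlt
    by_contra hk0
    have := A.le_max' k (Finset.mem_filter.mpr ⟨Finset.mem_range.mpr hk, hk0⟩)
    omega
  choose e heD heg hez using htop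
  set Mat : Matrix (Fin h) (Fin h) ℝ[X] := fun k l => zH g D0 q k (φ l) with hMat
  set W := Mat.det with hW
  have hprod : ∀ σ : Equiv.Perm (Fin h), (∏ l, Mat (σ l) l).natDegree ≤ ∑ l, e l ∧
      (∏ l, Mat (σ l) l).coeff (∑ l, e l) = ∏ l, (Mat (σ l) l).coeff (e l) := by
    intro σ
    exact coeff_prod_top _ _ _ (fun l _ => zH_natDegree _ _ _ _ _ _ (hez l))
  have hWdeg : W.natDegree ≤ ∑ l, e l := by
    rw [hW, Matrix.det_apply]
    apply natDegree_sum_le_of_forall_le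
    intro σ _
    refine (natDegree_smul_le _ _).trans (hprod σ).1
  have hWcoeff : W.coeff (∑ l, e l) ≠ 0 := by
    have e1 : W.coeff (∑ l, e l) =
        (Matrix.of fun k l : Fin h => g (e l) (φ l) * ((e l + q * φ l : ℕ) : ℝ) ^ (k : ℕ)).det := by
      rw [hW, Matrix.det_apply, Matrix.det_apply, finsetSum_coeff]
      refine Finset.sum_congr rfl fun σ _ => ?_
      rw [coeff_smul, (hprod σ).2]
      congr 1
      refine Finset.prod_congr rfl fun l _ => ?_
      rw [Matrix.of_apply, hMat]
      exact zH_coeff _ _ _ _ _ _ (heD l)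
    rw [e1]
    have e2 : (Matrix.of fun k l : Fin h => g (e l) (φ l) * ((e l + q * φ l : ℕ) : ℝ) ^ (k : ℕ)) =
        Matrix.of fun k l : Fin h => g (e l) (φ l) *
          (Matrix.vandermonde fun l : Fin h => ((e l + q * φ l : ℕ) : ℝ)).transpose k l := by
      ext k l; simp [Matrix.vandermonde_apply]
    rw [e2, Matrix.det_mul_row, Matrix.det_transpose]
    refine mul_ne_zero (Finset.prod_ne_zero_iff.mpr fun l _ => heg l) ?_
    rw [Matrix.det_vandermonde_ne_zero_iff]
    intro l l' hll
    have hll' : e l + q * φ l = e l' + q * φ l' := by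
      simp only at hll
      exact_mod_cast hll
    apply φinj
    have a1 := heD l
    have a2 := heD l'
    have b1 : (e l + q * φ l) / q = φ l := by
      rw [Nat.add_mul_div_left _ _ (by omega), Nat.div_eq_of_lt (by omega), zero_add]
    have b2 : (e l' + q * φ l') / q = φ l' := by
      rw [Nat.add_mul_div_left _ _ (by omega), Nat.div_eq_of_lt (by omega), zero_add]
    rw [← b1, ← b2, hll']
  have hW0 : W ≠ 0 := by intro h0; rw [h0] at hWcoeff; simp at hWcoeff
  -- divisibility
  set m := T - h + 1 with hm
  have hdvd : ∀ s, 1 ≤ s → s ≤ S → (X - C (ξ ^ s)) ^ m ∣ W := by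
    intro s hs1 hsS
    set u : ℝ := ω / ξ ^ q with hu
    have hu0 : u ≠ 0 := by positivity
    set x : ℝ := ξ ^ s with hx
    have hx0 : x ≠ 0 := by positivity
    set R : ℕ → ℝ[X] := fun k => ∑ j ∈ Finset.range D1, ∑ i ∈ Finset.range D0,
      C (u ^ (s * j) * (g i j * ((i + q * j : ℕ) : ℝ) ^ k)) * X ^ (i + q * j) with hR
    have hRsucc : ∀ k, R (k + 1) = X * derivative (R k) := by
      intro k
      simp only [hR, derivative_sum, Finset.mul_sum]
      refine Finset.sum_congr rfl fun j _ => Finset.sum_congr rfl fun i _ => ?_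
      rw [derivative_C_mul_X_pow]
      generalize i + q * j = c
      rcases c with _ | c
      · simp
      · have e0 : u ^ (s * j) * (g i j * ((c + 1 : ℕ) : ℝ) ^ (k + 1)) =
            u ^ (s * j) * (g i j * ((c + 1 : ℕ) : ℝ) ^ k) * ((c + 1 : ℕ) : ℝ) := by ring
        rw [Nat.add_sub_cancel, e0, pow_succ X c]
        ring
    have hR0 : (X - C x) ^ T ∣ R 0 := by
      rw [X_sub_C_pow_dvd_iff, X_pow_dvd_iff]
      intro τ hτ
      have := hV s hs1 hsS τ hτ
      change (taylor x (R 0)).coeff τ = 0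
      rw [taylor_coeff]
      have hx1 : x ^ τ * eval x (hasseDeriv τ (R 0)) = 0 := by
        rw [← this]
        simp only [hR, map_sum, eval_finsetSum, Finset.mul_sum]
        refine Finset.sum_congr rfl fun j _ => Finset.sum_congr rfl fun i _ => ?_
        rw [C_mul_X_pow_eq_monomial, hasseDeriv_monomial, eval_monomial]
        by_cases hc : τ ≤ i + q * j
        · have : x ^ (i + q * j) = x ^ τ * x ^ (i + q * j - τ) := by
            rw [← pow_add]; congr 1; omega
          have e3 : ω ^ (s * j) = u ^ (s * j) * x ^ (q * j) := by
            rw [hu, hx, div_pow, ← pow_mul, ← pow_mul, show s * (q * j) = q * (s * j) by ring]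
            field_simp
          rw [e3]
          have e4 : ξ ^ (s * i) * x ^ (q * j) = x ^ τ * x ^ (i + q * j - τ) := by
            rw [← this, pow_add, hx, ← pow_mul, ← pow_mul]
          linear_combination (-(g i j * ((i + q * j).choose τ : ℝ) * u ^ (s * j))) * e4
        · rw [Nat.choose_eq_zero_of_lt (by omega)]; simp
      exact (mul_eq_zero.mp hx1).resolve_left (pow_ne_zero _ hx0)
    have hRk : ∀ k, (X - C x) ^ (T - k) ∣ R k := by
      intro k
      induction k with
      | zero => exact hR0
      | succ k ih =>
        rw [hRsucc]
        apply Dvd.dvd.mul_left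
        have := pow_sub_one_dvd_derivative_of_pow_dvd ih
        rwa [Nat.sub_sub] at this
    set Mat' : Matrix (Fin h) (Fin h) ℝ[X] := Matrix.of fun k l =>
      (C (u ^ (s * φ l)) * X ^ (q * φ l)) * Mat k l with hMat'
    have hdet : Mat'.det = (∏ l, (C (u ^ (s * φ l)) * X ^ (q * φ l))) * W := by
      rw [hMat', Matrix.det_mul_row]
    have hrow : ∀ k : Fin h, ∑ l, Mat' k l = R k := by
      intro k
      have e5 : R k = ∑ j ∈ J, ∑ i ∈ Finset.range D0,
          C (u ^ (s * j) * (g i j * ((i + q * j : ℕ) : ℝ) ^ (k : ℕ))) * X ^ (i + q * j) := by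
        simp only [hR]
        symm
        apply Finset.sum_subset (Finset.filter_subset _ _)
        intro j hj hjJ
        apply Finset.sum_eq_zero
        intro i hi
        have : g i j = 0 := by
          by_contra h0
          exact hjJ (Finset.mem_filter.mpr ⟨hj, i, Finset.mem_range.mp hi, h0⟩)
        rw [this]; simp
      rw [e5, ← φimg, Finset.sum_image (fun a _ b _ hab => φinj hab)]
      refine Finset.sum_congr rfl fun l _ => ?_
      simp only [hMat', Matrix.of_apply, hMat, zH, Finset.mul_sum]
      refine Finset.sum_congr rfl fun i _ => ?_
      rw [C_mul (a := u ^ (s * φ l)), pow_add]; ring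
    have hdvd' : (X - C x) ^ m ∣ Mat'.det := by
      have e6 : Mat'.adjugate.mulVec (Mat'.mulVec 1) ⟨0, hpos⟩ = Mat'.det := by
        rw [Matrix.mulVec_mulVec, Matrix.adjugate_mul, Matrix.smul_mulVec, Matrix.one_mulVec]
        simp
      rw [← e6]
      rw [Matrix.mulVec, dotProduct]
      apply Finset.dvd_sum
      intro k _
      apply Dvd.dvd.mul_left
      have : Mat'.mulVec 1 k = R k := by
        rw [← hrow k]; simp [Matrix.mulVec, dotProduct]
      rw [this]
      refine (pow_dvd_pow _ ?_).trans (hRk k)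
      have := k.2
      omega
    rw [hdet] at hdvd'
    refine IsCoprime.dvd_of_dvd_mul_left ?_ hdvd'
    apply IsCoprime.pow_left
    apply IsCoprime.prod_right
    intro l _
    apply IsCoprime.mul_right
    · exact ⟨0, C ((u ^ (s * φ l))⁻¹), by
        rw [zero_mul, zero_add, ← C_mul, inv_mul_cancel₀ (pow_ne_zero _ hu0), C_1]⟩
    · apply IsCoprime.pow_right
      have := isCoprime_X_sub_C_of_isUnit_sub (R := ℝ) (a := x) (b := 0)
        (by simpa using hx0)
      simpa using this
  have hall : (∏ s ∈ Finset.Icc 1 S, (X - C (ξ ^ s)) ^ m) ∣ W := by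
    apply Finset.prod_dvd_of_coprime
    · intro s hs t ht hst
      apply IsCoprime.pow
      apply isCoprime_X_sub_C_of_isUnit_sub
      have : ξ ^ s ≠ ξ ^ t := fun h0 => hst (pow_right_injective₀ hξ hξ1 h0)
      exact (sub_ne_zero.mpr this).isUnit
    · intro s hs
      obtain ⟨h1, h2⟩ := Finset.mem_Icc.mp hs
      exact hdvd s h1 h2
  have hdeg := natDegree_le_of_dvd hall hW0
  rw [natDegree_prod_of_monic _ _ (fun s _ => (monic_X_sub_C _).pow _)] at hdeg
  simp only [natDegree_pow, natDegree_X_sub_C, mul_one, Finset.sum_const, Nat.card_Icc,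
    Nat.add_sub_cancel, smul_eq_mul] at hdeg
  have hsum : ∑ l, e l ≤ h * (D0 - 1) := by
    calc ∑ l, e l ≤ ∑ l : Fin h, (D0 - 1) := Finset.sum_le_sum fun l _ => by have := heD l; omega
      _ = h * (D0 - 1) := by simp
  have h1 : S * (T - D1) ≤ S * m := Nat.mul_le_mul_left _ (by omega)
  have h2 : h * (D0 - 1) ≤ D1 * (D0 - 1) := Nat.mul_le_mul_right _ hJD
  have h3 : D1 * (D0 - 1) < D1 * D0 := Nat.mul_lt_mul_of_pos_left (by omega) (by omega)
  calc S * (T - D1) ≤ D1 * (D0 - 1) := h1.trans (hdeg.trans (hWdeg.trans (hsum.trans h2)))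
    _ < D0 * D1 := by rw [mul_comm D0]; exact h3

end ZeroEstimate

/-! ### Part 5: a Baker-type argument for very large `M` -/

theorem choose_le_pow (c τ T : ℕ) (x : ℝ) (hτ : τ ≤ T) (hx : Real.exp 1 ≤ x)
    (hc : Real.exp 1 * c ≤ x * T) : (c.choose τ : ℝ) ≤ x ^ T := by
  have he := Real.exp_pos 1
  have hx0 : 0 < x := lt_of_lt_of_le he hx
  set z := Real.exp 1 / x with hz
  have hz0 : 0 < z := by positivity
  have hz1 : z ≤ 1 := by rw [hz, div_le_one hx0]; exact hx
  have h1 : z ^ τ * (c.choose τ : ℝ) ≤ (1 + z) ^ c := by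
    by_cases h : τ ≤ c
    · rw [add_comm, add_pow]
      have := Finset.single_le_sum (f := fun m => z ^ m * 1 ^ (c - m) * (c.choose m : ℝ))
        (s := Finset.range (c + 1)) (fun i _ => by positivity) (Finset.mem_range.mpr (by omega : τ < c + 1))
      simpa using this
    · rw [Nat.choose_eq_zero_of_lt (by omega)]; simp; positivity
  have h2 : (1 + z) ^ c ≤ Real.exp 1 ^ T := by
    calc (1 + z) ^ c ≤ (Real.exp z) ^ c := by
          gcongr; linarith [Real.add_one_le_exp z]
      _ = Real.exp (c * z) := by rw [← Real.exp_nat_mul]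
      _ ≤ Real.exp T := by
          apply Real.exp_le_exp.mpr
          rw [hz, mul_div_assoc', div_le_iff₀ hx0]; linarith
      _ = Real.exp 1 ^ T := by rw [← Real.exp_nat_mul]; simp
  have h3 : z ^ T ≤ z ^ τ := pow_le_pow_of_le_one hz0.le hz1 hτ
  have h4 : z ^ T * (c.choose τ : ℝ) ≤ Real.exp 1 ^ T :=
    (mul_le_mul_of_nonneg_right h3 (by positivity)).trans (h1.trans h2)
  rw [hz, div_pow, div_mul_eq_mul_div, div_le_iff₀ (by positivity)] at h4
  exact le_of_mul_le_mul_left h4 (by positivity)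

theorem main_est {ι : Type*} (I : Finset ι) (g : ι → ℝ) (c : ι → ℕ) (T τ A : ℕ) (hτ : τ ≤ T)
    (hz : ∀ k < T, ∑ i ∈ I, g i * ((c i).choose k : ℝ) = 0) (X ρ G Cb Z Y : ℝ) (hX : 0 < X)
    (hρ : 1 ≤ ρ) (hG : ∀ i ∈ I, |g i| ≤ G) (hCb : ∀ i ∈ I, ((c i).choose τ : ℝ) ≤ Cb)
    (hA : ∀ i ∈ I, c i ≤ A) (hG0 : 0 ≤ G) (hCb0 : 0 ≤ Cb)
    (hZ : X ^ τ ≤ Z) (hY : (1 + ρ * |X - 1|) ^ A ≤ Y) :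
    |∑ i ∈ I, g i * ((c i).choose τ : ℝ) * X ^ c i| ≤ I.card * (G * Cb) * (Z * (Y / ρ ^ (T - τ))) := by
  set y := X - 1 with hy
  have hρ0 : 0 < ρ := by linarith
  have hZ0 : 0 < Z := lt_of_lt_of_le (by positivity) hZ
  have hY0 : 0 < Y := lt_of_lt_of_le (by positivity) hY
  have e1 : ∀ i ∈ I, g i * ((c i).choose τ : ℝ) * X ^ c i = X ^ τ *
      (∑ m ∈ Finset.range (A + 1), y ^ m * ((τ + m).choose τ : ℝ) * (g i * ((c i).choose (τ + m) : ℝ))) := by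
    intro i hi
    by_cases h : τ ≤ c i
    · have : X ^ c i = X ^ τ * X ^ (c i - τ) := by rw [← pow_add]; congr 1; omega
      have h2 : X ^ (c i - τ) = ∑ m ∈ Finset.range (A + 1), y ^ m * ((c i - τ).choose m : ℝ) := by
        rw [show X = y + 1 by rw [hy]; ring, add_pow]
        simp only [one_pow, mul_one]
        apply Finset.sum_subset
        · intro m; simp only [Finset.mem_range]; have := hA i hi; omega
        · intro m _ hm
          rw [Nat.choose_eq_zero_of_lt (by simp only [Finset.mem_range] at hm; omega)]; simp
      rw [this, h2, Finset.mul_sum, Finset.mul_sum, Finset.mul_sum]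
      refine Finset.sum_congr rfl fun m _ => ?_
      have h3 : ((c i).choose (τ + m) : ℝ) * ((τ + m).choose τ : ℝ) =
          ((c i).choose τ : ℝ) * ((c i - τ).choose m : ℝ) := by
        rcases le_or_gt (τ + m) (c i) with h4 | h4
        · have := Nat.choose_mul (n := c i) (k := τ + m) (s := τ) (by omega)
          rw [Nat.add_sub_cancel_left] at this
          exact_mod_cast this
        · rw [Nat.choose_eq_zero_of_lt h4, Nat.choose_eq_zero_of_lt (by omega : c i - τ < m)]; simp
      linear_combination (-(X ^ τ * y ^ m * g i)) * h3
    · rw [Nat.choose_eq_zero_of_lt (by omega)]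
      rw [Finset.sum_eq_zero]; simp
      intro m _
      rw [Nat.choose_eq_zero_of_lt (by omega : c i < τ + m)]; simp
  rw [Finset.sum_congr rfl e1, ← Finset.mul_sum, Finset.sum_comm]
  have e2 : ∑ m ∈ Finset.range (A + 1), ∑ i ∈ I, y ^ m * ((τ + m).choose τ : ℝ) * (g i * ((c i).choose (τ + m) : ℝ))
     = ∑ m ∈ (Finset.range (A + 1)).filter (fun m => T ≤ τ + m),
        ∑ i ∈ I, y ^ m * ((τ + m).choose τ : ℝ) * (g i * ((c i).choose (τ + m) : ℝ)) := by
    rw [Finset.sum_filter]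
    refine Finset.sum_congr rfl fun m _ => ?_
    split_ifs with h
    · rfl
    · rw [← Finset.mul_sum, hz _ (by omega), mul_zero]
  rw [e2, Finset.sum_comm, abs_mul, abs_of_pos (pow_pos hX _)]
  have e3 : ∀ i ∈ I, |∑ m ∈ (Finset.range (A + 1)).filter (fun m => T ≤ τ + m),
      y ^ m * ((τ + m).choose τ : ℝ) * (g i * ((c i).choose (τ + m) : ℝ))| ≤ (G * Cb) * (Y / ρ ^ (T - τ)) := by
    intro i hi
    calc _ ≤ ∑ m ∈ (Finset.range (A + 1)).filter (fun m => T ≤ τ + m),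
          |y ^ m * ((τ + m).choose τ : ℝ) * (g i * ((c i).choose (τ + m) : ℝ))| :=
            Finset.abs_sum_le_sum_abs _ _
      _ ≤ ∑ m ∈ (Finset.range (A + 1)).filter (fun m => T ≤ τ + m),
          (G * Cb) * (((ρ * |y|) ^ m * (A.choose m : ℝ)) / ρ ^ (T - τ)) := by
            apply Finset.sum_le_sum
            intro m hm
            have hm' := (Finset.mem_filter.mp hm).2
            have h3 : ((c i).choose (τ + m) : ℝ) * ((τ + m).choose τ : ℝ) ≤ Cb * (A.choose m : ℝ) := by
              rcases le_or_gt (τ + m) (c i) with h4 | h4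
              · have h5 : ((c i).choose (τ + m) : ℝ) * ((τ + m).choose τ : ℝ) =
                  ((c i).choose τ : ℝ) * ((c i - τ).choose m : ℝ) := by
                  have := Nat.choose_mul (n := c i) (k := τ + m) (s := τ) (by omega)
                  rw [Nat.add_sub_cancel_left] at this
                  exact_mod_cast this
                rw [h5]
                have h6 : ((c i - τ).choose m : ℝ) ≤ (A.choose m : ℝ) := by
                  have := hA i hi
                  exact_mod_cast Nat.choose_le_choose m (by omega)
                exact mul_le_mul (hCb i hi) h6 (by positivity) hCb0
              · rw [Nat.choose_eq_zero_of_lt h4]; simp; positivity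
            have h7 : |y| ^ m ≤ (ρ * |y|) ^ m / ρ ^ (T - τ) := by
              rw [le_div_iff₀ (by positivity), mul_pow, mul_comm]
              apply mul_le_mul_of_nonneg_right _ (by positivity)
              exact pow_le_pow_right₀ hρ (by omega)
            calc |y ^ m * ((τ + m).choose τ : ℝ) * (g i * ((c i).choose (τ + m) : ℝ))|
                = |g i| * |y| ^ m * (((c i).choose (τ + m) : ℝ) * ((τ + m).choose τ : ℝ)) := by
                  rw [abs_mul, abs_mul, abs_mul, abs_pow, Nat.abs_cast, Nat.abs_cast]; ring
              _ ≤ G * ((ρ * |y|) ^ m / ρ ^ (T - τ)) * (Cb * (A.choose m : ℝ)) := by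
                  gcongr
                  exact hG i hi
              _ = _ := by ring
      _ ≤ ∑ m ∈ Finset.range (A + 1),
          (G * Cb) * (((ρ * |y|) ^ m * (A.choose m : ℝ)) / ρ ^ (T - τ)) := by
            apply Finset.sum_le_sum_of_subset_of_nonneg (Finset.filter_subset _ _)
            intro m _ _; positivity
      _ = (G * Cb) * ((1 + ρ * |y|) ^ A / ρ ^ (T - τ)) := by
            rw [← Finset.mul_sum, ← Finset.sum_div, add_comm 1, add_pow]; simp
      _ ≤ _ := by gcongr
  calc _ ≤ Z * ∑ i ∈ I, (G * Cb) * (Y / ρ ^ (T - τ)) := by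
        gcongr
        exact (Finset.abs_sum_le_sum_abs _ _).trans (Finset.sum_le_sum e3)
    _ = _ := by rw [Finset.sum_const, nsmul_eq_mul]; ring

attribute [local instance] Matrix.seminormedAddCommGroup in
theorem siegel_use (D0 D1 q T : ℕ) (Cb G : ℝ) (hCb : 1 ≤ Cb) (hcard : D0 * D1 = 5 * T) (hT : 0 < T)
    (hb : ∀ i < D0, ∀ j < D1, ∀ τ < T, ((i + q * j).choose τ : ℝ) ≤ Cb) (hG0 : 0 ≤ G)
    (hG : (D0 * D1 : ℝ) * Cb ≤ G ^ 4) :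
    ∃ g : ℕ → ℕ → ℤ, (∃ i < D0, ∃ j < D1, g i j ≠ 0) ∧
      (∀ τ < T, ∑ p ∈ Finset.range D0 ×ˢ Finset.range D1,
        (g p.1 p.2 : ℝ) * ((p.1 + q * p.2).choose τ : ℝ) = 0) ∧
      ∀ i < D0, ∀ j < D1, |(g i j : ℝ)| ≤ G := by
  classical
  set A : Matrix (Fin T) (Fin D0 × Fin D1) ℤ :=
    Matrix.of fun τ p => (((p.1 : ℕ) + q * (p.2 : ℕ)).choose τ : ℤ) with hA
  have hc : Fintype.card (Fin D0 × Fin D1) = 5 * T := by simp [hcard]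
  obtain ⟨v, hv0, hAv, hvn⟩ := Int.Matrix.exists_ne_zero_int_vec_norm_le A
    (by rw [hc, Fintype.card_fin]; omega) (by rw [Fintype.card_fin]; omega)
  have hAn : ‖A‖ ≤ Cb := by
    rw [Matrix.norm_le_iff (by linarith)]
    intro τ p
    have := hb p.1 p.1.2 p.2 p.2.2 τ τ.2
    rw [hA, Matrix.of_apply, Int.norm_eq_abs]
    rw [abs_of_nonneg (by positivity)]
    exact_mod_cast this
  have hvG : ‖v‖ ≤ G := by
    refine hvn.trans ?_
    rw [hc, Fintype.card_fin]
    have hTr : (0:ℝ) < T := by exact_mod_cast hT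
    have e : (T : ℝ) / (((5 * T : ℕ) : ℝ) - T) = 1 / 4 := by
      push_cast; field_simp; ring
    rw [e]
    have h1 : ((5 * T : ℕ) : ℝ) * max 1 ‖A‖ ≤ G ^ 4 := by
      rw [← hcard]; push_cast
      exact (mul_le_mul_of_nonneg_left (max_le hCb hAn) (by positivity)).trans hG
    calc _ ≤ (G ^ 4) ^ (1 / 4 : ℝ) := Real.rpow_le_rpow (by positivity) h1 (by norm_num)
      _ = G := by
        rw [← Real.rpow_natCast, ← Real.rpow_mul hG0]; norm_num
  set g : ℕ → ℕ → ℤ := fun i j => if h : i < D0 ∧ j < D1 then v (⟨i, h.1⟩, ⟨j, h.2⟩) else 0 with hg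
  have hgv : ∀ p : Fin D0 × Fin D1, g p.1 p.2 = v p := by
    intro p; simp [hg]
  refine ⟨g, ?_, ?_, ?_⟩
  · by_contra hcon
    push Not at hcon
    apply hv0
    funext p
    rw [← hgv p]; exact hcon p.1 p.1.2 p.2 p.2.2
  · intro τ hτ
    have h1 := congrFun hAv ⟨τ, hτ⟩
    simp only [Matrix.mulVec, dotProduct, Pi.zero_apply] at h1
    rw [Finset.sum_product, ← Fin.sum_univ_eq_sum_range (fun i => ∑ j ∈ Finset.range D1,
      (g i j : ℝ) * ((i + q * j).choose τ : ℝ))]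
    have h2 : ∀ i : Fin D0, ∑ j ∈ Finset.range D1, (g i j : ℝ) * (((i : ℕ) + q * j).choose τ : ℝ) =
        ∑ j : Fin D1, (g i j : ℝ) * (((i : ℕ) + q * (j : ℕ)).choose τ : ℝ) := fun i =>
      (Fin.sum_univ_eq_sum_range (fun j => (g i j : ℝ) * (((i : ℕ) + q * j).choose τ : ℝ)) D1).symm
    rw [Finset.sum_congr rfl fun i _ => h2 i, ← Fintype.sum_prod_type'
      (f := fun (i : Fin D0) (j : Fin D1) => (g i j : ℝ) * (((i : ℕ) + q * (j : ℕ)).choose τ : ℝ))]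
    have h3 : ((∑ p : Fin D0 × Fin D1, A ⟨τ, hτ⟩ p * v p : ℤ) : ℝ) = 0 := by rw [h1]; simp
    rw [← h3]; push_cast
    refine Finset.sum_congr rfl fun p _ => ?_
    rw [hgv p, hA, Matrix.of_apply]; push_cast; ring
  · intro i hi j hj
    have : g i j = v (⟨i, hi⟩, ⟨j, hj⟩) := by simp [hg, hi, hj]
    rw [this, ← Int.norm_eq_abs]
    exact (norm_le_pi_norm v _).trans hvG

theorem V_est (D0 D1 q T τ s A : ℕ) (g : ℕ → ℕ → ℤ) (hτ : τ ≤ T) (hτA : τ ≤ A)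
    (hz : ∀ k < T, ∑ p ∈ Finset.range D0 ×ˢ Finset.range D1,
        (g p.1 p.2 : ℝ) * ((p.1 + q * p.2).choose k : ℝ) = 0)
    (hA : ∀ i < D0, ∀ j < D1, i + q * j ≤ A)
    (ξ η ω ρ G Cb Z Y E : ℝ) (hξ : 0 < ξ) (hω : ω = ξ ^ q * η)
    (hρ : 1 ≤ ρ) (hG : ∀ i < D0, ∀ j < D1, |(g i j : ℝ)| ≤ G)
    (hCb : ∀ i < D0, ∀ j < D1, ((i + q * j).choose τ : ℝ) ≤ Cb)
    (hG0 : 0 ≤ G) (hCb0 : 0 ≤ Cb) (hZ : ∀ k ≤ A, (ξ ^ s) ^ k ≤ Z)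
    (hY : (1 + ρ * |ξ ^ s - 1|) ^ A ≤ Y) (hE : ∀ j < D1, |η ^ (s * j) - 1| ≤ E) :
    |∑ p ∈ Finset.range D0 ×ˢ Finset.range D1,
      (g p.1 p.2 : ℝ) * ((p.1 + q * p.2).choose τ : ℝ) * ξ ^ (s * p.1) * ω ^ (s * p.2)|
      ≤ (D0 * D1 : ℝ) * (G * Cb) * (Z * (Y / ρ ^ (T - τ) + E)) := by
  set I := Finset.range D0 ×ˢ Finset.range D1 with hI
  have hmem : ∀ p ∈ I, p.1 < D0 ∧ p.2 < D1 := by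
    intro p hp; simpa [hI] using hp
  have hZ0 : 0 < Z := lt_of_lt_of_le (by positivity) (hZ 0 (by omega))
  have e1 : ∀ p ∈ I, (g p.1 p.2 : ℝ) * ((p.1 + q * p.2).choose τ : ℝ) * ξ ^ (s * p.1) * ω ^ (s * p.2)
      = (g p.1 p.2 : ℝ) * ((p.1 + q * p.2).choose τ : ℝ) * (ξ ^ s) ^ (p.1 + q * p.2)
        + (g p.1 p.2 : ℝ) * ((p.1 + q * p.2).choose τ : ℝ) * ((ξ ^ s) ^ (p.1 + q * p.2) *
          (η ^ (s * p.2) - 1)) := by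
    intro p _
    have : ξ ^ (s * p.1) * ω ^ (s * p.2) = (ξ ^ s) ^ (p.1 + q * p.2) * η ^ (s * p.2) := by
      rw [hω, mul_pow, ← pow_mul, ← pow_mul, ← mul_assoc, ← pow_add]; congr 2; ring
    rw [mul_assoc, this]; ring
  rw [Finset.sum_congr rfl e1, Finset.sum_add_distrib]
  have m1 := main_est I (fun p => (g p.1 p.2 : ℝ)) (fun p => p.1 + q * p.2) T τ A hτ hz (ξ ^ s) ρ G Cb Z Y
    (by positivity) hρ (fun p hp => hG _ (hmem p hp).1 _ (hmem p hp).2)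
    (fun p hp => hCb _ (hmem p hp).1 _ (hmem p hp).2)
    (fun p hp => hA _ (hmem p hp).1 _ (hmem p hp).2) hG0 hCb0 (hZ τ hτA) hY
  have hcard : (I.card : ℝ) = D0 * D1 := by rw [hI, Finset.card_product]; simp
  have m2 : |∑ p ∈ I, (g p.1 p.2 : ℝ) * ((p.1 + q * p.2).choose τ : ℝ) * ((ξ ^ s) ^ (p.1 + q * p.2) *
          (η ^ (s * p.2) - 1))| ≤ I.card * ((G * Cb) * (Z * E)) := by
    refine (Finset.abs_sum_le_sum_abs _ _).trans ?_
    rw [← nsmul_eq_mul, ← Finset.sum_const]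
    apply Finset.sum_le_sum
    intro p hp
    obtain ⟨h1, h2⟩ := hmem p hp
    rw [abs_mul, abs_mul, abs_mul, Nat.abs_cast, abs_of_pos (pow_pos (pow_pos hξ s) _)]
    have := hG _ h1 _ h2
    have := hCb _ h1 _ h2
    have := hZ _ (hA _ h1 _ h2)
    have := hE _ h2
    gcongr
  refine (abs_add_le _ _).trans ((add_le_add m1 m2).trans (le_of_eq ?_))
  rw [hcard]; ring

open Polynomial in
theorem V_alt (α : ℝ) (hα : α ^ 3 = α + 1) (h1 : 1.3247 < α) (h2 : α < 1.3248)
    (D0 D1 q τ s a b t d : ℕ) (r : ℤ) (g : ℕ → ℕ → ℤ) (G Cb : ℝ) (hd : d ≤ 9) (ht : t ≤ b)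
    (ξ ω : ℝ) (hξ : ξ = α ^ a / 10 ^ b) (hω : ω = α ^ (-r) * 10 ^ t * ((3 * α ^ 2 - 1) * d / 9))
    (hG : ∀ i < D0, ∀ j < D1, |(g i j : ℝ)| ≤ G)
    (hCb : ∀ i < D0, ∀ j < D1, ((i + q * j).choose τ : ℝ) ≤ Cb)
    (hG0 : 0 ≤ G) (hCb0 : 0 ≤ Cb) (V : ℝ)
    (hV : V = ∑ p ∈ Finset.range D0 ×ˢ Finset.range D1,
      (g p.1 p.2 : ℝ) * ((p.1 + q * p.2).choose τ : ℝ) * ξ ^ (s * p.1) * ω ^ (s * p.2))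
    (hV0 : V ≠ 0) :
    1 ≤ 10 ^ (b * s * D0) * 9 ^ (s * D1) * |V| *
      ((D0 * D1 : ℝ) * (G * Cb * (10 ^ (b * s * D0) * (36 * 10 ^ b * 2 ^ r.natAbs) ^ (s * D1)))) ^ 2 := by
  obtain ⟨y, hy, hβ, hn⟩ := exists_beta α hα h1 h2
  set I := Finset.range D0 ×ˢ Finset.range D1 with hI
  have hmem : ∀ p ∈ I, p.1 < D0 ∧ p.2 < D1 := by
    intro p hp; simpa [hI] using hp
  have hα0 : 0 < α := by linarith
  set β : ℂ := ⟨-α / 2, y⟩ with hβdef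
  have hβn : ‖β‖ ≤ 1 := by
    have : ‖β‖ ^ 2 ≤ 1 := by rw [hn]; nlinarith
    nlinarith [norm_nonneg β]
  obtain ⟨u, hu1, hu2⟩ : ∃ u : ℤ[X], aeval α u = α ^ (-r) ∧ ‖aeval β u‖ ≤ 2 ^ r.natAbs := by
    have hinv : α ^ 2 - 1 = α⁻¹ := by
      apply eq_inv_of_mul_eq_one_left; linear_combination hα
    rcases le_total 0 r with h | h
    · refine ⟨(X ^ 2 - 1) ^ r.natAbs, ?_, ?_⟩
      · rw [map_pow, map_sub, map_pow, aeval_X, map_one, hinv, inv_pow, zpow_neg]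
        congr 1
        rw [← zpow_natCast]; congr 1; omega
      · rw [map_pow, map_sub, map_pow, aeval_X, map_one, norm_pow]
        gcongr
        refine (norm_sub_le _ _).trans ?_
        rw [norm_pow, norm_one]
        nlinarith [norm_nonneg β]
    · refine ⟨X ^ r.natAbs, ?_, ?_⟩
      · rw [map_pow, aeval_X, ← zpow_natCast]; congr 1; omega
      · rw [map_pow, aeval_X, norm_pow]
        gcongr
        linarith
  set Ω : ℤ[X] := u * 10 ^ t * ((3 * X ^ 2 - 1) * (d : ℤ[X])) with hΩ
  set f : ℤ[X] := ∑ p ∈ I, C (g p.1 p.2 * ((p.1 + q * p.2).choose τ : ℤ)) * 10 ^ (b * s * (D0 - p.1)) *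
    X ^ (a * s * p.1) * Ω ^ (s * p.2) * 9 ^ (s * (D1 - p.2)) with hf
  have hΩα : aeval α Ω = ω * 9 := by
    rw [hΩ, hω]; simp [hu1, map_ofNat]; ring
  have hfα : aeval α f = 10 ^ (b * s * D0) * 9 ^ (s * D1) * V := by
    rw [hf, map_sum, hV, Finset.mul_sum]
    refine Finset.sum_congr rfl fun p hp => ?_
    obtain ⟨k1, k2⟩ := hmem p hp
    simp only [map_mul, map_pow, hΩα, aeval_X, aeval_C, map_ofNat]
    have e1 : (10 : ℝ) ^ (b * s * D0) = 10 ^ (b * s * (D0 - p.1)) * 10 ^ (b * s * p.1) := by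
      rw [← pow_add, ← mul_add]; congr 2; omega
    have e2 : (9 : ℝ) ^ (s * D1) = 9 ^ (s * (D1 - p.2)) * 9 ^ (s * p.2) := by
      rw [← pow_add, ← mul_add]; congr 2; omega
    have e3 : ξ ^ (s * p.1) * 10 ^ (b * s * p.1) = α ^ (a * s * p.1) := by
      rw [hξ, div_pow, ← pow_mul, ← pow_mul, ← mul_assoc, ← mul_assoc]
      field_simp
    rw [e1, e2, ← e3, mul_pow]
    simp
    ring
  have hfβ : ‖aeval β f‖ ≤ (D0 * D1 : ℝ) * (G * Cb * (10 ^ (b * s * D0) * (36 * 10 ^ b * 2 ^ r.natAbs) ^ (s * D1))) := by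
    have hcard : (I.card : ℝ) = D0 * D1 := by rw [hI, Finset.card_product]; simp
    rw [hf, map_sum, ← hcard, ← nsmul_eq_mul, ← Finset.sum_const]
    refine (norm_sum_le _ _).trans (Finset.sum_le_sum fun p hp => ?_)
    obtain ⟨k1, k2⟩ := hmem p hp
    have hΩβ : ‖aeval β Ω‖ ≤ 36 * 10 ^ b * 2 ^ r.natAbs := by
      rw [hΩ]
      simp only [map_mul, map_pow, map_sub, map_one, aeval_X, map_ofNat, map_natCast, norm_mul, norm_pow,
        Complex.norm_natCast]
      have q1 : ‖3 * β ^ 2 - 1‖ ≤ 4 := by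
        refine (norm_sub_le _ _).trans ?_
        rw [norm_mul, norm_pow, norm_one, Complex.norm_ofNat]
        nlinarith [norm_nonneg β]
      have q2 : (d : ℝ) ≤ 9 := by exact_mod_cast hd
      have q3 : ‖(10:ℂ)‖ ^ t ≤ 10 ^ b := by
        rw [Complex.norm_ofNat]
        exact pow_le_pow_right₀ (by norm_num) ht
      calc _ ≤ 2 ^ r.natAbs * 10 ^ b * (4 * (9:ℝ)) := by gcongr
        _ = _ := by ring
    have q4 : (1:ℝ) ≤ 36 * 10 ^ b * 2 ^ r.natAbs := by
      have := one_le_pow₀ (M₀ := ℝ) (a := 10) (n := b) (by norm_num)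
      have := one_le_pow₀ (M₀ := ℝ) (a := 2) (n := r.natAbs) (by norm_num)
      nlinarith
    have q5 : (9:ℝ) ≤ 36 * 10 ^ b * 2 ^ r.natAbs := by
      have := one_le_pow₀ (M₀ := ℝ) (a := 10) (n := b) (by norm_num)
      have := one_le_pow₀ (M₀ := ℝ) (a := 2) (n := r.natAbs) (by norm_num)
      nlinarith
    simp only [map_mul, map_pow, aeval_X, aeval_C, map_ofNat, norm_mul, norm_pow, Complex.norm_ofNat]
    have w1 : ‖(algebraMap ℤ ℂ) (g p.1 p.2)‖ ≤ G := by
      have := hG _ k1 _ k2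
      simpa using this
    have w2 : ‖(algebraMap ℤ ℂ) ((p.1 + q * p.2).choose τ : ℤ)‖ ≤ Cb := by
      have := hCb _ k1 _ k2
      simpa using this
    have w3 : (10:ℝ) ^ (b * s * (D0 - p.1)) ≤ 10 ^ (b * s * D0) := 
      pow_le_pow_right₀ (by norm_num) (Nat.mul_le_mul_left _ (by omega))
    have w4 : ‖β‖ ^ (a * s * p.1) ≤ 1 := pow_le_one₀ (norm_nonneg _) hβn
    have w5 : ‖aeval β Ω‖ ^ (s * p.2) * 9 ^ (s * (D1 - p.2)) ≤ (36 * 10 ^ b * 2 ^ r.natAbs) ^ (s * D1) := by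
      have : s * D1 = s * p.2 + s * (D1 - p.2) := by rw [← mul_add]; congr 1; omega
      rw [this, pow_add]
      gcongr
    calc _ = (‖(algebraMap ℤ ℂ) (g p.1 p.2)‖ * ‖(algebraMap ℤ ℂ) ((p.1 + q * p.2).choose τ : ℤ)‖) *
          (10 ^ (b * s * (D0 - p.1)) * ‖β‖ ^ (a * s * p.1) * (‖aeval β Ω‖ ^ (s * p.2) * 9 ^ (s * (D1 - p.2)))) := by
          ring
      _ ≤ (G * Cb) * (10 ^ (b * s * D0) * 1 * (36 * 10 ^ b * 2 ^ r.natAbs) ^ (s * D1)) := by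
          gcongr
      _ = _ := by ring
  have := norm_ineq α hα y hy hβ f (by rw [hfα]; positivity)
  rw [hfα, abs_mul, abs_of_pos (by positivity)] at this
  refine this.trans ?_
  gcongr

theorem exists_root12 (M : ℕ) (hM : 10 ^ 72 ≤ M) :
    ∃ x : ℕ, 10 ^ 6 ≤ x ∧ x ^ 12 ≤ M ∧ M < (x + 1) ^ 12 := by
  have hP : ∃ x : ℕ, M < (x + 1) ^ 12 := ⟨M, by
    calc M < M + 1 := by omega
      _ ≤ (M + 1) ^ 12 := Nat.le_self_pow (by norm_num) _⟩
  classical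
  refine ⟨Nat.find hP, ?_, ?_, Nat.find_spec hP⟩
  · by_contra h
    have h2 := Nat.find_spec hP
    have : (Nat.find hP + 1) ^ 12 ≤ (10 ^ 6) ^ 12 := Nat.pow_le_pow_left (by omega) 12
    norm_num at this hM
    omega
  · by_cases h0 : Nat.find hP = 0
    · rw [h0]; simp
    · have := Nat.find_min hP (m := Nat.find hP - 1) (by omega)
      rw [show Nat.find hP - 1 + 1 = Nat.find hP by omega] at this
      omega

theorem log_ten_le : Real.log 10 ≤ 2.3031 := by
  have h := Real.log_two_lt_d9
  have h3 : Real.log 10 = 3 * Real.log 2 + Real.log (10 / 8) := by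
    rw [show (10:ℝ) = 2 ^ 3 * (10 / 8) by norm_num, Real.log_mul (by norm_num) (by norm_num), Real.log_pow]
    norm_num
  have h4 : Real.log (10 / 8) = (10 * Real.log 2 - 3 * Real.log 10 + Real.log (1000/1024)) + Real.log (10/8) := by
    have : Real.log (1000/1024) = 3 * Real.log 10 - 10 * Real.log 2 := by
      rw [Real.log_div (by norm_num) (by norm_num), show (1000:ℝ) = 10 ^ 3 by norm_num,
        show (1024:ℝ) = 2 ^ 10 by norm_num, Real.log_pow, Real.log_pow]; norm_num
    rw [this]; ring
  have h5 : Real.log (1000/1024) ≤ 1000/1024 - 1 := Real.log_le_sub_one_of_pos (by norm_num)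
  linarith

theorem dirichlet_step (α : ℝ) (h1 : 1.3247 < α) (h2 : α < 1.3248)
    (n' M x : ℕ) (θ δ : ℝ) (hx : 10 ^ 6 ≤ x) (hxM : x ^ 12 ≤ M)
    (hrel : α ^ n' = θ * 10 ^ M * (1 + δ)) (hθ1 : 0.4 ≤ θ) (hθ2 : θ ≤ 5) (hδ : |δ| ≤ 1 / 2) :
    ∃ a b : ℕ, 1 ≤ b ∧ b ≤ x ^ 4 ∧ |Real.log (α ^ a / 10 ^ b)| ≤ 0.35 / (x : ℝ) ^ 4 ∧
      |(n' : ℝ) - ((M / b : ℕ) : ℝ) * a| ≤ 10 * b + M / (b * (x : ℝ) ^ 4) := by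
  have hα0 : 0 < α := by linarith
  have hxr : (10:ℝ) ^ 6 ≤ x := by exact_mod_cast hx
  have hx0 : (0:ℝ) < x := by linarith [show (0:ℝ) < 10 ^ 6 by norm_num]
  have hMr : (x:ℝ) ^ 12 ≤ M := by exact_mod_cast hxM
  have hM0 : (0:ℝ) < M := lt_of_lt_of_le (by positivity) hMr
  obtain ⟨hδ1, hδ2⟩ := abs_le.mp hδ
  have hlog : n' * Real.log α = M * Real.log 10 + Real.log (θ * (1 + δ)) := by
    have := congrArg Real.log hrel
    rw [Real.log_pow, show θ * 10 ^ M * (1 + δ) = 10 ^ M * (θ * (1 + δ)) by ring,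
      Real.log_mul (by positivity) (by apply ne_of_gt; apply mul_pos <;> linarith), Real.log_pow] at this
    exact this
  have hθδ1 : 0.2 ≤ θ * (1 + δ) := by nlinarith
  have hθδ2 : θ * (1 + δ) ≤ 7.5 := by nlinarith
  set w := Real.log (θ * (1 + δ)) with hw
  have hw1 : -4 ≤ w := by
    have := Real.one_sub_inv_le_log_of_pos (show 0 < θ * (1 + δ) by linarith)
    have h3 : (θ * (1 + δ))⁻¹ ≤ 5 := by
      calc _ ≤ (0.2:ℝ)⁻¹ := inv_anti₀ (by norm_num) hθδ1
        _ = 5 := by norm_num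
    linarith
  have hw2 : w ≤ 6.5 := by
    have := Real.log_le_sub_one_of_pos (show 0 < θ * (1 + δ) by linarith)
    linarith
  have hla1 : 0.245 ≤ Real.log α := by
    have := Real.one_sub_inv_le_log_of_pos hα0
    have h3 : α⁻¹ ≤ 1.3247⁻¹ := inv_anti₀ (by norm_num) h1.le
    norm_num at h3
    linarith
  have hla2 : Real.log α ≤ 0.3248 := by
    have := Real.log_le_sub_one_of_pos hα0
    linarith
  have hn10 : (n' : ℝ) ≤ 10 * M := by
    have h10 := log_ten_le
    have : (n' : ℝ) * 0.245 ≤ M * 2.3031 + 6.5 := by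
      have e1 : (n' : ℝ) * 0.245 ≤ n' * Real.log α := by gcongr
      have e2 : (M : ℝ) * Real.log 10 ≤ M * 2.3031 := by gcongr
      linarith
    have hM1 : (1000:ℝ) ≤ M := by
      refine le_trans ?_ hMr
      calc (1000:ℝ) ≤ (10 ^ 6) ^ 12 := by norm_num
        _ ≤ _ := by gcongr
    linarith
  obtain ⟨b, hb0, hbx, hb⟩ := Real.exists_nat_abs_mul_sub_round_le ((n' : ℝ) / M) (n := x ^ 4)
    (by positivity)
  set R := round ((b : ℝ) * ((n' : ℝ) / M)) with hR
  have hR0 : 0 ≤ R := by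
    rw [hR, round_eq]; apply Int.floor_nonneg.mpr; positivity
  obtain ⟨a, ha⟩ := Int.eq_ofNat_of_zero_le hR0
  have ha' : (R : ℝ) = a := by rw [ha]; simp
  rw [ha'] at hb
  set ε := (b : ℝ) * ((n' : ℝ) / M) - a with hε
  have hb1 : (1:ℝ) ≤ b := by exact_mod_cast hb0
  have hbx' : (b : ℝ) ≤ (x:ℝ) ^ 4 := by exact_mod_cast hbx
  have hε' : |ε| ≤ 1 / (x:ℝ) ^ 4 := by
    refine hb.trans ?_
    push_cast
    gcongr
    linarith
  obtain ⟨hε1, hε2⟩ := abs_le.mp hε'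
  have hae : (a : ℝ) = b * (n' / M) - ε := by rw [hε]; ring
  refine ⟨a, b, hb0, hbx, ?_, ?_⟩
  · have : Real.log (α ^ a / 10 ^ b) = b / M * w - ε * Real.log α := by
      rw [Real.log_div (by positivity) (by positivity), Real.log_pow, Real.log_pow, hae]
      have : (n' : ℝ) / M * Real.log α = Real.log 10 + w / M := by
        field_simp; linarith
      linear_combination (b : ℝ) * this
    rw [this]
    have hbM : (b : ℝ) / M ≤ 0.001 / (x:ℝ) ^ 4 := by
      rw [div_le_div_iff₀ hM0 (by positivity)]
      have : (x:ℝ) ^ 4 * x ^ 4 * 10 ^ 6 ≤ M := by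
        refine le_trans ?_ hMr
        calc (x:ℝ) ^ 4 * x ^ 4 * 10 ^ 6 ≤ (x:ℝ) ^ 4 * x ^ 4 * x := by gcongr
          _ = (x:ℝ) ^ 9 := by ring
          _ ≤ (x:ℝ) ^ 12 := pow_le_pow_right₀ (by linarith) (by norm_num)
      have h4 : (b:ℝ) * x ^ 4 ≤ x ^ 4 * x ^ 4 := by gcongr
      nlinarith
    have hwa : |w| ≤ 6.5 := abs_le.mpr ⟨by linarith, hw2⟩
    calc |b / M * w - ε * Real.log α| ≤ |b / M * w| + |ε * Real.log α| := abs_sub _ _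
      _ = b / M * |w| + |ε| * Real.log α := by
          rw [abs_mul, abs_mul, abs_of_nonneg (by positivity : (0:ℝ) ≤ b / M),
            abs_of_nonneg (by linarith : (0:ℝ) ≤ Real.log α)]
      _ ≤ 0.001 / (x:ℝ) ^ 4 * 6.5 + 1 / (x:ℝ) ^ 4 * 0.3248 := by gcongr
      _ = 0.3313 / (x:ℝ) ^ 4 := by ring
      _ ≤ _ := by gcongr; norm_num
  · have hdm : (M : ℝ) = b * ((M / b : ℕ) : ℝ) + ((M % b : ℕ) : ℝ) := by
      exact_mod_cast (Nat.div_add_mod M b).symm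
    have ht : ((M % b : ℕ) : ℝ) ≤ b := by exact_mod_cast (Nat.mod_lt M hb0).le
    set Q : ℝ := ((M / b : ℕ) : ℝ) with hQ
    set t : ℝ := ((M % b : ℕ) : ℝ) with htt
    have ht0 : 0 ≤ t := by positivity
    have hQ0 : 0 ≤ Q := by positivity
    have hQM : Q ≤ M / b := by rw [le_div_iff₀ (by linarith)]; linarith
    have e : (n' : ℝ) - Q * a = t * (n' / M) + Q * ε := by
      rw [hae]
      have : (n' : ℝ) = M * (n' / M) := by field_simp
      have h5 : (b * Q + t) * ((n' : ℝ) / M) = n' := by rw [← hdm]; field_simp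
      linear_combination -h5
    rw [e]
    calc |t * (n' / M) + Q * ε| ≤ |t * (n' / M)| + |Q * ε| := abs_add_le _ _
      _ = t * (n' / M) + Q * |ε| := by
        rw [abs_mul Q, abs_of_nonneg hQ0, abs_of_nonneg (by positivity)]
      _ ≤ b * 10 + M / b * (1 / (x:ℝ) ^ 4) := by
        have : (n' : ℝ) / M ≤ 10 := by rw [div_le_iff₀ hM0]; exact hn10
        gcongr
      _ = _ := by field_simp; try ring

theorem x_pow_ten (x : ℕ) (hx : 10 ^ 6 ≤ x) : x ^ 7204 * 10 ^ 15148 ≤ 10 ^ x := by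
  set m := x / 20000 with hm
  have hm50 : 50 ≤ m := by omega
  have h1 : x ≤ 10 ^ m := by
    have h2 : m - 5 < 10 ^ (m - 5) := Nat.lt_pow_self (by norm_num)
    have h3 : 10 ^ m = 100000 * 10 ^ (m - 5) := by
      rw [show m = (m - 5) + 5 by omega, pow_add]; simp; ring
    rw [h3]; omega
  calc x ^ 7204 * 10 ^ 15148 ≤ (10 ^ m) ^ 7204 * 10 ^ 15148 :=
        Nat.mul_le_mul_right _ (Nat.pow_le_pow_left h1 _)
    _ = 10 ^ (m * 7204 + 15148) := by rw [← pow_mul, ← pow_add]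
    _ ≤ 10 ^ x := Nat.pow_le_pow_right (by norm_num) (by omega)

theorem final_ineq (XX TT K : ℝ) (hTT : 10 ≤ TT) (hX : TT ^ 6 ≤ XX) (hK : XX ^ 1801 * TT ^ 3787 ≤ K) :
    XX ^ 1801 * TT ^ 3784 * (TT ^ 700 / XX ^ 2700 + TT ^ 2 / K) < 1 := by
  have hT0 : 0 < TT := by linarith
  have hX0 : 0 < XX := lt_of_lt_of_le (by positivity) hX
  have hK0 : 0 < K := lt_of_lt_of_le (by positivity) hK
  have a1 : XX ^ 1801 * TT ^ 3784 * (TT ^ 700 / XX ^ 2700) ≤ 1 / TT := by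
    rw [mul_div_assoc', div_le_div_iff₀ (by positivity) hT0]
    have h1 : (TT ^ 6) ^ 899 ≤ XX ^ 899 := by gcongr
    have h2 : TT ^ 4485 ≤ (TT ^ 6) ^ 899 := by
      rw [← pow_mul]; exact pow_le_pow_right₀ (by linarith) (by norm_num)
    calc XX ^ 1801 * TT ^ 3784 * TT ^ 700 * TT = XX ^ 1801 * TT ^ 4485 := by
          rw [mul_assoc, mul_assoc, ← pow_succ, ← pow_add]
      _ ≤ XX ^ 1801 * XX ^ 899 := by gcongr; exact h2.trans h1
      _ = 1 * XX ^ 2700 := by rw [← pow_add, one_mul]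
  have a2 : XX ^ 1801 * TT ^ 3784 * (TT ^ 2 / K) ≤ 1 / TT := by
    rw [mul_div_assoc', div_le_div_iff₀ hK0 hT0, one_mul]
    calc XX ^ 1801 * TT ^ 3784 * TT ^ 2 * TT = XX ^ 1801 * TT ^ 3787 := by
          rw [mul_assoc, mul_assoc, ← pow_succ, ← pow_add]
      _ ≤ K := hK
  have : 1 / TT ≤ 1 / 10 := by gcongr
  rw [mul_add]
  linarith

theorem c_bounds (α : ℝ) (h1 : 1.3247 < α) (h2 : α < 1.3248) :
    4.2 ≤ 3 * α ^ 2 - 1 ∧ 3 * α ^ 2 - 1 ≤ 5 := by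
  constructor <;> nlinarith

theorem pow_sub_one_bound (η : ℝ) (h0 : 0 < η) (h2 : η ≤ 2) (m : ℕ) :
    |η ^ m - 1| ≤ |η - 1| * 4 ^ m := by
  induction m with
  | zero => simp
  | succ m ih =>
    have e : η ^ (m + 1) - 1 = η * (η ^ m - 1) + (η - 1) := by ring
    rw [e]
    refine (abs_add_le _ _).trans ?_
    rw [abs_mul, abs_of_pos h0]
    have h3 : (1:ℝ) ≤ 4 ^ m := one_le_pow₀ (by norm_num)
    have h4 : η * |η ^ m - 1| ≤ 2 * (|η - 1| * 4 ^ m) := by gcongr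
    have h5 : |η - 1| * 1 ≤ |η - 1| * 4 ^ m := by gcongr
    have h6 : 0 ≤ |η - 1| * 4 ^ m := by positivity
    rw [pow_succ]; linarith

set_option maxHeartbeats 4000000 in
theorem baker_large (α : ℝ) (hα : α ^ 3 = α + 1) (h1 : 1.3247 < α) (h2 : α < 1.3248)
    (n' M d k : ℕ) (hd1 : 1 ≤ d) (hd : d ≤ 9) (δ : ℝ) (hM : 10 ^ 72 ≤ M) (hk : M ≤ 2 * k)
    (hδ : |δ| ≤ 10 / 10 ^ k)
    (hrel : α ^ n' = ((3 * α ^ 2 - 1) * d / 9) * 10 ^ M * (1 + δ)) : False := by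
  obtain ⟨x, hx, hxM, hMx⟩ := exists_root12 M hM
  have hα0 : 0 < α := by linarith
  have hdr1 : (1:ℝ) ≤ d := by exact_mod_cast hd1
  have hdr2 : (d:ℝ) ≤ 9 := by exact_mod_cast hd
  obtain ⟨hc1, hc2⟩ := c_bounds α h1 h2
  set θ : ℝ := (3 * α ^ 2 - 1) * d / 9 with hθ
  have hθ1 : 0.4 ≤ θ := by 
    have : (3 * α ^ 2 - 1) * 1 ≤ (3 * α ^ 2 - 1) * d := mul_le_mul_of_nonneg_left hdr1 (by linarith)
    rw [hθ]; linarith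
  have hθ2 : θ ≤ 5 := by
    have : (3 * α ^ 2 - 1) * d ≤ 5 * 9 := mul_le_mul hc2 hdr2 (by linarith) (by linarith)
    rw [hθ]; linarith
  have hk2 : 2 ≤ k := by omega
  have hδh : |δ| ≤ 1 / 10 := by
    refine hδ.trans ?_
    rw [div_le_div_iff₀ (by positivity) (by norm_num)]
    calc (10:ℝ) * 10 = 10 ^ 2 := by norm_num
      _ ≤ 1 * 10 ^ k := by rw [one_mul]; exact pow_le_pow_right₀ (by norm_num) hk2
  obtain ⟨hδ1, hδ2⟩ := abs_le.mp hδh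
  obtain ⟨a, b, hb1, hbx, hlogξ, hr⟩ := dirichlet_step α h1 h2 n' M x θ δ hx hxM hrel hθ1 hθ2
    (hδh.trans (by norm_num))
  -- natural number parameters
  set B := x ^ 8 / b + 1 with hB
  set U := x ^ 3 * (b * B) with hU
  set q := M / b with hq
  set D0 := 60 * x ^ 3 * B with hD0
  set D1 := 100 * b with hD1
  have hbB1 : x ^ 8 ≤ b * B := by
    have := Nat.div_add_mod (x ^ 8) b
    have := Nat.mod_lt (x ^ 8) hb1
    rw [hB, mul_add]; omega
  have hx48 : x ^ 4 ≤ x ^ 8 := Nat.pow_le_pow_right (by omega) (by norm_num)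
  have hbB2 : b * B ≤ 2 * x ^ 8 := by
    have := Nat.div_add_mod (x ^ 8) b
    rw [hB, mul_add]; omega
  have hU1 : x ^ 11 ≤ U := by
    calc x ^ 11 = x ^ 3 * x ^ 8 := by ring
      _ ≤ _ := Nat.mul_le_mul_left _ hbB1
  have hU2 : U ≤ 2 * x ^ 11 := by
    calc U ≤ x ^ 3 * (2 * x ^ 8) := Nat.mul_le_mul_left _ hbB2
      _ = _ := by ring
  have hx12 : 1000000 * x ^ 11 ≤ x ^ 12 := by
    calc 1000000 * x ^ 11 ≤ x * x ^ 11 := Nat.mul_le_mul_right _ (by omega)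
      _ = _ := by ring
  have hx811 : 1000000 * x ^ 8 ≤ x ^ 11 := by
    calc 1000000 * x ^ 8 ≤ x ^ 3 * x ^ 8 := Nat.mul_le_mul_right _ (by
          calc 1000000 ≤ x := by omega
            _ ≤ x ^ 3 := Nat.le_self_pow (by norm_num) _)
      _ = _ := by ring
  have hx8 : 1 ≤ x ^ 8 := Nat.one_le_pow _ _ (by omega)
  have hcard : D0 * D1 = 5 * (1200 * U) := by rw [hD0, hD1, hU]; ring
  have hD0q : D0 ≤ q := by
    rw [hq, Nat.le_div_iff_mul_le (by omega)]
    have : D0 * b = 60 * U := by rw [hD0, hU]; ring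
    omega
  set A := q * D1 with hA
  have hAM : A ≤ 100 * M := by
    have : A = 100 * (b * (M / b)) := by rw [hA, hq, hD1]; ring
    have := Nat.mul_div_le M b
    omega
  have hAc : ∀ i < D0, ∀ j < D1, i + q * j ≤ A := by
    intro i hi j hj
    have : q * (j + 1) ≤ q * D1 := Nat.mul_le_mul_left _ hj
    rw [mul_add] at this; omega
  -- real versions
  have hxr : (10:ℝ) ^ 6 ≤ x := by exact_mod_cast hx
  have hx0 : (0:ℝ) < x := by linarith [show (0:ℝ) < 10 ^ 6 by norm_num]
  have hU1r : (x:ℝ) ^ 11 ≤ U := by exact_mod_cast hU1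
  have hx811r : (1000000:ℝ) * x ^ 8 ≤ x ^ 11 := by exact_mod_cast hx811
  have hMr : (M:ℝ) ≤ 1.001 * x ^ 12 := by
    have e1 : (M:ℝ) ≤ (x + 1) ^ 12 := by exact_mod_cast hMx.le
    have e2 : (x:ℝ) + 1 ≤ x * (1 + 1 / 10 ^ 6) := by
      have : (1:ℝ) ≤ x * (1 / 10 ^ 6) := by rw [mul_one_div, le_div_iff₀ (by norm_num)]; linarith
      linarith
    calc (M:ℝ) ≤ (x + 1) ^ 12 := e1
      _ ≤ (x * (1 + 1 / 10 ^ 6)) ^ 12 := by gcongr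
      _ = (1 + 1 / 10 ^ 6) ^ 12 * x ^ 12 := by ring
      _ ≤ 1.001 * x ^ 12 := by gcongr; norm_num
  have hAr : (A:ℝ) ≤ 100.1 * x ^ 12 := by
    have : (A:ℝ) ≤ 100 * M := by exact_mod_cast hAM
    linarith
  have he := Real.exp_one_lt_d9
  have hex : Real.exp 1 ≤ x := by linarith [show (3:ℝ) ≤ 10 ^ 6 by norm_num]
  have hcT : ∀ c ≤ A, Real.exp 1 * (c:ℝ) ≤ x * ((300 * U : ℕ) : ℝ) := by
    intro c hc
    have hcr : (c:ℝ) ≤ 100.1 * x ^ 12 := le_trans (by exact_mod_cast hc) hAr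
    calc Real.exp 1 * (c:ℝ) ≤ 2.72 * (100.1 * x ^ 12) := by gcongr; linarith
      _ ≤ x * (300 * x ^ 11) := by
        have : (0:ℝ) < x ^ 12 := by positivity
        have e : (x:ℝ) * (300 * x ^ 11) = 300 * x ^ 12 := by ring
        rw [e]; linarith
      _ ≤ x * ((300 * U : ℕ) : ℝ) := by push_cast; gcongr
  have hcT2 : ∀ c ≤ A, Real.exp 1 * (c:ℝ) ≤ x * ((1200 * U : ℕ) : ℝ) := by
    intro c hc
    refine (hcT c hc).trans ?_
    gcongr; norm_num
  have hx1 : (1:ℝ) ≤ x := by linarith [show (1:ℝ) ≤ 10 ^ 6 by norm_num]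
  have hL : (D0 * D1 : ℝ) ≤ (x:ℝ) ^ 12 := by
    have : D0 * D1 ≤ x ^ 12 := by rw [hcard]; omega
    exact_mod_cast this
  -- Siegel
  obtain ⟨g, hg0, hgz, hgG⟩ := siegel_use D0 D1 q (1200 * U) ((x:ℝ) ^ (1200 * U)) ((x:ℝ) ^ (3 + 300 * U))
    (one_le_pow₀ hx1) hcard (by omega)
    (fun i hi j hj τ hτ => choose_le_pow _ _ _ _ hτ.le hex (hcT2 _ (hAc i hi j hj)))
    (by positivity)
    (by
      rw [← pow_mul, show (3 + 300 * U) * 4 = 12 + 1200 * U by ring, pow_add]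
      gcongr)
  have hCb : ∀ τ < 300 * U, ∀ i < D0, ∀ j < D1, ((i + q * j).choose τ : ℝ) ≤ (x:ℝ) ^ (300 * U) :=
    fun τ hτ i hi j hj => choose_le_pow _ _ _ _ hτ.le hex (hcT _ (hAc i hi j hj))
  -- the numbers
  set ξ : ℝ := α ^ a / 10 ^ b with hξ
  have hξ0 : 0 < ξ := by positivity
  have hξ1 : ξ ≠ 1 := by
    rw [hξ, Ne, div_eq_one_iff_eq (by positivity)]
    exact alpha_pow_ne α hα h1 h2 a b hb1
  set r : ℤ := (n' : ℤ) - q * a with hrdef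
  set t := M % b with ht
  set ω : ℝ := α ^ (-r) * 10 ^ t * θ with hω
  set η : ℝ := 1 / (1 + δ) with hη
  have hω0 : 0 < ω := by positivity
  have hη0 : 0 < η := by apply one_div_pos.mpr; linarith
  have hη2 : η ≤ 2 := by rw [hη, div_le_iff₀ (by linarith)]; linarith
  have hη1 : |η - 1| ≤ 2 * |δ| := by
    have e3 : (1 + δ) ≠ 0 := by apply ne_of_gt; linarith
    have : η - 1 = η * (-δ) := by rw [hη]; field_simp; ring
    rw [this, abs_mul, abs_of_pos hη0, abs_neg]; gcongr
  have hωξ : ω = ξ ^ q * η := by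
    have e1 : α ^ (-r) = α ^ (q * a) / α ^ n' := by
      rw [hrdef, neg_sub, zpow_sub₀ hα0.ne', zpow_natCast]
      congr 1
    have e2 : (10:ℝ) ^ M = 10 ^ (b * q) * 10 ^ t := by
      rw [← pow_add, hq, ht, Nat.div_add_mod]
    have e3 : (0:ℝ) < 1 + δ := by linarith
    have e4 : θ ≠ 0 := by linarith
    rw [hω, e1, hrel, hξ, hη, div_pow, ← pow_mul, ← pow_mul, e2, mul_comm a q]
    field_simp
  set TT : ℝ := (10:ℝ) ^ U with hTT
  set XX : ℝ := (x:ℝ) ^ U with hXX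
  have hpow10 : ∀ m : ℕ, m ≤ U → (10:ℝ) ^ m ≤ TT := fun m hm => pow_le_pow_right₀ (by norm_num) hm
  have hexp10 : ∀ v : ℝ, v ≤ U → Real.exp v ≤ TT := by
    intro v hv
    calc Real.exp v ≤ Real.exp U := Real.exp_le_exp.mpr hv
      _ = Real.exp 1 ^ U := by rw [← Real.exp_nat_mul]; simp
      _ ≤ TT := by rw [hTT]; gcongr; linarith
  have hTT10 : 10 ≤ TT := by
    have := hpow10 1 (by omega)
    simpa using this
  have hTTXX : TT ^ 6 ≤ XX := by
    rw [hTT, hXX, ← pow_mul, mul_comm, pow_mul]; gcongr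
  have hK : XX ^ 1801 * TT ^ 3787 ≤ (10:ℝ) ^ k := by
    have e0 := x_pow_ten x hx
    have e1 : (((x:ℝ) ^ 1801 * 10 ^ 3787) ^ U) ^ 2 ≤ ((10:ℝ) ^ k) ^ 2 := by
      have hbase : (1:ℝ) ≤ (x:ℝ) ^ 1801 * 10 ^ 3787 :=
        one_le_mul_of_one_le_of_one_le (one_le_pow₀ hx1) (one_le_pow₀ (by norm_num))
      have e2 : ((x:ℝ) ^ 1801 * 10 ^ 3787) ^ 4 ≤ 10 ^ x := by
        rw [mul_pow, ← pow_mul, ← pow_mul]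
        exact_mod_cast e0
      calc (((x:ℝ) ^ 1801 * 10 ^ 3787) ^ U) ^ 2 = ((x:ℝ) ^ 1801 * 10 ^ 3787) ^ (U * 2) := by rw [← pow_mul]
        _ ≤ ((x:ℝ) ^ 1801 * 10 ^ 3787) ^ (4 * x ^ 11) := pow_le_pow_right₀ hbase (by omega)
        _ = (((x:ℝ) ^ 1801 * 10 ^ 3787) ^ 4) ^ (x ^ 11) := by rw [pow_mul]
        _ ≤ (10 ^ x) ^ (x ^ 11) := by gcongr
        _ = 10 ^ (x ^ 12) := by rw [← pow_mul]; congr 1; ring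
        _ ≤ 10 ^ (k * 2) := pow_le_pow_right₀ (by norm_num) (by omega)
        _ = _ := by rw [pow_mul]
    have e3 := (pow_le_pow_iff_left₀ (by positivity) (by positivity) (by norm_num : (2:ℕ) ≠ 0)).mp e1
    have e4 : XX ^ 1801 * TT ^ 3787 = ((x:ℝ) ^ 1801 * 10 ^ 3787) ^ U := by
      rw [hXX, hTT, mul_pow, pow_right_comm (x:ℝ) U, pow_right_comm (10:ℝ) U]
    rw [e4]
    exact e3
  have hrn : (b:ℝ) * (r.natAbs : ℝ) ≤ 12 * x ^ 8 := by
    have e1 : (r.natAbs : ℝ) = |(n' : ℝ) - (q : ℝ) * a| := by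
      rw [Nat.cast_natAbs, hrdef]; push_cast; rfl
    have hb1r : (1:ℝ) ≤ b := by exact_mod_cast hb1
    have hbxr : (b:ℝ) ≤ (x:ℝ) ^ 4 := by exact_mod_cast hbx
    rw [e1]
    calc (b:ℝ) * |(n' : ℝ) - (q : ℝ) * a| ≤ b * (10 * b + M / (b * (x : ℝ) ^ 4)) := by gcongr
      _ = 10 * (b * b) + M / x ^ 4 := by field_simp
      _ ≤ 10 * (x ^ 4 * x ^ 4) + 1.001 * x ^ 12 / x ^ 4 := by gcongr
      _ = 11.001 * x ^ 8 := by field_simp; ring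
      _ ≤ _ := by gcongr; norm_num
  have hrn' : b * r.natAbs ≤ 12 * x ^ 8 := by exact_mod_cast hrn
  have hbb : b * b ≤ x ^ 8 := by
    calc b * b ≤ x ^ 4 * x ^ 4 := Nat.mul_le_mul hbx hbx
      _ = _ := by ring
  have hVzero : ∀ s, 1 ≤ s → s ≤ 21 → ∀ τ < 300 * U, ∑ p ∈ Finset.range D0 ×ˢ Finset.range D1,
      (g p.1 p.2 : ℝ) * ((p.1 + q * p.2).choose τ : ℝ) * ξ ^ (s * p.1) * ω ^ (s * p.2) = 0 := by
    intro s hs1 hs2 τ hτ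
    by_contra hne
    have alt := V_alt α hα h1 h2 D0 D1 q τ s a b t d r g ((x:ℝ) ^ (3 + 300 * U)) ((x:ℝ) ^ (300 * U))
      hd (Nat.mod_lt _ hb1).le ξ ω hξ hω hgG (hCb τ hτ) (by positivity) (by positivity) _ rfl hne
    have hsr : (s:ℝ) ≤ 21 := by exact_mod_cast hs2
    have hslog : |s * Real.log ξ| ≤ 7.35 / (x:ℝ) ^ 4 := by
      rw [abs_mul, Nat.abs_cast]
      calc (s:ℝ) * |Real.log ξ| ≤ 21 * (0.35 / (x:ℝ) ^ 4) := by gcongr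
        _ = _ := by ring
    have hξs : ξ ^ s = Real.exp (s * Real.log ξ) := by
      rw [Real.exp_nat_mul, Real.exp_log hξ0]
    have hZ : ∀ m ≤ A, (ξ ^ s) ^ m ≤ TT := by
      intro m hm
      rw [hξs, ← Real.exp_nat_mul]
      apply hexp10
      have hmr : (m:ℝ) ≤ 100.1 * x ^ 12 := le_trans (by exact_mod_cast hm) hAr
      calc (m:ℝ) * (s * Real.log ξ) ≤ (100.1 * x ^ 12) * (7.35 / (x:ℝ) ^ 4) := by
            refine (mul_le_mul_of_nonneg_left (le_abs_self _) (by positivity)).trans ?_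
            gcongr
        _ = 735.735 * x ^ 8 := by field_simp; ring
        _ ≤ x ^ 11 := by
          have : (0:ℝ) < x ^ 8 := by positivity
          linarith
        _ ≤ U := hU1r
    have hy : |ξ ^ s - 1| ≤ 14.7 / (x:ℝ) ^ 4 := by
      rw [hξs]
      refine (Real.abs_exp_sub_one_le ?_).trans ?_
      · refine hslog.trans ?_
        rw [div_le_one (by positivity)]
        calc (7.35:ℝ) ≤ (10 ^ 6) ^ 4 := by norm_num
          _ ≤ _ := by gcongr
      · calc 2 * |s * Real.log ξ| ≤ 2 * (7.35 / (x:ℝ) ^ 4) := by gcongr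
          _ = _ := by ring
    have hY : (1 + (x:ℝ) ^ 3 * |ξ ^ s - 1|) ^ A ≤ TT ^ 700 := by
      calc (1 + (x:ℝ) ^ 3 * |ξ ^ s - 1|) ^ A ≤ (1 + (x:ℝ) ^ 3 * (14.7 / (x:ℝ) ^ 4)) ^ A := by gcongr
        _ ≤ (Real.exp ((x:ℝ) ^ 3 * (14.7 / (x:ℝ) ^ 4))) ^ A := by
          gcongr
          linarith [Real.add_one_le_exp ((x:ℝ) ^ 3 * (14.7 / (x:ℝ) ^ 4))]
        _ = Real.exp (A * ((x:ℝ) ^ 3 * (14.7 / (x:ℝ) ^ 4))) := by rw [← Real.exp_nat_mul]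
        _ ≤ Real.exp ((100 * U : ℕ) * 15) := by
          apply Real.exp_le_exp.mpr
          calc (A:ℝ) * ((x:ℝ) ^ 3 * (14.7 / (x:ℝ) ^ 4)) ≤ (100.1 * x ^ 12) * ((x:ℝ) ^ 3 * (14.7 / (x:ℝ) ^ 4)) := by
                gcongr
            _ = 1471.47 * (x:ℝ) ^ 11 := by field_simp; ring
            _ ≤ (1500:ℝ) * (U:ℝ) := by
              have : (0:ℝ) < (x:ℝ) ^ 11 := by positivity
              linarith
            _ = _ := by push_cast; ring
        _ = (Real.exp 15) ^ (100 * U) := by rw [Real.exp_nat_mul]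
        _ ≤ (10 ^ 7) ^ (100 * U) := by
          gcongr
          have : Real.exp 15 = Real.exp 1 ^ 15 := by rw [← Real.exp_nat_mul]; norm_num
          rw [this]
          calc Real.exp 1 ^ 15 ≤ 2.7183 ^ 15 := by gcongr; linarith
            _ ≤ 10 ^ 7 := by norm_num
        _ = TT ^ 700 := by rw [hTT, ← pow_mul, ← pow_mul]; congr 1; ring
    have hE : ∀ j < D1, |η ^ (s * j) - 1| ≤ TT ^ 2 / 10 ^ k := by
      intro j hj
      have e1 : (4:ℝ) ^ (s * j) ≤ TT := by
        refine le_trans ?_ (hpow10 (s * j) ?_)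
        · gcongr; norm_num
        · calc s * j ≤ 21 * D1 := Nat.mul_le_mul hs2 hj.le
            _ ≤ U := by omega
      have e2 : (20:ℝ) ≤ TT := by
        refine le_trans ?_ (hpow10 2 (by omega)); norm_num
      calc |η ^ (s * j) - 1| ≤ |η - 1| * 4 ^ (s * j) := pow_sub_one_bound η hη0 hη2 _
        _ ≤ (2 * (10 / 10 ^ k)) * TT := by
          gcongr
          linarith
        _ = 20 * TT / 10 ^ k := by ring
        _ ≤ TT ^ 2 / 10 ^ k := by rw [sq]; gcongr
    have hτA : τ ≤ A := by
      have e1 : x ^ 12 ≤ 2 * A := by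
        have h3 : A = 100 * (b * (M / b)) := by rw [hA, hq, hD1]; ring
        have h4 := Nat.div_add_mod M b
        have h5 := Nat.mod_lt M hb1
        omega
      omega
    have est := V_est D0 D1 q (1200 * U) τ s A g (by omega) hτA hgz hAc ξ η ω ((x:ℝ) ^ 3)
      ((x:ℝ) ^ (3 + 300 * U)) ((x:ℝ) ^ (300 * U)) TT (TT ^ 700) (TT ^ 2 / 10 ^ k) hξ0 hωξ
      (one_le_pow₀ hx1) hgG (hCb τ hτ) (by positivity) (by positivity) hZ hY hE
    set V := ∑ p ∈ Finset.range D0 ×ˢ Finset.range D1,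
      (g p.1 p.2 : ℝ) * ((p.1 + q * p.2).choose τ : ℝ) * ξ ^ (s * p.1) * ω ^ (s * p.2) with hV
    have hTT0 : 0 < TT := by linarith
    have hXX0 : 0 < XX := by positivity
    have hN : (D0 * D1 : ℝ) * ((x:ℝ) ^ (3 + 300 * U) * (x:ℝ) ^ (300 * U)) ≤ (x:ℝ) ^ 15 * XX ^ 600 := by
      calc (D0 * D1 : ℝ) * ((x:ℝ) ^ (3 + 300 * U) * (x:ℝ) ^ (300 * U)) ≤
          x ^ 12 * ((x:ℝ) ^ (3 + 300 * U) * (x:ℝ) ^ (300 * U)) := by gcongr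
        _ = _ := by rw [hXX, ← pow_mul, ← pow_add, ← pow_add, ← pow_add]; congr 1; ring
    have hρ : XX ^ 2700 ≤ ((x:ℝ) ^ 3) ^ (1200 * U - τ) := by
      rw [hXX, ← pow_mul, ← pow_mul]
      exact pow_le_pow_right₀ hx1 (by omega)
    have est2 : |V| ≤ (x:ℝ) ^ 15 * XX ^ 600 * (TT * (TT ^ 700 / XX ^ 2700 + TT ^ 2 / 10 ^ k)) := by
      refine est.trans ?_
      gcongr
    have P1 : (10:ℝ) ^ (b * s * D0) ≤ TT ^ 1260 := by
      rw [hTT, ← pow_mul]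
      apply pow_le_pow_right₀ (by norm_num)
      calc b * s * D0 = s * (60 * U) := by rw [hD0, hU]; ring
        _ ≤ 21 * (60 * U) := Nat.mul_le_mul_right _ hs2
        _ = _ := by ring
    have hsD1 : s * D1 ≤ 2100 * b := by
      calc s * D1 ≤ 21 * D1 := Nat.mul_le_mul_right _ hs2
        _ = _ := by rw [hD1]; ring
    have P2 : (9:ℝ) ^ (s * D1) ≤ TT := by
      refine le_trans ?_ (hpow10 (s * D1) (by omega))
      gcongr; norm_num
    have P3 : ((36:ℝ) * 10 ^ b * 2 ^ r.natAbs) ^ (s * D1) ≤ TT := by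
      have e1 : (36:ℝ) * 10 ^ b * 2 ^ r.natAbs ≤ 10 ^ (2 + b + r.natAbs) := by
        rw [pow_add, pow_add]
        gcongr <;> norm_num
      calc ((36:ℝ) * 10 ^ b * 2 ^ r.natAbs) ^ (s * D1) ≤ (10 ^ (2 + b + r.natAbs)) ^ (s * D1) := by gcongr
        _ = 10 ^ ((2 + b + r.natAbs) * (s * D1)) := by rw [← pow_mul]
        _ ≤ TT := by
          apply hpow10
          calc (2 + b + r.natAbs) * (s * D1) ≤ (2 + b + r.natAbs) * (2100 * b) := Nat.mul_le_mul_left _ hsD1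
            _ = 2100 * (2 * b + b * b + b * r.natAbs) := by ring
            _ ≤ U := by omega
    have fin : XX ^ 1801 * TT ^ 3784 * (TT ^ 700 / XX ^ 2700 + TT ^ 2 / 10 ^ k) < 1 :=
      final_ineq XX TT (10 ^ k) hTT10 hTTXX hK
    have h45 : ((x:ℝ) ^ 15 * XX ^ 600) ^ 3 ≤ XX ^ 1801 := by
      calc ((x:ℝ) ^ 15 * XX ^ 600) ^ 3 = x ^ 45 * XX ^ 1800 := by rw [mul_pow, ← pow_mul, ← pow_mul]
        _ ≤ XX * XX ^ 1800 := by
          gcongr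
          exact pow_le_pow_right₀ hx1 (by omega)
        _ = _ := by rw [← pow_succ']
    set W := TT ^ 700 / XX ^ 2700 + TT ^ 2 / 10 ^ k with hW
    have hW0 : 0 < W := by positivity
    have key : 10 ^ (b * s * D0) * 9 ^ (s * D1) * |V| *
      ((D0 * D1 : ℝ) * ((x:ℝ) ^ (3 + 300 * U) * (x:ℝ) ^ (300 * U) * (10 ^ (b * s * D0) *
        (36 * 10 ^ b * 2 ^ r.natAbs) ^ (s * D1)))) ^ 2 ≤ XX ^ 1801 * TT ^ 3784 * W := by
      calc _ = 10 ^ (b * s * D0) * 9 ^ (s * D1) * |V| *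
          (((D0 * D1 : ℝ) * ((x:ℝ) ^ (3 + 300 * U) * (x:ℝ) ^ (300 * U))) * (10 ^ (b * s * D0) *
          (36 * 10 ^ b * 2 ^ r.natAbs) ^ (s * D1))) ^ 2 := by rw [mul_assoc (D0 * D1 : ℝ)]
        _ ≤ TT ^ 1260 * TT * ((x:ℝ) ^ 15 * XX ^ 600 * (TT * W)) *
          (((x:ℝ) ^ 15 * XX ^ 600) * (TT ^ 1260 * TT)) ^ 2 := by gcongr
        _ = ((x:ℝ) ^ 15 * XX ^ 600) ^ 3 * TT ^ 3784 * W := by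
          generalize (x:ℝ) ^ 15 * XX ^ 600 = n0
          have : TT ^ 3784 = TT ^ 1260 * TT ^ 1260 * TT ^ 1260 * TT ^ 4 := by
            rw [← pow_add, ← pow_add, ← pow_add]
          rw [this]
          generalize TT ^ 1260 = t0
          ring
        _ ≤ _ := by gcongr
    linarith [alt.trans key]
  have := zero_estimate D0 D1 q 21 (300 * U) (fun i j => (g i j : ℝ))
    (by obtain ⟨i, hi, j, hj, h⟩ := hg0; exact ⟨i, hi, j, hj, by exact_mod_cast h⟩)
    hD0q ξ ω hξ0 hξ1 hω0 (by omega)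
    (fun s hs1 hs2 τ hτ => by
      have := hVzero s hs1 hs2 τ hτ
      rw [Finset.sum_product_right] at this
      exact this)
  omega

theorem d2_zero_setup (α : ℝ) (hα : α ^ 3 = α + 1) (h1 : 1.3247 < α) (h2 : α < 1.3248)
    (n d ℓ₁ ℓ₂ : ℕ) (hd1 : 1 ≤ d) (hd : d ≤ 9) (hn : 1 ≤ n)
    (hℓ₁ : 54 ≤ ℓ₁) (heq : 9 * padovan n + d * 10 ^ ℓ₂ = d * 10 ^ (ℓ₁ + ℓ₂)) :
    ∃ δ : ℝ, |δ| ≤ 10 / 10 ^ ℓ₁ ∧ n + 3 ≤ 10 * (ℓ₁ + ℓ₂) ∧ ℓ₁ + ℓ₂ ≤ 2 * ℓ₁ ∧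
      α ^ (n + 3) = ((3 * α ^ 2 - 1) * d / 9) * 10 ^ (ℓ₁ + ℓ₂) * (1 + δ) := by
  obtain ⟨hc1, hc2⟩ := c_bounds α h1 h2
  have has := padovan_asymp α hα h1 h2 n
  have hdr1 : (1:ℝ) ≤ d := by exact_mod_cast hd1
  have hdr2 : (d:ℝ) ≤ 9 := by exact_mod_cast hd
  have heqr : 9 * (padovan n : ℝ) + d * 10 ^ ℓ₂ = d * (10 ^ ℓ₁ * 10 ^ ℓ₂) := by
    rw [← pow_add]; exact_mod_cast heq
  generalize hc : 3 * α ^ 2 - 1 = c at *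
  have hc0 : c ≠ 0 := by linarith
  have hd0 : (d:ℝ) ≠ 0 := by linarith
  have hA : (0:ℝ) < 10 ^ ℓ₁ := by positivity
  have hA54 : (10:ℝ) ^ 54 ≤ 10 ^ ℓ₁ := pow_le_pow_right₀ (by norm_num) hℓ₁
  have hB : (1:ℝ) ≤ 10 ^ ℓ₂ := one_le_pow₀ (by norm_num)
  have hM : (10:ℝ) ^ (ℓ₁ + ℓ₂) = 10 ^ ℓ₁ * 10 ^ ℓ₂ := pow_add _ _ _
  have hδ : ∃ δ : ℝ, |δ| ≤ 10 / 10 ^ ℓ₁ ∧ 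
      α ^ (n + 3) = (c * d / 9) * 10 ^ (ℓ₁ + ℓ₂) * (1 + δ) := by
    refine ⟨α ^ (n + 3) / ((c * d / 9) * 10 ^ (ℓ₁ + ℓ₂)) - 1, ?_, ?_⟩
    · set e := (padovan n : ℝ) - α ^ (n + 3) / c with he
      have e1 : α ^ (n + 3) = c * (padovan n - e) := by rw [he]; field_simp; ring
      have e2 : (padovan n : ℝ) = (d * (10 ^ ℓ₁ * 10 ^ ℓ₂) - d * 10 ^ ℓ₂) / 9 := by linarith
      have e3 : α ^ (n + 3) / ((c * d / 9) * 10 ^ (ℓ₁ + ℓ₂)) - 1 = 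
          (-1 - e * (9 / (d * 10 ^ ℓ₂))) / 10 ^ ℓ₁ := by
        rw [e1, e2, hM]
        field_simp
        ring
      rw [e3, abs_div, abs_of_pos hA]
      gcongr
      have e4 : 9 / ((d:ℝ) * 10 ^ ℓ₂) ≤ 9 := by
        rw [div_le_iff₀ (by positivity)]
        nlinarith
      have e5 : 0 ≤ 9 / ((d:ℝ) * 10 ^ ℓ₂) := by positivity
      have e6 : |e * (9 / (d * 10 ^ ℓ₂))| ≤ 1 * 9 := by
        rw [abs_mul, abs_of_nonneg e5]; gcongr
      rw [abs_le] at e6 ⊢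
      constructor <;> linarith [e6.1, e6.2]
    · have : (c * d / 9) * (10:ℝ) ^ (ℓ₁ + ℓ₂) ≠ 0 := by positivity
      field_simp
      ring
  obtain ⟨δ, hδ1, hrel⟩ := hδ
  have hn' : n + 3 ≤ 10 * (ℓ₁ + ℓ₂) := by
    by_contra hcon
    have hcon : 9 * (ℓ₁ + ℓ₂ + 1) ≤ n + 3 := by omega
    have g1 : (10:ℝ) ≤ α ^ 9 := by
      calc (10:ℝ) ≤ 1.3247 ^ 9 := by norm_num
        _ ≤ α ^ 9 := by gcongr
    have g2 : (10:ℝ) ^ (ℓ₁ + ℓ₂ + 1) ≤ α ^ (n + 3) := by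
      calc (10:ℝ) ^ (ℓ₁ + ℓ₂ + 1) ≤ (α ^ 9) ^ (ℓ₁ + ℓ₂ + 1) := by gcongr
        _ = α ^ (9 * (ℓ₁ + ℓ₂ + 1)) := by rw [← pow_mul]
        _ ≤ _ := pow_le_pow_right₀ (by linarith) hcon
    have g3' : |δ| ≤ 0.1 := by
      refine hδ1.trans ?_
      rw [div_le_iff₀ hA]
      linarith [show (100:ℝ) ≤ 10 ^ 54 by norm_num]
    obtain ⟨g30, g3⟩ := abs_le.mp g3'
    have g4 : c * d / 9 ≤ 5 := by
      have : c * d ≤ 5 * 9 := mul_le_mul hc2 hdr2 (by linarith) (by linarith)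
      linarith
    have g5 : α ^ (n + 3) ≤ 5 * 10 ^ (ℓ₁ + ℓ₂) * (1 + 0.1) := by
      rw [hrel]
      gcongr
      linarith
    rw [pow_succ] at g2
    have : (0:ℝ) < 10 ^ (ℓ₁ + ℓ₂) := by positivity
    linarith
  refine ⟨δ, hδ1, hn', ?_, hrel⟩
  by_contra hcon
  have hl : ℓ₁ < ℓ₂ := by omega
  have hdvd : 2 ^ ℓ₂ ∣ padovan n := by
    have t1 : 2 ^ ℓ₂ ∣ 9 * padovan n := by
      have t0 : (2:ℕ) ^ ℓ₂ ∣ 10 ^ ℓ₂ := pow_dvd_pow_of_dvd (by norm_num) _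
      have t2 : 2 ^ ℓ₂ ∣ d * 10 ^ ℓ₂ := Dvd.dvd.mul_left t0 _
      have t3 : 2 ^ ℓ₂ ∣ d * 10 ^ (ℓ₁ + ℓ₂) := by
        rw [pow_add]; exact Dvd.dvd.mul_left (Dvd.dvd.mul_left t0 _) _
      rw [← heq] at t3
      exact (Nat.dvd_add_left t2).mp t3
    exact (Nat.Coprime.pow_left ℓ₂ (by norm_num)).dvd_of_dvd_mul_left t1
  have hb := two_pow_dvd_padovan n ℓ₂ hn (by omega) hdvd
  have hpow : ∀ m, 55 ≤ m → 100 * (m + 1) ≤ 2 ^ m := by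
    intro m hm
    induction m, hm using Nat.le_induction with
    | base => norm_num
    | succ k hk ih => rw [pow_succ]; omega
  have := hpow ℓ₂ (by omega)
  omega

theorem log_series (x L : ℝ) (N : ℕ) (t u : ℝ) (hx : |x| ≤ 1 / 2)
    (hs : |(∑ i ∈ Finset.range N, x ^ (i + 1) / (i + 1)) + L| ≤ t) (hu : 2 * |x| ^ (N + 1) ≤ u) :
    |Real.log (1 - x) - L| ≤ t + u := by
  have h := Real.abs_log_sub_add_sum_range_le (x := x) (by linarith) N
  have h2 : |x| ^ (N + 1) / (1 - |x|) ≤ 2 * |x| ^ (N + 1) := by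
    rw [div_le_iff₀ (by linarith)]
    have : 0 ≤ |x| ^ (N + 1) := by positivity
    nlinarith
  have e : Real.log (1 - x) - L = ((∑ i ∈ Finset.range N, x ^ (i + 1) / (i + 1)) + Real.log (1 - x))
    - ((∑ i ∈ Finset.range N, x ^ (i + 1) / (i + 1)) + L) := by ring
  rw [e]
  refine (abs_sub _ _).trans ?_
  linarith

theorem log_aux_225 : |Real.log (1 - (1 / 225)) - (-445435034938027980049578956336411833159842279939688823189425281879858925199061719052413224385843447280356486664228770403266547404195241306052512312268569074922249111500 / 10 ^ 170)| ≤ 1 / 10 ^ 165 + 1 / 10 ^ 165 := by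
  refine log_series (1 / 225) _ 72 _ _ ?_ ?_ ?_
  · rw [abs_le]; constructor <;> norm_num
  · simp only [Finset.sum_range_succ, Finset.sum_range_zero]; rw [abs_le]; constructor <;> norm_num
  · rw [abs_of_nonneg (by norm_num)]; norm_num

theorem log_aux_126 : |Real.log (1 - (1 / 126)) - (-796816964917687351079733906784478843076191678206218031151515228342510803600862325035170093221555971110432429319086943097326525732292844338638273594241437638833866480786 / 10 ^ 170)| ≤ 1 / 10 ^ 165 + 1 / 10 ^ 165 := by
  refine log_series (1 / 126) _ 80 _ _ ?_ ?_ ?_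
  · rw [abs_le]; constructor <;> norm_num
  · simp only [Finset.sum_range_succ, Finset.sum_range_zero]; rw [abs_le]; constructor <;> norm_num
  · rw [abs_of_nonneg (by norm_num)]; norm_num

theorem log_aux_2401 : |Real.log (1 - (1 / 2401)) - (-41657988521623273848646310693509447214498016638358767417043569749907252587899698743384836930135987433673661116214343665139316734062236711244351678553442827013797409749 / 10 ^ 170)| ≤ 1 / 10 ^ 165 + 1 / 10 ^ 165 := by
  refine log_series (1 / 2401) _ 51 _ _ ?_ ?_ ?_
  · rw [abs_le]; constructor <;> norm_num
  · simp only [Finset.sum_range_succ, Finset.sum_range_zero]; rw [abs_le]; constructor <;> norm_num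
  · rw [abs_of_nonneg (by norm_num)]; norm_num

theorem log_aux_4375 : |Real.log (1 - (1 / 4375)) - (-22859755500165432444129643207378713155610753643065984644137087844213908274284258702040026804666113513522181043764658035822335770472233728114071801270584996367606298097 / 10 ^ 170)| ≤ 1 / 10 ^ 165 + 1 / 10 ^ 165 := by
  refine log_series (1 / 4375) _ 47 _ _ ?_ ?_ ?_
  · rw [abs_le]; constructor <;> norm_num
  · simp only [Finset.sum_range_succ, Finset.sum_range_zero]; rw [abs_le]; constructor <;> norm_num
  · rw [abs_of_nonneg (by norm_num)]; norm_num

theorem log_aux_smooth (s : ℝ) (i j k l : ℕ) (hs : s = 2 ^ i * 3 ^ j * 5 ^ k * 7 ^ l) :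
    Real.log s = i * Real.log 2 + j * Real.log 3 + k * Real.log 5 + l * Real.log 7 := by
  rw [hs, Real.log_mul (by positivity) (by positivity), Real.log_mul (by positivity) (by positivity),
    Real.log_mul (by positivity) (by positivity), Real.log_pow, Real.log_pow, Real.log_pow, Real.log_pow]

theorem log_primes : |Real.log 2 - (693147180559945309417232121458176568075500134360255254120680009493393621969694715605863326996418687542001481020570685733685520235758130557032670751635075961930727571 / 10 ^ 165)| ≤ 1 / 10 ^ 160 ∧
    |Real.log 3 - (1098612288668109691395245236922525704647490557822749451734694333637494293218608966873615754813732088787970029065957865742368004225930519821052801870767277410603162769 / 10 ^ 165)| ≤ 1 / 10 ^ 160 ∧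
    |Real.log 5 - (1609437912434100374600759333226187639525601354268517721912647891474178987707657764630133878093179610799966303021715562899724005229324676199633616617463705727552179637 / 10 ^ 165)| ≤ 1 / 10 ^ 160 ∧
    |Real.log 7 - (1945910149055313305105352743443179729637084729581861188459390149937579862752069267787658498587871526993061694205851140911723752257677786843148958095163900775907824468 / 10 ^ 165)| ≤ 1 / 10 ^ 160 := by
  have r225 := log_aux_smooth (2 ^ 5 * 3 ^ 0 * 5 ^ 0 * 7 ^ 1 : ℝ) 5 0 0 1 rfl
  have r225' := log_aux_smooth (2 ^ 0 * 3 ^ 2 * 5 ^ 2 * 7 ^ 0 : ℝ) 0 2 2 0 rfl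
  have r225e : Real.log (1 - (1 / 225)) = Real.log (2 ^ 5 * 3 ^ 0 * 5 ^ 0 * 7 ^ 1 : ℝ) - Real.log (2 ^ 0 * 3 ^ 2 * 5 ^ 2 * 7 ^ 0 : ℝ) := by
    rw [← Real.log_div (by positivity) (by positivity)]; congr 1; norm_num
  rw [r225, r225'] at r225e
  have b225 := log_aux_225
  rw [r225e, abs_le] at b225
  obtain ⟨b225l, b225u⟩ := b225
  have r126 := log_aux_smooth (2 ^ 0 * 3 ^ 0 * 5 ^ 3 * 7 ^ 0 : ℝ) 0 0 3 0 rfl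
  have r126' := log_aux_smooth (2 ^ 1 * 3 ^ 2 * 5 ^ 0 * 7 ^ 1 : ℝ) 1 2 0 1 rfl
  have r126e : Real.log (1 - (1 / 126)) = Real.log (2 ^ 0 * 3 ^ 0 * 5 ^ 3 * 7 ^ 0 : ℝ) - Real.log (2 ^ 1 * 3 ^ 2 * 5 ^ 0 * 7 ^ 1 : ℝ) := by
    rw [← Real.log_div (by positivity) (by positivity)]; congr 1; norm_num
  rw [r126, r126'] at r126e
  have b126 := log_aux_126
  rw [r126e, abs_le] at b126
  obtain ⟨b126l, b126u⟩ := b126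
  have r2401 := log_aux_smooth (2 ^ 5 * 3 ^ 1 * 5 ^ 2 * 7 ^ 0 : ℝ) 5 1 2 0 rfl
  have r2401' := log_aux_smooth (2 ^ 0 * 3 ^ 0 * 5 ^ 0 * 7 ^ 4 : ℝ) 0 0 0 4 rfl
  have r2401e : Real.log (1 - (1 / 2401)) = Real.log (2 ^ 5 * 3 ^ 1 * 5 ^ 2 * 7 ^ 0 : ℝ) - Real.log (2 ^ 0 * 3 ^ 0 * 5 ^ 0 * 7 ^ 4 : ℝ) := by
    rw [← Real.log_div (by positivity) (by positivity)]; congr 1; norm_num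
  rw [r2401, r2401'] at r2401e
  have b2401 := log_aux_2401
  rw [r2401e, abs_le] at b2401
  obtain ⟨b2401l, b2401u⟩ := b2401
  have r4375 := log_aux_smooth (2 ^ 1 * 3 ^ 7 * 5 ^ 0 * 7 ^ 0 : ℝ) 1 7 0 0 rfl
  have r4375' := log_aux_smooth (2 ^ 0 * 3 ^ 0 * 5 ^ 4 * 7 ^ 1 : ℝ) 0 0 4 1 rfl
  have r4375e : Real.log (1 - (1 / 4375)) = Real.log (2 ^ 1 * 3 ^ 7 * 5 ^ 0 * 7 ^ 0 : ℝ) - Real.log (2 ^ 0 * 3 ^ 0 * 5 ^ 4 * 7 ^ 1 : ℝ) := by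
    rw [← Real.log_div (by positivity) (by positivity)]; congr 1; norm_num
  rw [r4375, r4375'] at r4375e
  have b4375 := log_aux_4375
  rw [r4375e, abs_le] at b4375
  obtain ⟨b4375l, b4375u⟩ := b4375
  push_cast at *
  clear r225 r225' r225e r126 r126' r126e r2401 r2401' r2401e r4375 r4375' r4375e
  generalize Real.log 2 = x2 at *
  generalize Real.log 3 = x3 at *
  generalize Real.log 5 = x5 at *
  generalize Real.log 7 = x7 at *
  norm_num at *
  refine ⟨?_, ?_, ?_, ?_⟩ <;> rw [abs_le] <;> constructor <;> linarith

theorem log_aux_alpha : |Real.log (1 - (-7334336603555240825779934829674874562650081237481531076684488144244216285393054660535303190884735679407951565606183811783350112040799247411435119959391455814463 / 10 ^ 165)) - (7334309707440043728411389016586171284383592786163611627123281231253716969216685906563852653587449451278407605292044596772859987135940492773584399204053931261153 / 10 ^ 165)| ≤ 1 / 10 ^ 158 + 1 / 10 ^ 158 := by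
  refine log_series (-7334336603555240825779934829674874562650081237481531076684488144244216285393054660535303190884735679407951565606183811783350112040799247411435119959391455814463 / 10 ^ 165) _ 30 _ _ ?_ ?_ ?_
  · rw [abs_le]; constructor <;> norm_num
  · simp only [Finset.sum_range_succ, Finset.sum_range_zero]; rw [abs_le]; constructor <;> norm_num
  · rw [abs_of_nonpos (by norm_num)]; norm_num

theorem alpha_bracket (α : ℝ) (hα : α ^ 3 = α + 1) (h1 : 1.3247 < α) (h2 : α < 1.3248) :
    1 - (-7334336603555240825779934829674874562650081237481531076684488144244216285393054660535303190884735679407951565606183811783350112040799247411435119959391455814463 / 10 ^ 165) ≤ α * (2 ^ 15 * 3 ^ 13 / (5 * 7 ^ 12)) ∧ α * (2 ^ 15 * 3 ^ 13 / (5 * 7 ^ 12)) ≤ 1 - (-7334336603555240825779934829674874562650081237481531076684488144244216285393054660535303190884735679407951565606183811783350112040799247411435119959391455814464 / 10 ^ 165) := by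
  have mono : ∀ r : ℝ, 1.3 ≤ r → (α - r) * (α ^ 2 + α * r + r ^ 2 - 1) = - (r ^ 3 - r - 1) := by
    intro r hr; linear_combination hα
  constructor
  · have h := mono ((1 - (-7334336603555240825779934829674874562650081237481531076684488144244216285393054660535303190884735679407951565606183811783350112040799247411435119959391455814463 / 10 ^ 165)) / (2 ^ 15 * 3 ^ 13 / (5 * 7 ^ 12))) (by norm_num)
    rw [← div_le_iff₀ (by positivity)]
    by_contra hc
    have hc' := not_le.mp hc
    set r : ℝ := (1 - (-7334336603555240825779934829674874562650081237481531076684488144244216285393054660535303190884735679407951565606183811783350112040799247411435119959391455814463 / 10 ^ 165)) / (2 ^ 15 * 3 ^ 13 / (5 * 7 ^ 12)) with hr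
    have h3 : - (r ^ 3 - r - 1) > 0 := by rw [hr]; norm_num
    have h4 : (1.3:ℝ) ≤ r := by rw [hr]; norm_num
    clear_value r
    have h5 : 0 < α ^ 2 + α * r + r ^ 2 - 1 := by nlinarith
    nlinarith [mul_pos (sub_pos.mpr hc') h5]
  · have h := mono ((1 - (-7334336603555240825779934829674874562650081237481531076684488144244216285393054660535303190884735679407951565606183811783350112040799247411435119959391455814464 / 10 ^ 165)) / (2 ^ 15 * 3 ^ 13 / (5 * 7 ^ 12))) (by norm_num)
    rw [← le_div_iff₀ (by positivity)]
    by_contra hc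
    have hc' := not_le.mp hc
    set r : ℝ := (1 - (-7334336603555240825779934829674874562650081237481531076684488144244216285393054660535303190884735679407951565606183811783350112040799247411435119959391455814464 / 10 ^ 165)) / (2 ^ 15 * 3 ^ 13 / (5 * 7 ^ 12)) with hr
    have h3 : - (r ^ 3 - r - 1) < 0 := by rw [hr]; norm_num
    have h4 : (1.3:ℝ) ≤ r := by rw [hr]; norm_num
    clear_value r
    have h5 : 0 < α ^ 2 + α * r + r ^ 2 - 1 := by nlinarith
    nlinarith [mul_pos (sub_pos.mpr hc') h5]

theorem log_near (y lo hi L t : ℝ) (hlo : 0.9 ≤ lo) (h1 : lo ≤ y) (h2 : y ≤ hi)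
    (hL : |Real.log lo - L| ≤ t) : |Real.log y - L| ≤ t + 2 * (hi - lo) := by
  have a1 : Real.log lo ≤ Real.log y := Real.log_le_log (by linarith) h1
  have a2 : Real.log y - Real.log lo ≤ 2 * (hi - lo) := by
    rw [← Real.log_div (by linarith) (by linarith)]
    have := Real.log_le_sub_one_of_pos (show 0 < y / lo by apply div_pos <;> linarith)
    refine this.trans ?_
    rw [div_sub_one (by linarith), div_le_iff₀ (by linarith)]
    nlinarith
  rw [abs_le] at hL ⊢
  constructor <;> linarith [hL.1, hL.2]

theorem log_alpha (α : ℝ) (hα : α ^ 3 = α + 1) (h1 : 1.3247 < α) (h2 : α < 1.3248) :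
    |Real.log α - (281199574322961846512050764067878299792023225744066462675730334318038453062120891322987707475494054792525318733522005228938946707976538228737401749328973325575304846 / 10 ^ 165)| ≤ 1 / 10 ^ 155 := by
  obtain ⟨g1, g2⟩ := alpha_bracket α hα h1 h2
  have h := log_near _ _ _ _ _ (by norm_num) g1 g2 log_aux_alpha
  have hα0 : α ≠ 0 := by linarith
  rw [Real.log_mul hα0 (by positivity)] at h
  obtain ⟨p2, p3, p5, p7⟩ := log_primes
  have ra := log_aux_smooth (2 ^ 15 * 3 ^ 13 * 5 ^ 0 * 7 ^ 0 : ℝ) 15 13 0 0 rfl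
  have ra' := log_aux_smooth (2 ^ 0 * 3 ^ 0 * 5 ^ 1 * 7 ^ 12 : ℝ) 0 0 1 12 rfl
  have rae : Real.log (2 ^ 15 * 3 ^ 13 / (5 * 7 ^ 12)) = Real.log (2 ^ 15 * 3 ^ 13 * 5 ^ 0 * 7 ^ 0 : ℝ) - Real.log (2 ^ 0 * 3 ^ 0 * 5 ^ 1 * 7 ^ 12 : ℝ) := by
    rw [← Real.log_div (by positivity) (by positivity)]; congr 1; norm_num
  rw [ra, ra'] at rae
  rw [rae, abs_le] at h
  rw [abs_le] at p2 p3 p5 p7 ⊢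
  push_cast at h
  clear ra ra' rae g1 g2
  obtain ⟨hl, hu⟩ := h
  obtain ⟨p2l, p2u⟩ := p2
  obtain ⟨p3l, p3u⟩ := p3
  obtain ⟨p5l, p5u⟩ := p5
  obtain ⟨p7l, p7u⟩ := p7
  generalize Real.log α = xa at *
  generalize Real.log 2 = x2 at *
  generalize Real.log 3 = x3 at *
  generalize Real.log 5 = x5 at *
  generalize Real.log 7 = x7 at *
  clear hα h1 h2 hα0
  norm_num at *
  constructor <;> linarith

theorem log_aux_c : |Real.log (1 - (57044267131566317767024948409949417677294042527466049286687910980550428008244919612883628784873 / 10 ^ 100)) - (-57044429834605698645465286957552893061539402131098558166780337747975994265726533720847302617989 / 10 ^ 100)| ≤ 1 / 10 ^ 90 + 1 / 10 ^ 90 := by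
  refine log_series (57044267131566317767024948409949417677294042527466049286687910980550428008244919612883628784873 / 10 ^ 100) _ 18 _ _ ?_ ?_ ?_
  · rw [abs_le]; constructor <;> norm_num
  · simp only [Finset.sum_range_succ, Finset.sum_range_zero]; rw [abs_le]; constructor <;> norm_num
  · rw [abs_of_nonneg (by norm_num)]; norm_num

theorem log_c (α : ℝ) (hα : α ^ 3 = α + 1) (h1 : 1.3247 < α) (h2 : α < 1.3248) :
    |Real.log (3 * α ^ 2 - 1) - (14503561277077758081906423504654554661722243544886881032894620050979350868766756960286547771709958225 / 10 ^ 100)| ≤ 1 / 10 ^ 88 := by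
  obtain ⟨g1, g2⟩ := alpha_bracket α hα h1 h2
  have k1 : (13247179572447460259609088544780973407344040569017333645340150503028278512455475940546993479817872803299109209947422074251089026390 / 10 ^ 130 : ℝ) ≤ α := by
    refine le_trans ?_ ((div_le_iff₀ (by positivity)).mpr g1); norm_num
  have k2 : α ≤ (13247179572447460259609088544780973407344040569017333645340150503028278512455475940546993479817872803299109209947422074251089026391 / 10 ^ 130 : ℝ) := by
    refine le_trans ((le_div_iff₀ (by positivity)).mpr g2) ?_; norm_num
  have k3 : (13247179572447460259609088544780973407344040569017333645340150503028278512455475940546993479817872803299109209947422074251089026390 / 10 ^ 130 : ℝ) ^ 2 ≤ α ^ 2 := pow_le_pow_left₀ (by positivity) k1 2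
  have k4 : α ^ 2 ≤ (13247179572447460259609088544780973407344040569017333645340150503028278512455475940546993479817872803299109209947422074251089026391 / 10 ^ 130 : ℝ) ^ 2 := pow_le_pow_left₀ (by linarith) k2 2
  have hc0 := (c_bounds α h1 h2).1
  clear g1 g2 k1 k2
  generalize α ^ 2 = z at *
  have j1 : 1 - (57044267131566317767024948409949417677294042527466049286687910980550428008244919612883628784873 / 10 ^ 100) ≤ (3 * z - 1) * (7 ^ 25 / (2 ^ 7 * 3 ^ 28 * 5 ^ 9)) := by
    rw [← div_le_iff₀ (by positivity)]
    refine le_trans ?_ (sub_le_sub_right (mul_le_mul_of_nonneg_left k3 (by norm_num)) 1)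
    norm_num
  have j2 : (3 * z - 1) * (7 ^ 25 / (2 ^ 7 * 3 ^ 28 * 5 ^ 9)) ≤ 1 - (57044267131566317767024948409949417677294042527466049286687910980550428008244919612883628784871 / 10 ^ 100) := by
    rw [← le_div_iff₀ (by positivity)]
    refine le_trans (sub_le_sub_right (mul_le_mul_of_nonneg_left k4 (by norm_num)) 1) ?_
    norm_num
  have h := log_near _ _ _ _ _ (by norm_num) j1 j2 log_aux_c
  rw [Real.log_mul (by linarith) (by positivity)] at h
  obtain ⟨p2, p3, p5, p7⟩ := log_primes
  have ra := log_aux_smooth (2 ^ 0 * 3 ^ 0 * 5 ^ 0 * 7 ^ 25 : ℝ) 0 0 0 25 rfl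
  have ra' := log_aux_smooth (2 ^ 7 * 3 ^ 28 * 5 ^ 9 * 7 ^ 0 : ℝ) 7 28 9 0 rfl
  have rae : Real.log (7 ^ 25 / (2 ^ 7 * 3 ^ 28 * 5 ^ 9)) = Real.log (2 ^ 0 * 3 ^ 0 * 5 ^ 0 * 7 ^ 25 : ℝ) - Real.log (2 ^ 7 * 3 ^ 28 * 5 ^ 9 * 7 ^ 0 : ℝ) := by
    rw [← Real.log_div (by positivity) (by positivity)]; congr 1; norm_num
  rw [ra, ra'] at rae
  rw [rae, abs_le] at h
  rw [abs_le] at p2 p3 p5 p7 ⊢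
  push_cast at h
  clear ra ra' rae j1 j2 k3 k4
  obtain ⟨hl, hu⟩ := h
  obtain ⟨p2l, p2u⟩ := p2
  obtain ⟨p3l, p3u⟩ := p3
  obtain ⟨p5l, p5u⟩ := p5
  obtain ⟨p7l, p7u⟩ := p7
  generalize Real.log (3 * z - 1) = xa at *
  generalize Real.log 2 = x2 at *
  generalize Real.log 3 = x3 at *
  generalize Real.log 5 = x5 at *
  generalize Real.log 7 = x7 at *
  clear hα h1 h2 hc0
  norm_num at *
  constructor <;> linarith

theorem bd_generic (la L lt e η ε N : ℝ) (n' M : ℕ) (Q p g : ℤ) (hN : (n':ℝ) ≤ N)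
    (hQ : 0 ≤ Q) (hp : |Q * la - p * L| ≤ e) (hL : 2 ≤ L)
    (hl : |n' * la - M * L - lt| ≤ ε) (hg1 : η < |Q * lt - g * L|) (hg2 : |Q * lt - g * L| ≤ 1.3)
    (hs : N * e + Q * ε ≤ η) (hη : η ≤ 0.5) : False := by
  have h1 : |(n':ℝ) * (Q * la - p * L)| ≤ N * e := by
    rw [abs_mul, Nat.abs_cast]
    exact mul_le_mul hN hp (abs_nonneg _) (le_trans (Nat.cast_nonneg _) hN)
  have hQr : (0:ℝ) ≤ Q := by exact_mod_cast hQ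
  have h2 : |(Q:ℝ) * (n' * la - M * L - lt)| ≤ Q * ε := by
    rw [abs_mul, abs_of_nonneg hQr]; gcongr
  have h3 : (((n' : ℤ) * p - Q * M - g : ℤ) : ℝ) * L = (Q * lt - g * L) +
      (Q:ℝ) * (n' * la - M * L - lt) - (n':ℝ) * (Q * la - p * L) := by
    push_cast; ring
  generalize ((n' : ℤ) * p - Q * M - g : ℤ) = k at h3
  generalize (Q:ℝ) * lt - g * L = u at *
  generalize (Q:ℝ) * (n' * la - M * L - lt) = v at *
  generalize (n':ℝ) * (Q * la - p * L) = z at *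
  have h4 : |(k:ℝ) * L| ≤ 1.8 := by
    rw [h3, abs_le]; rw [abs_le] at h1 h2 hg2
    constructor <;> linarith [h1.1, h1.2, h2.1, h2.2, hg2.1, hg2.2]
  have hk : k = 0 := by
    by_contra hk
    have : (1:ℝ) ≤ |(k:ℝ)| := by exact_mod_cast Int.one_le_abs hk
    rw [abs_mul, abs_of_pos (by linarith : (0:ℝ) < L)] at h4
    nlinarith
  rw [hk] at h3
  have h5 : u = z - v := by push_cast at h3; linarith
  have h6 : |u| ≤ |z| + |v| := by rw [h5]; exact abs_sub _ _
  linarith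

theorem log_ten_num : |Real.log 10 - (23025850929940456840179914546843642076011014886287729760333279009675726096773524802359972050895982983419677840422862486334095254650828067566662873690987816894829 / 10 ^ 160)| ≤ 1 / 10 ^ 158 := by
  obtain ⟨p2, p3, p5, p7⟩ := log_primes
  rw [show (10:ℝ) = 2 * 5 by norm_num, Real.log_mul (by norm_num) (by norm_num)]
  clear p3 p7
  rw [abs_le] at p2 p5 ⊢
  obtain ⟨p2l, p2u⟩ := p2
  obtain ⟨p5l, p5u⟩ := p5
  generalize Real.log 2 = x2 at *
  generalize Real.log 5 = x5 at *
  norm_num at *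
  constructor <;> linarith

theorem e_one (α : ℝ) (hα : α ^ 3 = α + 1) (h1 : 1.3247 < α) (h2 : α < 1.3248) :
    |((7259250844085850261090489929171762813393551725081602082225767925361051979737 : ℤ) : ℝ) * Real.log α - ((886524564704033379725621398477147446320621785289625749212547766102323183886 : ℤ) : ℝ) * Real.log 10| ≤ 2 / 10 ^ 78 ∧
    |((139228 : ℤ) : ℝ) * Real.log α - ((17003 : ℤ) : ℝ) * Real.log 10| ≤ 3 / 10 ^ 6 := by
  have ha := log_alpha α hα h1 h2
  have ht := log_ten_num
  rw [abs_le] at ha ht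
  obtain ⟨hal, hau⟩ := ha
  obtain ⟨htl, htu⟩ := ht
  generalize Real.log α = xa at *
  generalize Real.log 10 = xt at *
  push_cast
  clear hα h1 h2
  norm_num at *
  refine ⟨?_, ?_⟩ <;> rw [abs_le] <;> constructor <;> linarith

theorem theta_numeric (α : ℝ) (hα : α ^ 3 = α + 1) (h1 : 1.3247 < α) (h2 : α < 1.3248)
    (d : ℕ) (hd0 : 0 < d) (i j k l : ℕ) (g₁ g₂ : ℤ)
    (hd : Real.log (d:ℝ) = i * Real.log 2 + j * Real.log 3 + k * Real.log 5 + l * Real.log 7)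
    (T : ℝ) (hT : |((14503561277077758081906423504654554661722243544886881032894620050979350868766756960286547771709958225 / 10 ^ 100) : ℝ) + ((i:ℝ) * (693147180559945309417232121458176568075500134360255254120680009493393621969694715605863326996418687542001481020570685733685520235758130557032670751635075961930727571 / 10 ^ 165) + (j:ℝ) * (1098612288668109691395245236922525704647490557822749451734694333637494293218608966873615754813732088787970029065957865742368004225930519821052801870767277410603162769 / 10 ^ 165) + (k:ℝ) * (1609437912434100374600759333226187639525601354268517721912647891474178987707657764630133878093179610799966303021715562899724005229324676199633616617463705727552179637 / 10 ^ 165) + (l:ℝ) * (1945910149055313305105352743443179729637084729581861188459390149937579862752069267787658498587871526993061694205851140911723752257677786843148958095163900775907824468 / 10 ^ 165))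
      - 2 * (1098612288668109691395245236922525704647490557822749451734694333637494293218608966873615754813732088787970029065957865742368004225930519821052801870767277410603162769 / 10 ^ 165) - T| + ((i:ℝ) + j + k + l) / 10 ^ 160 + 2 / 10 ^ 160 + 1 / 10 ^ 88 ≤ 2 / 10 ^ 88)
    (hg₁ : (0.2 ≤ 7259250844085850261090489929171762813393551725081602082225767925361051979737 * T - g₁ * (23025850929940456840179914546843642076011014886287729760333279009675726096773524802359972050895982983419677840422862486334095254650828067566662873690987816894829 / 10 ^ 160) ∧ 7259250844085850261090489929171762813393551725081602082225767925361051979737 * T - g₁ * (23025850929940456840179914546843642076011014886287729760333279009675726096773524802359972050895982983419677840422862486334095254650828067566662873690987816894829 / 10 ^ 160) ≤ 1.2 ∧ |(g₁:ℝ)| ≤ 10 ^ 80) ∨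
      (7259250844085850261090489929171762813393551725081602082225767925361051979737 * T - g₁ * (23025850929940456840179914546843642076011014886287729760333279009675726096773524802359972050895982983419677840422862486334095254650828067566662873690987816894829 / 10 ^ 160) ≤ -0.2 ∧ -1.2 ≤ 7259250844085850261090489929171762813393551725081602082225767925361051979737 * T - g₁ * (23025850929940456840179914546843642076011014886287729760333279009675726096773524802359972050895982983419677840422862486334095254650828067566662873690987816894829 / 10 ^ 160) ∧ |(g₁:ℝ)| ≤ 10 ^ 80))
    (hg₂ : (0.19 ≤ 139228 * T - g₂ * (23025850929940456840179914546843642076011014886287729760333279009675726096773524802359972050895982983419677840422862486334095254650828067566662873690987816894829 / 10 ^ 160) ∧ 139228 * T - g₂ * (23025850929940456840179914546843642076011014886287729760333279009675726096773524802359972050895982983419677840422862486334095254650828067566662873690987816894829 / 10 ^ 160) ≤ 1.2 ∧ |(g₂:ℝ)| ≤ 10 ^ 80) ∨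
      (139228 * T - g₂ * (23025850929940456840179914546843642076011014886287729760333279009675726096773524802359972050895982983419677840422862486334095254650828067566662873690987816894829 / 10 ^ 160) ≤ -0.19 ∧ -1.2 ≤ 139228 * T - g₂ * (23025850929940456840179914546843642076011014886287729760333279009675726096773524802359972050895982983419677840422862486334095254650828067566662873690987816894829 / 10 ^ 160) ∧ |(g₂:ℝ)| ≤ 10 ^ 80)) :
    (0.15 < |((7259250844085850261090489929171762813393551725081602082225767925361051979737 : ℤ) : ℝ) * Real.log ((3 * α ^ 2 - 1) * d / 9) - g₁ * Real.log 10| ∧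
     |((7259250844085850261090489929171762813393551725081602082225767925361051979737 : ℤ) : ℝ) * Real.log ((3 * α ^ 2 - 1) * d / 9) - g₁ * Real.log 10| ≤ 1.3) ∧
    (0.15 < |((139228 : ℤ) : ℝ) * Real.log ((3 * α ^ 2 - 1) * d / 9) - g₂ * Real.log 10| ∧
     |((139228 : ℤ) : ℝ) * Real.log ((3 * α ^ 2 - 1) * d / 9) - g₂ * Real.log 10| ≤ 1.3) := by
  have hc := log_c α hα h1 h2
  have ht := log_ten_num
  have hc0 := (c_bounds α h1 h2).1
  obtain ⟨p2, p3, p5, p7⟩ := log_primes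
  have hd0' : (d:ℝ) ≠ 0 := by positivity
  have hd1 : (0:ℝ) < d := by positivity
  have e : Real.log ((3 * α ^ 2 - 1) * d / 9) = Real.log (3 * α ^ 2 - 1) +
      (i * Real.log 2 + j * Real.log 3 + k * Real.log 5 + l * Real.log 7) - 2 * Real.log 3 := by
    rw [Real.log_div (by apply mul_ne_zero _ hd0'; linarith) (by norm_num), Real.log_mul (by linarith) hd0', hd,
      show (9:ℝ) = 3 ^ 2 by norm_num, Real.log_pow]
    push_cast; ring
  have key : |Real.log ((3 * α ^ 2 - 1) * d / 9) - T| ≤ 2 / 10 ^ 88 := by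
    refine le_trans ?_ hT
    rw [e]
    clear hg₁ hg₂ hT e ht
    generalize Real.log (3 * α ^ 2 - 1) = xc at *
    generalize Real.log 2 = x2 at *
    generalize Real.log 3 = x3 at *
    generalize Real.log 5 = x5 at *
    generalize Real.log 7 = x7 at *
    generalize ((14503561277077758081906423504654554661722243544886881032894620050979350868766756960286547771709958225 / 10 ^ 100) : ℝ) = c0 at *
    generalize ((693147180559945309417232121458176568075500134360255254120680009493393621969694715605863326996418687542001481020570685733685520235758130557032670751635075961930727571 / 10 ^ 165) : ℝ) = y2 at *
    generalize ((1098612288668109691395245236922525704647490557822749451734694333637494293218608966873615754813732088787970029065957865742368004225930519821052801870767277410603162769 / 10 ^ 165) : ℝ) = y3 at *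
    generalize ((1609437912434100374600759333226187639525601354268517721912647891474178987707657764630133878093179610799966303021715562899724005229324676199633616617463705727552179637 / 10 ^ 165) : ℝ) = y5 at *
    generalize ((1945910149055313305105352743443179729637084729581861188459390149937579862752069267787658498587871526993061694205851140911723752257677786843148958095163900775907824468 / 10 ^ 165) : ℝ) = y7 at *
    have q : ∀ (m : ℕ) (x y : ℝ), |x - y| ≤ 1 / 10 ^ 160 → |m * (x - y)| ≤ m / 10 ^ 160 := by
      intro m x y h
      rw [abs_mul, Nat.abs_cast, div_eq_mul_one_div]; gcongr
    have q2 := abs_le.mp (q i _ _ p2)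
    have q3 := abs_le.mp (q j _ _ p3)
    have q5 := abs_le.mp (q k _ _ p5)
    have q7 := abs_le.mp (q l _ _ p7)
    have r1 := neg_abs_le (c0 + (i * y2 + j * y3 + k * y5 + l * y7) - 2 * y3 - T)
    have r2 := le_abs_self (c0 + (i * y2 + j * y3 + k * y5 + l * y7) - 2 * y3 - T)
    generalize |c0 + (i * y2 + j * y3 + k * y5 + l * y7) - 2 * y3 - T| = z at *
    rw [abs_le] at p3 hc ⊢
    obtain ⟨p3l, p3u⟩ := p3
    obtain ⟨hcl, hcu⟩ := hc
    obtain ⟨q2l, q2u⟩ := q2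
    obtain ⟨q3l, q3u⟩ := q3
    obtain ⟨q5l, q5u⟩ := q5
    obtain ⟨q7l, q7u⟩ := q7
    constructor <;> linarith
  generalize Real.log ((3 * α ^ 2 - 1) * d / 9) = lt at *
  generalize Real.log 10 = xt at *
  clear hT hc hd p2 p3 p5 p7 e hc0 hα h1 h2
  generalize ((23025850929940456840179914546843642076011014886287729760333279009675726096773524802359972050895982983419677840422862486334095254650828067566662873690987816894829 / 10 ^ 160) : ℝ) = y at *
  have fin : ∀ (Q : ℤ) (g : ℤ), 0 ≤ Q → Q ≤ 10 ^ 77 →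
      ((0.19 ≤ Q * T - g * y ∧ Q * T - g * y ≤ 1.2 ∧ |(g:ℝ)| ≤ 10 ^ 80) ∨
      (Q * T - g * y ≤ -0.19 ∧ -1.2 ≤ Q * T - g * y ∧ |(g:ℝ)| ≤ 10 ^ 80)) →
      (0.15 < |(Q : ℝ) * lt - g * xt| ∧ |(Q : ℝ) * lt - g * xt| ≤ 1.3) := by
    intro Q g hQ0 hQ hh
    have hQr : (Q:ℝ) ≤ 10 ^ 77 := by exact_mod_cast hQ
    have hQr0 : (0:ℝ) ≤ Q := by exact_mod_cast hQ0
    have u1 : |(Q:ℝ) * (lt - T)| ≤ 0.01 := by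
      rw [abs_mul, abs_of_nonneg hQr0]
      calc (Q:ℝ) * |lt - T| ≤ 10 ^ 77 * (2 / 10 ^ 88) := by gcongr
        _ ≤ _ := by norm_num
    have hgg : |(g:ℝ)| ≤ 10 ^ 80 := by rcases hh with hh | hh <;> exact hh.2.2
    have u2 : |(g:ℝ) * (xt - y)| ≤ 0.01 := by
      rw [abs_mul]
      calc |(g:ℝ)| * |xt - y| ≤ 10 ^ 80 * (1 / 10 ^ 158) := by gcongr
        _ ≤ _ := by norm_num
    rw [abs_le] at u1 u2
    obtain ⟨u1l, u1u⟩ := u1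
    obtain ⟨u2l, u2u⟩ := u2
    rcases hh with ⟨k1, k2, -⟩ | ⟨k1, k2, -⟩
    · rw [abs_of_pos (by linarith)]; constructor <;> linarith
    · rw [abs_of_neg (by linarith)]; constructor <;> linarith
  constructor
  · refine fin _ _ (by norm_num) (by norm_num) ?_
    push_cast
    rcases hg₁ with ⟨k1, k2, k3⟩ | ⟨k1, k2, k3⟩
    · left; exact ⟨by linarith, k2, k3⟩
    · right; exact ⟨by linarith, k2, k3⟩
  · refine fin _ _ (by norm_num) (by norm_num) ?_
    push_cast
    exact hg₂

theorem theta_1 (α : ℝ) (hα : α ^ 3 = α + 1) (h1 : 1.3247 < α) (h2 : α < 1.3248) :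
    ∃ g₁ g₂ : ℤ,
    (0.15 < |((7259250844085850261090489929171762813393551725081602082225767925361051979737 : ℤ) : ℝ) * Real.log ((3 * α ^ 2 - 1) * (1 : ℕ) / 9) - g₁ * Real.log 10| ∧
     |((7259250844085850261090489929171762813393551725081602082225767925361051979737 : ℤ) : ℝ) * Real.log ((3 * α ^ 2 - 1) * (1 : ℕ) / 9) - g₁ * Real.log 10| ≤ 1.3) ∧
    (0.15 < |((139228 : ℤ) : ℝ) * Real.log ((3 * α ^ 2 - 1) * (1 : ℕ) / 9) - g₂ * Real.log 10| ∧
     |((139228 : ℤ) : ℝ) * Real.log ((3 * α ^ 2 - 1) * (1 : ℕ) / 9) - g₂ * Real.log 10| ≤ 1.3) := by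
  refine ⟨-2354616747881633874911302727301548202227879396370144871761813888057582724757, -45160, ?_⟩
  have hd := log_aux_smooth ((1 : ℕ) : ℝ) 0 0 0 0 (by norm_num)
  exact theta_numeric α hα h1 h2 1 (by norm_num) 0 0 0 0 (-2354616747881633874911302727301548202227879396370144871761813888057582724757) (-45160) hd
    (-74686844962844357459984812337959594312275676115681080017992666217705349956054223771857673245647 / 10 ^ 95) (by norm_num) (by left; norm_num) (by right; norm_num)

theorem theta_2 (α : ℝ) (hα : α ^ 3 = α + 1) (h1 : 1.3247 < α) (h2 : α < 1.3248) :
    ∃ g₁ g₂ : ℤ,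
    (0.15 < |((7259250844085850261090489929171762813393551725081602082225767925361051979737 : ℤ) : ℝ) * Real.log ((3 * α ^ 2 - 1) * (2 : ℕ) / 9) - g₁ * Real.log 10| ∧
     |((7259250844085850261090489929171762813393551725081602082225767925361051979737 : ℤ) : ℝ) * Real.log ((3 * α ^ 2 - 1) * (2 : ℕ) / 9) - g₁ * Real.log 10| ≤ 1.3) ∧
    (0.15 < |((139228 : ℤ) : ℝ) * Real.log ((3 * α ^ 2 - 1) * (2 : ℕ) / 9) - g₂ * Real.log 10| ∧
     |((139228 : ℤ) : ℝ) * Real.log ((3 * α ^ 2 - 1) * (2 : ℕ) / 9) - g₂ * Real.log 10| ≤ 1.3) := by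
  refine ⟨-169364497762718539432018058482743890107512698201305629852241569630192053050, -3248, ?_⟩
  have hd := log_aux_smooth ((2 : ℕ) : ℝ) 1 0 0 0 (by norm_num)
  exact theta_numeric α hα h1 h2 2 (by norm_num) 1 0 0 0 (-169364497762718539432018058482743890107512698201305629852241569630192053050) (-3248) hd
    (-5372126906849826518261600192141937504725662679655554605924665268365987759084752211271340546005 / 10 ^ 95) (by norm_num) (by right; norm_num) (by right; norm_num)

theorem theta_3 (α : ℝ) (hα : α ^ 3 = α + 1) (h1 : 1.3247 < α) (h2 : α < 1.3248) :
    ∃ g₁ g₂ : ℤ,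
    (0.15 < |((7259250844085850261090489929171762813393551725081602082225767925361051979737 : ℤ) : ℝ) * Real.log ((3 * α ^ 2 - 1) * (3 : ℕ) / 9) - g₁ * Real.log 10| ∧
     |((7259250844085850261090489929171762813393551725081602082225767925361051979737 : ℤ) : ℝ) * Real.log ((3 * α ^ 2 - 1) * (3 : ℕ) / 9) - g₁ * Real.log 10| ≤ 1.3) ∧
    (0.15 < |((139228 : ℤ) : ℝ) * Real.log ((3 * α ^ 2 - 1) * (3 : ℕ) / 9) - g₂ * Real.log 10| ∧
     |((139228 : ℤ) : ℝ) * Real.log ((3 * α ^ 2 - 1) * (3 : ℕ) / 9) - g₂ * Real.log 10| ≤ 1.3) := by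
  refine ⟨1108926123173375640707230827026297090792516091321678214443484163654435419884, 21269, ?_⟩
  have hd := log_aux_smooth ((3 : ℕ) : ℝ) 0 1 0 0 (by norm_num)
  exact theta_numeric α hα h1 h2 3 (by norm_num) 0 1 0 0 (1108926123173375640707230827026297090792516091321678214443484163654435419884) (21269) hd
    (35174383903966611679539711354292976152473379666593865155476767146044079365806672915503902235726 / 10 ^ 95) (by norm_num) (by left; norm_num) (by right; norm_num)

theorem theta_4 (α : ℝ) (hα : α ^ 3 = α + 1) (h1 : 1.3247 < α) (h2 : α < 1.3248) :
    ∃ g₁ g₂ : ℤ,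
    (0.15 < |((7259250844085850261090489929171762813393551725081602082225767925361051979737 : ℤ) : ℝ) * Real.log ((3 * α ^ 2 - 1) * (4 : ℕ) / 9) - g₁ * Real.log 10| ∧
     |((7259250844085850261090489929171762813393551725081602082225767925361051979737 : ℤ) : ℝ) * Real.log ((3 * α ^ 2 - 1) * (4 : ℕ) / 9) - g₁ * Real.log 10| ≤ 1.3) ∧
    (0.15 < |((139228 : ℤ) : ℝ) * Real.log ((3 * α ^ 2 - 1) * (4 : ℕ) / 9) - g₂ * Real.log 10| ∧
     |((139228 : ℤ) : ℝ) * Real.log ((3 * α ^ 2 - 1) * (4 : ℕ) / 9) - g₂ * Real.log 10| ≤ 1.3) := by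
  refine ⟨2015887752356196796047266610336060422012853999967533612057330748797198618657, 38663, ?_⟩
  have hd := log_aux_smooth ((4 : ℕ) : ℝ) 2 0 0 0 (by norm_num)
  exact theta_numeric α hα h1 h2 4 (by norm_num) 2 0 0 0 (2015887752356196796047266610336060422012853999967533612057330748797198618657) (38663) hd
    (63942591149144704423461611953675719302824350756369970806143335680973374437884719349314992153637 / 10 ^ 95) (by norm_num) (by right; norm_num) (by left; norm_num)

theorem theta_5 (α : ℝ) (hα : α ^ 3 = α + 1) (h1 : 1.3247 < α) (h2 : α < 1.3248) :
    ∃ g₁ g₂ : ℤ,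
    (0.15 < |((7259250844085850261090489929171762813393551725081602082225767925361051979737 : ℤ) : ℝ) * Real.log ((3 * α ^ 2 - 1) * (5 : ℕ) / 9) - g₁ * Real.log 10| ∧
     |((7259250844085850261090489929171762813393551725081602082225767925361051979737 : ℤ) : ℝ) * Real.log ((3 * α ^ 2 - 1) * (5 : ℕ) / 9) - g₁ * Real.log 10| ≤ 1.3) ∧
    (0.15 < |((139228 : ℤ) : ℝ) * Real.log ((3 * α ^ 2 - 1) * (5 : ℕ) / 9) - g₂ * Real.log 10| ∧
     |((139228 : ℤ) : ℝ) * Real.log ((3 * α ^ 2 - 1) * (5 : ℕ) / 9) - g₂ * Real.log 10| ≤ 1.3) := by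
  refine ⟨2719381846085301050699902533051410299045305630542617968554381718876078583274, 52156, ?_⟩
  have hd := log_aux_smooth ((5 : ℕ) : ℝ) 0 0 1 0 (by norm_num)
  exact theta_numeric α hα h1 h2 5 (by norm_num) 0 0 1 0 (2719381846085301050699902533051410299045305630542617968554381718876078583274) (52156) hd
    (86256946280565680000091120984659169640284459311170692173272122929712548814711552691155714563671 / 10 ^ 95) (by norm_num) (by right; norm_num) (by left; norm_num)

theorem theta_6 (α : ℝ) (hα : α ^ 3 = α + 1) (h1 : 1.3247 < α) (h2 : α < 1.3248) :
    ∃ g₁ g₂ : ℤ,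
    (0.15 < |((7259250844085850261090489929171762813393551725081602082225767925361051979737 : ℤ) : ℝ) * Real.log ((3 * α ^ 2 - 1) * (6 : ℕ) / 9) - g₁ * Real.log 10| ∧
     |((7259250844085850261090489929171762813393551725081602082225767925361051979737 : ℤ) : ℝ) * Real.log ((3 * α ^ 2 - 1) * (6 : ℕ) / 9) - g₁ * Real.log 10| ≤ 1.3) ∧
    (0.15 < |((139228 : ℤ) : ℝ) * Real.log ((3 * α ^ 2 - 1) * (6 : ℕ) / 9) - g₂ * Real.log 10| ∧
     |((139228 : ℤ) : ℝ) * Real.log ((3 * α ^ 2 - 1) * (6 : ℕ) / 9) - g₂ * Real.log 10| ≤ 1.3) := by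
  refine ⟨3294178373292290976186515495845101402912882789490517456353056482081826091591, 63180, ?_⟩
  have hd := log_aux_smooth ((6 : ℕ) : ℝ) 1 1 0 0 (by norm_num)
  exact theta_numeric α hα h1 h2 6 (by norm_num) 1 1 0 0 (3294178373292290976186515495845101402912882789490517456353056482081826091591) (63180) hd
    (104489101959961142621262923500110632960023393102619390567544768095383441562776144476090234935368 / 10 ^ 95) (by norm_num) (by left; norm_num) (by left; norm_num)

theorem theta_7 (α : ℝ) (hα : α ^ 3 = α + 1) (h1 : 1.3247 < α) (h2 : α < 1.3248) :
    ∃ g₁ g₂ : ℤ,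
    (0.15 < |((7259250844085850261090489929171762813393551725081602082225767925361051979737 : ℤ) : ℝ) * Real.log ((3 * α ^ 2 - 1) * (7 : ℕ) / 9) - g₁ * Real.log 10| ∧
     |((7259250844085850261090489929171762813393551725081602082225767925361051979737 : ℤ) : ℝ) * Real.log ((3 * α ^ 2 - 1) * (7 : ℕ) / 9) - g₁ * Real.log 10| ≤ 1.3) ∧
    (0.15 < |((139228 : ℤ) : ℝ) * Real.log ((3 * α ^ 2 - 1) * (7 : ℕ) / 9) - g₂ * Real.log 10| ∧
     |((139228 : ℤ) : ℝ) * Real.log ((3 * α ^ 2 - 1) * (7 : ℕ) / 9) - g₂ * Real.log 10| ≤ 1.3) := by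
  refine ⟨3780161912427157682851403523419330595736450705199294599444578837412650301283, 72501, ?_⟩
  have hd := log_aux_smooth ((7 : ℕ) : ℝ) 0 0 0 1 (by norm_num)
  exact theta_numeric α hα h1 h2 7 (by norm_num) 0 0 0 1 (3780161912427157682851403523419330595736450705199294599444578837412650301283) (72501) hd
    (119904169942686973050550462006358378651432796842505038827946348776052636319152703006908176613140 / 10 ^ 95) (by norm_num) (by right; norm_num) (by left; norm_num)

theorem theta_8 (α : ℝ) (hα : α ^ 3 = α + 1) (h1 : 1.3247 < α) (h2 : α < 1.3248) :
    ∃ g₁ g₂ : ℤ,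
    (0.15 < |((7259250844085850261090489929171762813393551725081602082225767925361051979737 : ℤ) : ℝ) * Real.log ((3 * α ^ 2 - 1) * (8 : ℕ) / 9) - g₁ * Real.log 10| ∧
     |((7259250844085850261090489929171762813393551725081602082225767925361051979737 : ℤ) : ℝ) * Real.log ((3 * α ^ 2 - 1) * (8 : ℕ) / 9) - g₁ * Real.log 10| ≤ 1.3) ∧
    (0.15 < |((139228 : ℤ) : ℝ) * Real.log ((3 * α ^ 2 - 1) * (8 : ℕ) / 9) - g₂ * Real.log 10| ∧
     |((139228 : ℤ) : ℝ) * Real.log ((3 * α ^ 2 - 1) * (8 : ℕ) / 9) - g₂ * Real.log 10| ≤ 1.3) := by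
  refine ⟨4201140002475112131526551279154864734133220698136372853966903067224589290363, 80575, ?_⟩
  have hd := log_aux_smooth ((8 : ℕ) : ℝ) 3 0 0 0 (by norm_num)
  exact theta_numeric α hα h1 h2 8 (by norm_num) 3 0 0 0 (4201140002475112131526551279154864734133220698136372853966903067224589290363) (80575) hd
    (133257309205139235365184824099493376110374364192395496218211336630312736634854190909901324853279 / 10 ^ 95) (by norm_num) (by left; norm_num) (by left; norm_num)

theorem theta_9 (α : ℝ) (hα : α ^ 3 = α + 1) (h1 : 1.3247 < α) (h2 : α < 1.3248) :
    ∃ g₁ g₂ : ℤ,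
    (0.15 < |((7259250844085850261090489929171762813393551725081602082225767925361051979737 : ℤ) : ℝ) * Real.log ((3 * α ^ 2 - 1) * (9 : ℕ) / 9) - g₁ * Real.log 10| ∧
     |((7259250844085850261090489929171762813393551725081602082225767925361051979737 : ℤ) : ℝ) * Real.log ((3 * α ^ 2 - 1) * (9 : ℕ) / 9) - g₁ * Real.log 10| ≤ 1.3) ∧
    (0.15 < |((139228 : ℤ) : ℝ) * Real.log ((3 * α ^ 2 - 1) * (9 : ℕ) / 9) - g₂ * Real.log 10| ∧
     |((139228 : ℤ) : ℝ) * Real.log ((3 * α ^ 2 - 1) * (9 : ℕ) / 9) - g₂ * Real.log 10| ≤ 1.3) := by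
  refine ⟨4572468994228385156325764381354142383812911579013501300648782215366453564526, 87697, ?_⟩
  have hd := log_aux_smooth ((9 : ℕ) : ℝ) 0 2 0 0 (by norm_num)
  exact theta_numeric α hα h1 h2 9 (by norm_num) 0 2 0 0 (4572468994228385156325764381354142383812911579013501300648782215366453564526) (87697) hd
    (145035612770777580819064235046545546617222435448868810328946200509793508687667569602865477717100 / 10 ^ 95) (by norm_num) (by right; norm_num) (by left; norm_num)

theorem theta_all (α : ℝ) (hα : α ^ 3 = α + 1) (h1 : 1.3247 < α) (h2 : α < 1.3248)
    (d : ℕ) (hd1 : 1 ≤ d) (hd : d ≤ 9) : ∃ g₁ g₂ : ℤ,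
    (0.15 < |((7259250844085850261090489929171762813393551725081602082225767925361051979737 : ℤ) : ℝ) * Real.log ((3 * α ^ 2 - 1) * d / 9) - g₁ * Real.log 10| ∧
     |((7259250844085850261090489929171762813393551725081602082225767925361051979737 : ℤ) : ℝ) * Real.log ((3 * α ^ 2 - 1) * d / 9) - g₁ * Real.log 10| ≤ 1.3) ∧
    (0.15 < |((139228 : ℤ) : ℝ) * Real.log ((3 * α ^ 2 - 1) * d / 9) - g₂ * Real.log 10| ∧
     |((139228 : ℤ) : ℝ) * Real.log ((3 * α ^ 2 - 1) * d / 9) - g₂ * Real.log 10| ≤ 1.3) := by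
  obtain rfl | rfl | rfl | rfl | rfl | rfl | rfl | rfl | rfl : d = 1 ∨ d = 2 ∨ d = 3 ∨ d = 4 ∨
    d = 5 ∨ d = 6 ∨ d = 7 ∨ d = 8 ∨ d = 9 := by omega
  · exact theta_1 α hα h1 h2
  · exact theta_2 α hα h1 h2
  · exact theta_3 α hα h1 h2
  · exact theta_4 α hα h1 h2
  · exact theta_5 α hα h1 h2
  · exact theta_6 α hα h1 h2
  · exact theta_7 α hα h1 h2
  · exact theta_8 α hα h1 h2
  · exact theta_9 α hα h1 h2

theorem baker_small (α : ℝ) (hα : α ^ 3 = α + 1) (h1 : 1.3247 < α) (h2 : α < 1.3248)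
    (n' M d k : ℕ) (hd1 : 1 ≤ d) (hd : d ≤ 9) (δ : ℝ) (hM : M < 10 ^ 72) (hk : M ≤ 2 * k)
    (hn : n' ≤ 10 * M) (hk54 : 54 ≤ k) (hδ : |δ| ≤ 10 / 10 ^ k)
    (hrel : α ^ n' = ((3 * α ^ 2 - 1) * d / 9) * 10 ^ M * (1 + δ)) : False := by
  obtain ⟨g₁, g₂, ⟨a1, a2⟩, b1, b2⟩ := theta_all α hα h1 h2 d hd1 hd
  obtain ⟨e1, e2⟩ := e_one α hα h1 h2
  have hc0 := (c_bounds α h1 h2).1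
  have hd0 : (0:ℝ) < d := by exact_mod_cast hd1
  have hk10 : (10:ℝ) ^ 54 ≤ 10 ^ k := pow_le_pow_right₀ (by norm_num) hk54
  have hδh : |δ| ≤ 1 / 2 := by
    refine hδ.trans ?_
    rw [div_le_iff₀ (by positivity)]
    linarith [show (100:ℝ) ≤ 10 ^ 54 by norm_num]
  obtain ⟨dl, du⟩ := abs_le.mp hδh
  have hL : 2 ≤ Real.log 10 := by
    have := (abs_le.mp log_ten_num).1
    norm_num at this ⊢
    linarith
  have hlam : |n' * Real.log α - M * Real.log 10 - Real.log ((3 * α ^ 2 - 1) * d / 9)| ≤ 20 / 10 ^ k := by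
    have hth : 0 < (3 * α ^ 2 - 1) * d / 9 := by
      apply div_pos (mul_pos (by linarith) hd0) (by norm_num)
    have h := congrArg Real.log hrel
    rw [Real.log_mul (by positivity) (by linarith), Real.log_mul hth.ne' (by positivity), Real.log_pow,
      Real.log_pow] at h
    have e : n' * Real.log α - M * Real.log 10 - Real.log ((3 * α ^ 2 - 1) * d / 9) = Real.log (1 + δ) := by
      linarith
    rw [e]
    have u1 := Real.log_le_sub_one_of_pos (show 0 < 1 + δ by linarith)
    have u2 := Real.one_sub_inv_le_log_of_pos (show 0 < 1 + δ by linarith)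
    have u3 : -(2 * |δ|) ≤ 1 - (1 + δ)⁻¹ := by
      have : 1 - (1 + δ)⁻¹ = δ * (1 + δ)⁻¹ := by
        have : 1 + δ ≠ 0 := by linarith
        field_simp; ring
      rw [this]
      have u4 : (1 + δ)⁻¹ ≤ 2 := by
        rw [inv_le_comm₀ (by linarith) (by norm_num)]; linarith
      have u5 : 0 < (1 + δ)⁻¹ := by apply inv_pos.mpr; linarith
      have u6 := neg_abs_le (δ * (1 + δ)⁻¹)
      rw [abs_mul, abs_of_pos u5] at u6
      have u7 : |δ| * (1 + δ)⁻¹ ≤ |δ| * 2 := by gcongr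
      linarith
    have u8 := le_abs_self δ
    have u9 := abs_nonneg δ
    have u10 : (20:ℝ) / 10 ^ k = 2 * (10 / 10 ^ k) := by ring
    rw [u10, abs_le]
    constructor <;> linarith
  by_cases hM2 : M < 160
  · refine bd_generic _ _ _ _ 0.15 (20 / 10 ^ 54) 1600 n' M _ _ g₂ ?_ (by norm_num) e2 hL (hlam.trans ?_) b1 b2 ?_ (by norm_num)
    · have : n' ≤ 1600 := by omega
      exact_mod_cast this
    · gcongr
    · norm_num
  · have hk80 : (10:ℝ) ^ 80 ≤ 10 ^ k := pow_le_pow_right₀ (by norm_num) (by omega)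
    refine bd_generic _ _ _ _ 0.15 (20 / 10 ^ 80) (10 ^ 73) n' M _ _ g₁ ?_ (by norm_num) e1 hL (hlam.trans ?_) a1 a2 ?_ (by norm_num)
    · have : n' ≤ 10 ^ 73 := by omega
      exact_mod_cast this
    · gcongr
    · norm_num

/-- If `n ≥ 1` and `P n = (1/9)(d₁·10^(ℓ₁+ℓ₂) − (d₁−d₂)·10^ℓ₂ − d₂)` with distinct
digits `d₁ ≠ d₂`, `d₁ > 0`, `ℓ₁, ℓ₂ ≥ 1`, then `ℓ₁ ≤ 53`. -/
theorem ell1_reduced_bound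
    (n d₁ d₂ ℓ₁ ℓ₂ : ℕ) (hn : 1 ≤ n)
    (hd₁ : d₁ ≤ 9) (hd₂ : d₂ ≤ 9) (hne : d₁ ≠ d₂) (hd₁pos : 0 < d₁)
    (hℓ₁ : 1 ≤ ℓ₁) (hℓ₂ : 1 ≤ ℓ₂)
    (heq : (9 : ℤ) * (padovan n : ℤ) =
      (d₁ : ℤ) * 10 ^ (ℓ₁ + ℓ₂) - ((d₁ : ℤ) - (d₂ : ℤ)) * 10 ^ ℓ₂ - (d₂ : ℤ)) :
    ℓ₁ ≤ 53 := by
  by_contra hcon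
  have h54 : 54 ≤ ℓ₁ := by omega
  have heqN : 9 * padovan n + d₂ + d₁ * 10 ^ ℓ₂ = d₂ * 10 ^ ℓ₂ + d₁ * 10 ^ (ℓ₁ + ℓ₂) := by
    zify
    linear_combination heq
  by_cases h0 : d₂ = 0
  · subst h0
    obtain ⟨α, hα, h1, h2⟩ := exists_alpha
    have heq0 : 9 * padovan n + d₁ * 10 ^ ℓ₂ = d₁ * 10 ^ (ℓ₁ + ℓ₂) := by
      rw [Nat.zero_mul, Nat.zero_add, Nat.add_zero] at heqN; exact heqN
    obtain ⟨δ, hδ, hn', hM, hrel⟩ := d2_zero_setup α hα h1 h2 n d₁ ℓ₁ ℓ₂ hd₁pos hd₁ hn h54 heq0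
    rcases Nat.lt_or_ge (ℓ₁ + ℓ₂) (10 ^ 72) with hlt | hge
    · exact baker_small α hα h1 h2 (n + 3) (ℓ₁ + ℓ₂) d₁ ℓ₁ hd₁pos hd₁ δ hlt hM hn' h54 hδ hrel
    · exact baker_large α hα h1 h2 (n + 3) (ℓ₁ + ℓ₂) d₁ ℓ₁ hd₁pos hd₁ δ hge hM hδ hrel
  · exact case_d2_pos n d₁ d₂ ℓ₁ ℓ₂ hd₁ hd₂ hne hd₁pos h54 hℓ₂ heqN h0
end

section
/- For all integers n with 0 ≤ n ≤ 500, digits d₁, d₂ ∈ {0,…,9} with d₁ ≠ d₂ and d₁ > 0, and integers ℓ₁, ℓ₂ ≥ 1: if P_n = d₁·((10^{ℓ₁} − 1)/9)·10^{ℓ₂} + d₂·((10^{ℓ₂} − 1)/9), then P_n ∈ {12, 16, 21, 28, 37, 49, 65, 86, 114, 200}. -/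
/-- Repunit with `k` digits. -/
def repu (k : ℕ) : ℕ := (10 ^ k - 1) / 9

theorem repu_spec (k : ℕ) : 9 * repu k + 1 = 10 ^ k := by
  have h : 9 ∣ 10 ^ k - 1 := by
    have := Nat.sub_dvd_pow_sub_pow 10 1 k
    simpa using this
  have h1 : 1 ≤ 10 ^ k := Nat.one_le_pow _ _ (by norm_num)
  unfold repu
  omega

theorem repu_succ (k : ℕ) : repu (k + 1) = 10 * repu k + 1 := by
  have h1 := repu_spec k
  have h2 := repu_spec (k + 1)
  rw [pow_succ] at h2
  omega

/-- No prefix length in range makes `M` a repdigit. -/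
def noPrefix (M : ℕ) : ℕ → Bool
  | 0 => true
  | k + 1 => !(Nat.beq M ((M % 10) * repu (k + 1))) && noPrefix M k

/-- No splitting of `N` with suffix length in range is a concatenation of two repdigits. -/
def noSplit (N : ℕ) : ℕ → Bool
  | 0 => true
  | k + 1 =>
    (!(Nat.beq (N % 10 ^ (k + 1)) ((N % 10) * repu (k + 1))) ||
      (Nat.beq (N / 10 ^ (k + 1) % 10) (N % 10) || Nat.beq (N / 10 ^ (k + 1) % 10) 0 ||
        noPrefix (N / 10 ^ (k + 1)) 63)) &&
      noSplit N k

/-- The listed values. -/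
def listed (N : ℕ) : Bool :=
  [12, 16, 21, 28, 37, 49, 65, 86, 114, 200].any (Nat.beq N)

/-- Full test of one value. -/
def good (N : ℕ) : Bool := Nat.blt N (10 ^ 62) && (listed N || noSplit N 63)

/-- Test of `k` consecutive terms of the sequence, given the next three. -/
def goodFrom : ℕ → ℕ → ℕ → ℕ → Bool
  | 0, _, _, _ => true
  | k + 1, a, b, c => good a && goodFrom k b c (a + b)

theorem goodFrom_run : goodFrom 501 0 1 1 = true := by decide +kernel

theorem goodFrom_spec (k m i : ℕ)
    (h : goodFrom k (padovan m) (padovan (m + 1)) (padovan (m + 2)) = true) (hi : i < k) :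
    good (padovan (m + i)) = true := by
  induction k generalizing m i with
  | zero => omega
  | succ k ih =>
    simp only [goodFrom, Bool.and_eq_true] at h
    cases i with
    | zero => exact h.1
    | succ i =>
      have h3 : padovan (m + 1 + 2) = padovan m + padovan (m + 1) := by
        rw [show m + 1 + 2 = m + 3 from rfl, padovan, add_comm]
      have := ih (m + 1) i (by rw [h3]; exact h.2) (by omega)
      rwa [show m + (i + 1) = m + 1 + i by omega]

theorem noPrefix_spec (M k l : ℕ) (h : noPrefix M k = true) (h1 : 1 ≤ l) (hl : l ≤ k) :
    M ≠ (M % 10) * repu l := by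
  induction k with
  | zero => omega
  | succ k ih =>
    simp only [noPrefix, Bool.and_eq_true, Bool.not_eq_true'] at h
    rcases Nat.lt_or_ge k l with hk | hk
    · obtain rfl : l = k + 1 := by omega
      exact Nat.ne_of_beq_eq_false h.1
    · exact ih h.2 hk

theorem noSplit_spec (N k l : ℕ) (h : noSplit N k = true) (h1 : 1 ≤ l) (hl : l ≤ k)
    (hs : N % 10 ^ l = (N % 10) * repu l) (hd : N / 10 ^ l % 10 ≠ N % 10)
    (h0 : N / 10 ^ l % 10 ≠ 0) :
    noPrefix (N / 10 ^ l) 63 = true := by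
  induction k with
  | zero => omega
  | succ k ih =>
    simp only [noSplit, Bool.and_eq_true, Bool.or_eq_true, Bool.not_eq_true'] at h
    rcases Nat.lt_or_ge k l with hk | hk
    · obtain rfl : l = k + 1 := by omega
      rcases h.1 with h | (h | h) | h
      · exact absurd hs (Nat.ne_of_beq_eq_false h)
      · exact absurd (Nat.eq_of_beq_eq_true h) hd
      · exact absurd (Nat.eq_of_beq_eq_true h) h0
      · exact h
    · exact ih h.2 hk

theorem digit_mul_repu_mod (d l : ℕ) (hd : d ≤ 9) (hl : 1 ≤ l) : d * repu l % 10 = d := by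
  obtain ⟨k, rfl⟩ : ∃ k, l = k + 1 := ⟨l - 1, by omega⟩
  rw [repu_succ, mul_add, mul_left_comm, mul_one]
  omega

/-- For `0 ≤ n ≤ 500`, the only Padovan numbers that are concatenations of two distinct
repdigits are `12, 16, 21, 28, 37, 49, 65, 86, 114, 200`. -/
theorem small_range_padovan_concat
    (n d₁ d₂ ℓ₁ ℓ₂ : ℕ) (hn : n ≤ 500)
    (hd₁ : d₁ ≤ 9) (hd₂ : d₂ ≤ 9) (hne : d₁ ≠ d₂) (hd₁pos : 0 < d₁)
    (hℓ₁ : 1 ≤ ℓ₁) (hℓ₂ : 1 ≤ ℓ₂)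
    (heq : padovan n = d₁ * ((10 ^ ℓ₁ - 1) / 9) * 10 ^ ℓ₂ + d₂ * ((10 ^ ℓ₂ - 1) / 9)) :
    padovan n ∈ ({12, 16, 21, 28, 37, 49, 65, 86, 114, 200} : Set ℕ) := by
  have hg : good (padovan n) = true := by
    have := goodFrom_spec 501 0 n goodFrom_run (by omega)
    rwa [zero_add] at this
  change padovan n = d₁ * repu ℓ₁ * 10 ^ ℓ₂ + d₂ * repu ℓ₂ at heq
  generalize padovan n = N at *
  simp only [good, Bool.and_eq_true, Bool.or_eq_true] at hg
  obtain ⟨hlt, hg | hg⟩ := hg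
  · simp only [listed, List.any_cons, List.any_nil, Bool.or_eq_true, Nat.beq_eq,
      Bool.false_eq_true, or_false] at hg
    simpa using hg
  exfalso
  have hN : N < 10 ^ 62 := by simpa [Nat.blt_eq] using hlt
  have s1 := repu_spec ℓ₁
  have s2 := repu_spec ℓ₂
  have hm2 : d₂ * repu ℓ₂ < 10 ^ ℓ₂ := by nlinarith
  have hpos2 : 0 < 10 ^ ℓ₂ := by positivity
  have hr1 : 1 ≤ repu ℓ₁ := by
    have : 10 ^ 1 ≤ 10 ^ ℓ₁ := Nat.pow_le_pow_right (by norm_num) hℓ₁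
    omega
  have hM1 : repu ℓ₁ ≤ d₁ * repu ℓ₁ := Nat.le_mul_of_pos_left _ hd₁pos
  have hA : d₁ * repu ℓ₁ ≤ N := by
    have := Nat.le_mul_of_pos_right (d₁ * repu ℓ₁) hpos2
    omega
  have hB : 10 ^ ℓ₂ ≤ N := by
    have := Nat.le_mul_of_pos_left (10 ^ ℓ₂) (show 0 < d₁ * repu ℓ₁ by omega)
    omega
  have hl2 : ℓ₂ < 62 := (Nat.pow_lt_pow_iff_right (by norm_num)).1 (lt_of_le_of_lt hB hN)
  have hl1 : ℓ₁ < 64 := by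
    refine (Nat.pow_lt_pow_iff_right (a := 10) (by norm_num)).1 ?_
    omega
  have hdiv : N / 10 ^ ℓ₂ = d₁ * repu ℓ₁ := by
    rw [heq, mul_comm _ (10 ^ ℓ₂), Nat.mul_add_div hpos2, Nat.div_eq_of_lt hm2, add_zero]
  have hmod : N % 10 ^ ℓ₂ = d₂ * repu ℓ₂ := by
    rw [heq, mul_comm _ (10 ^ ℓ₂), Nat.mul_add_mod, Nat.mod_eq_of_lt hm2]
  have hlast : N % 10 = d₂ := by
    rw [← Nat.mod_mod_of_dvd N (dvd_pow_self 10 (by omega : ℓ₂ ≠ 0)), hmod]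
    exact digit_mul_repu_mod d₂ ℓ₂ hd₂ hℓ₂
  have hfirst : N / 10 ^ ℓ₂ % 10 = d₁ := by
    rw [hdiv]
    exact digit_mul_repu_mod d₁ ℓ₁ hd₁ hℓ₁
  have hp := noSplit_spec N 63 ℓ₂ hg hℓ₂ (by omega) (by rw [hmod, hlast])
    (by rw [hfirst, hlast]; exact hne) (by omega)
  exact noPrefix_spec _ 63 ℓ₁ hp hℓ₁ (by omega) (by rw [hfirst, hdiv])
end
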